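/- arXiv:math/0411282 — 7 statements merged into one kernel-verified Lean document; each statement's English description precedes it below -/
import Mathlib

section
/- Let (μ_x)_{x>0} be a family of probability measures on ℝ, each concentrated on [0,∞), such that: (i) each μ_x has a density g_x with respect to Lebesgue measure on [0,∞) which is strictly positive almost everywhere on [0,∞); (ii) μ_x ∗ μ_y = μ_{x+y} for all x, y > 0; (iii) μ_x converges weakly to the Dirac measure δ_0 as x → 0+. Let m : (0,∞) → ℝ satisfy μ_x([0, m(x)]) = 1/2 for every x > 0. Then m is continuous and strictly increasing on (0,∞). -/
open MeasureTheory Filter Set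
open scoped MeasureTheory

lemma core_sum_mem {n : ℕ} (ν : Measure ℝ) [IsProbabilityMeasure ν]
    (t : Fin n → ℝ) (ht : ∀ i, t i ∈ ν.support) :
    ∑ i, t i ∈ ((Measure.pi fun _ : Fin n => ν).map (fun ω => ∑ i, ω i)).support := by
  rw [Measure.support_eq_forall_isOpen]
  intro u hu ho
  have hm : Measurable (fun ω : Fin n → ℝ => ∑ i, ω i) := by fun_prop
  have hc : Continuous (fun ω : Fin n → ℝ => ∑ i, ω i) := by fun_prop
  rw [Measure.map_apply hm ho.measurableSet]
  have ho' := ho.preimage hc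
  rw [isOpen_pi_iff'] at ho'
  obtain ⟨v, hv, hvs⟩ := ho' t hu
  refine lt_of_lt_of_le ?_ (measure_mono hvs)
  rw [Measure.pi_pi]
  refine pos_iff_ne_zero.2 (Finset.prod_ne_zero_iff.2 fun i _ => ?_)
  have := ht i
  rw [Measure.support_eq_forall_isOpen] at this
  exact (this (v i) (hv i).2 (hv i).1).ne'

lemma core (ρ ν : Measure ℝ) [IsProbabilityMeasure ρ] [IsProbabilityMeasure ν] (n : ℕ)
    (hn : 0 < n) (hmap : (Measure.pi fun _ : Fin n => ν).map (fun ω => ∑ i, ω i) = ρ)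
    (hν0 : ∀ t ∈ ν.support, 0 ≤ t) {c l δ ε : ℝ} (hδ : 0 < δ) (hε : 0 < ε)
    (hcS : c ∈ ρ.support) (hgap : ∀ t ∈ ρ.support, c < t → c + δ ≤ t)
    (hl : ∀ t ∈ ρ.support, l ≤ t) :
    ∃ M, ρ (Iio (l + δ / 2)) ≤
      ρ (Ioo (M - ε) (M + ε)) + ENNReal.ofReal ((c + 1) ^ 2 / (n * ε ^ 2)) := by
  have hn' : (0:ℝ) < n := by exact_mod_cast hn
  have : Nonempty (Fin n) := ⟨⟨0, hn⟩⟩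
  set P := Measure.pi fun _ : Fin n => ν with hP
  have hm : Measurable (fun ω : Fin n → ℝ => ∑ i, ω i) := by fun_prop
  have hae : ∀ᵐ ω ∂P, ∀ i, ω i ∈ ν.support := by
    rw [ae_all_iff]
    intro i
    exact (Measure.quasiMeasurePreserving_eval (fun _ : Fin n => ν) i).ae Measure.support_mem_ae
  have hsum : ∀ t : Fin n → ℝ, (∀ i, t i ∈ ν.support) → ∑ i, t i ∈ ρ.support := by
    intro t ht; rw [← hmap]; exact core_sum_mem ν t ht
  obtain ⟨η, hη0, hηδ, hηn⟩ : ∃ η : ℝ, 0 < η ∧ η ≤ δ / 2 ∧ η ≤ 1 / n :=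
    ⟨min (δ / 2) (1 / n), by positivity, min_le_left _ _, min_le_right _ _⟩
  -- choose a point near c
  obtain ⟨w, hwT, hw1, hw2⟩ : ∃ w : Fin n → ℝ, (∀ i, w i ∈ ν.support) ∧
      c - η < ∑ i, w i ∧ ∑ i, w i ≤ c := by
    have h1 : 0 < ρ (Ioo (c - η) (c + η)) :=
      (Measure.mem_support_iff_forall c).1 hcS _ (Ioo_mem_nhds (by linarith) (by linarith))
    rw [← hmap, Measure.map_apply hm measurableSet_Ioo] at h1
    obtain ⟨w, hw, hwT⟩ := ((frequently_ae_mem_iff.2 h1.ne').and_eventually hae).exists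
    refine ⟨w, hwT, hw.1, ?_⟩
    by_contra hcon
    push Not at hcon
    have := hgap _ (hsum w hwT) hcon
    have h3 : ∑ i, w i < c + η := hw.2
    linarith
  have hc0 : 0 ≤ c := le_trans (Finset.sum_nonneg fun i _ => hν0 _ (hwT i)) hw2
  obtain ⟨i0, -, hi0⟩ : ∃ i ∈ Finset.univ, w i ≤ c / n := by
    apply Finset.exists_le_of_sum_le Finset.univ_nonempty
    simp only [Finset.sum_const, Finset.card_univ, Fintype.card_fin, nsmul_eq_mul]
    rw [mul_div_cancel₀ _ hn'.ne']
    exact hw2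
  set s := w i0 + η with hs
  have hs0 : 0 ≤ s := by have := hν0 _ (hwT i0); linarith
  have hsn : s ≤ (c + 1) / n := by rw [add_div]; linarith
  have hgapT : ∀ t ∈ ν.support, s < t → s + δ / 2 ≤ t := by
    intro t ht hst
    have h1 := hsum (Function.update w i0 t) (by
      intro i
      by_cases h : i = i0
      · subst h; simpa using ht
      · simpa [h] using hwT i)
    have h2 : ∑ i, Function.update w i0 t i = ∑ i, w i - w i0 + t := by
      rw [Finset.sum_update_of_mem (Finset.mem_univ i0), Finset.sdiff_singleton_eq_erase]
      rw [← Finset.add_sum_erase _ w (Finset.mem_univ i0)]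
      ring
    rw [h2] at h1
    have := hgap _ h1 (by linarith)
    linarith
  -- infimum of the support
  have hTne : ν.support.Nonempty := ⟨_, hwT i0⟩
  have hTbdd : BddBelow ν.support := ⟨0, fun t ht => hν0 t ht⟩
  set L := sInf ν.support with hL
  have hLT : L ∈ ν.support := Measure.isClosed_support.csInf_mem hTne hTbdd
  have hLle : ∀ t ∈ ν.support, L ≤ t := fun t ht => csInf_le hTbdd ht
  have hlL : l ≤ n * L := by
    have := hl _ (hsum (fun _ => L) fun _ => hLT)
    simpa using this
  have hXs : ∀ ω : Fin n → ℝ, (∀ i, ω i ∈ ν.support) → ∑ i, ω i < l + δ / 2 →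
      ∀ i, ω i ≤ s := by
    intro ω hω hlt i
    by_contra hcon
    push Not at hcon
    have h1 := hgapT _ (hω i) hcon
    have h2 : ∑ j ∈ Finset.univ.erase i, L ≤ ∑ j ∈ Finset.univ.erase i, ω j :=
      Finset.sum_le_sum fun j _ => hLle _ (hω j)
    have h3 := Finset.add_sum_erase _ ω (Finset.mem_univ i)
    have h4 := Finset.add_sum_erase Finset.univ (fun _ : Fin n => L) (Finset.mem_univ i)
    simp only [Finset.sum_const, Finset.card_univ, Fintype.card_fin, nsmul_eq_mul] at h2 h4
    have := hLle _ (hwT i0)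
    linarith
  -- truncation
  let Y : (Fin n → ℝ) → ℝ := ∑ i, fun ω => min (ω i) s
  have hbd : ∀ᵐ t ∂ν, min t s ∈ Set.Icc 0 s := by
    filter_upwards [Measure.support_mem_ae (μ := ν)] with t ht
    exact ⟨le_min (hν0 t ht) hs0, min_le_right _ _⟩
  have hmem1 : MemLp (fun t : ℝ => min t s) 2 ν :=
    memLp_of_bounded hbd (by fun_prop) 2
  have hvar : ProbabilityTheory.variance Y P ≤ (c + 1) ^ 2 / n := by
    rw [ProbabilityTheory.variance_sum_pi (X := fun _ t => min t s) (fun i => hmem1)]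
    have h1 := ProbabilityTheory.variance_le_sq_of_bounded hbd (by fun_prop)
    simp only [Finset.sum_const, Finset.card_univ, Fintype.card_fin, nsmul_eq_mul]
    have h2 : s ^ 2 ≤ ((c + 1) / n) ^ 2 := by gcongr
    calc _ ≤ n * ((c + 1) / n) ^ 2 := by
          gcongr
          nlinarith
      _ = _ := by field_simp
  have hmemY : MemLp Y 2 P := by
    apply memLp_finsetSum'
    intro i _
    exact hmem1.comp_measurePreserving (measurePreserving_eval (fun _ : Fin n => ν) i)
  have hcheb := ProbabilityTheory.meas_ge_le_variance_div_sq hmemY hε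
  refine ⟨∫ ω, Y ω ∂P, ?_⟩
  set M := ∫ ω, Y ω ∂P
  have hle : ENNReal.ofReal (ProbabilityTheory.variance Y P / ε ^ 2) ≤
      ENNReal.ofReal ((c + 1) ^ 2 / (n * ε ^ 2)) := by
    apply ENNReal.ofReal_le_ofReal
    rw [← div_div]
    gcongr
  rw [← hmap, Measure.map_apply hm measurableSet_Iio, Measure.map_apply hm measurableSet_Ioo]
  refine le_trans ?_ (add_le_add_right (hcheb.trans hle) _)
  refine le_trans (measure_mono_ae ?_) (measure_union_le _ _)
  filter_upwards [hae] with ω hω hlt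
  have h1 := hXs ω hω hlt
  have h2 : Y ω = ∑ i, ω i := by
    simp only [Y, Finset.sum_apply]
    exact Finset.sum_congr rfl fun i _ => min_eq_left (h1 i)
  by_cases h : ε ≤ |Y ω - M|
  · exact Or.inr h
  · left
    push Not at h
    rw [abs_lt, h2] at h
    exact ⟨by linarith [h.1], by linarith [h.2]⟩

lemma law_sum (μ : ℝ → Measure ℝ) (hprob : ∀ x > (0:ℝ), IsProbabilityMeasure (μ x))
    (hconv : ∀ x > (0:ℝ), ∀ y > (0:ℝ), Measure.conv (μ x) (μ y) = μ (x + y))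
    {y : ℝ} (hy : 0 < y) (n : ℕ) (hn : 0 < n) :
    (Measure.pi fun _ : Fin n => μ y).map (fun ω => ∑ i, ω i) = μ (n * y) := by
  have := hprob y hy
  set P := Measure.pi fun _ : Fin n => μ y with hP
  have hind : ProbabilityTheory.iIndepFun (fun (i : Fin n) (ω : Fin n → ℝ) => ω i) P :=
    ProbabilityTheory.iIndepFun_pi (X := fun _ => id) (fun _ => aemeasurable_id)
  have hme : ∀ i, Measurable (fun (ω : Fin n → ℝ) => ω i) := fun i => by fun_prop
  have hmap1 : ∀ i, P.map (fun (ω : Fin n → ℝ) => ω i) = μ y := fun i =>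
    (measurePreserving_eval (fun _ : Fin n => μ y) i).map_eq
  have key : ∀ s : Finset (Fin n), s.Nonempty →
      P.map (∑ i ∈ s, fun (ω : Fin n → ℝ) => ω i) = μ (s.card * y) := by
    intro s hs
    induction hs using Finset.Nonempty.cons_induction with
    | singleton a => simpa using hmap1 a
    | cons a s ha hs ih =>
      have hi := hind.indepFun_finsetSum_of_notMem hme ha
      rw [Finset.sum_cons, Finset.card_cons, add_comm,
        hi.map_add_eq_map_conv_map (by fun_prop) (hme a), ih, hmap1,
        hconv _ (by have := hs.card_pos; positivity) _ hy]
      congr 1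
      push_cast; ring
  have : Nonempty (Fin n) := ⟨⟨0, hn⟩⟩
  have h := key Finset.univ Finset.univ_nonempty
  simp only [Finset.card_univ, Fintype.card_fin] at h
  rw [← h]
  congr 1
  ext ω; simp

lemma no_gap (μ : ℝ → Measure ℝ) (hprob : ∀ x > (0:ℝ), IsProbabilityMeasure (μ x))
    (hconv : ∀ x > (0:ℝ), ∀ y > (0:ℝ), Measure.conv (μ x) (μ y) = μ (x + y))
    (hnn : ∀ x > (0:ℝ), μ x (Iio 0) = 0)
    (hunif : ∀ x > (0:ℝ), ∀ q : ENNReal, q ≠ 0 → ∃ ε > (0:ℝ), ∀ M : ℝ,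
      μ x (Ioo (M - ε) (M + ε)) < q)
    {x : ℝ} (hx : 0 < x) {c d : ℝ} (hcd : c < d) (hc : μ x (Iic c) ≠ 0) :
    μ x (Ioo c d) ≠ 0 := by
  intro h0
  have := hprob x hx
  have hsupp : ∀ x > (0:ℝ), ∀ t ∈ (μ x).support, 0 ≤ t := by
    intro x hx t ht
    by_contra hlt
    push Not at hlt
    exact Measure.subset_compl_support_of_isOpen isOpen_Iio (hnn x hx) hlt ht
  set ρ := μ x with hρ
  set S := ρ.support with hS
  have hne : (Iic c ∩ S).Nonempty :=
    Measure.nonempty_inter_support_of_pos (pos_iff_ne_zero.2 hc)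
  have hbdd : BddAbove (Iic c ∩ S) := ⟨c, fun t ht => ht.1⟩
  have hmem := (isClosed_Iic.inter (Measure.isClosed_support (μ := ρ))).csSup_mem hne hbdd
  set c' := sSup (Iic c ∩ S) with hc'
  have hc'c : c' ≤ c := hmem.1
  have hgap : ∀ t ∈ S, c' < t → c' + (d - c') ≤ t := by
    intro t ht hlt
    by_contra hcon
    push Not at hcon
    by_cases htc : t ≤ c
    · exact absurd (le_csSup hbdd ⟨htc, ht⟩) (not_le.2 hlt)
    · push Not at htc
      exact Measure.subset_compl_support_of_isOpen isOpen_Ioo h0 ⟨htc, by linarith⟩ ht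
  have hSb : BddBelow S := ⟨0, fun t ht => hsupp x hx t ht⟩
  have hlS : sInf S ∈ S := Measure.isClosed_support.csInf_mem ⟨c', hmem.2⟩ hSb
  set l := sInf S with hl
  have hδ : 0 < d - c' := by linarith
  have hq : 0 < ρ (Iio (l + (d - c') / 2)) :=
    (Measure.mem_support_iff_forall l).1 hlS _ (Iio_mem_nhds (by linarith))
  set q := ρ (Iio (l + (d - c') / 2)) with hqdef
  have hq2 : q / 2 ≠ 0 := (ENNReal.half_pos hq.ne').ne'
  obtain ⟨ε, hε, hM⟩ := hunif x hx (q / 2) hq2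
  have hlim : Tendsto (fun n : ℕ => ENNReal.ofReal ((c' + 1) ^ 2 / (n * ε ^ 2))) atTop (nhds 0) := by
    rw [← ENNReal.ofReal_zero]
    apply ENNReal.tendsto_ofReal
    have h1 : Tendsto (fun n : ℕ => ((c' + 1) ^ 2 / ε ^ 2) / (n : ℝ)) atTop (nhds 0) :=
      tendsto_const_div_atTop_nhds_zero_nat _
    refine h1.congr fun n => ?_
    rw [div_div, mul_comm]
  obtain ⟨n, hn1, hn0⟩ := ((hlim.eventually_lt_const (pos_iff_ne_zero.2 hq2)).and
    (eventually_gt_atTop 0)).exists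
  have hn' : (0:ℝ) < n := by exact_mod_cast hn0
  have hy : 0 < x / n := by positivity
  have := hprob _ hy
  have hmap := law_sum μ hprob hconv hy n hn0
  rw [mul_div_cancel₀ _ hn'.ne'] at hmap
  obtain ⟨M, hfin⟩ := core ρ (μ (x / n)) n hn0 hmap (hsupp _ hy) hδ hε hmem.2 hgap
    (fun t ht => csInf_le hSb ht)
  have : q < q / 2 + q / 2 := hfin.trans_lt (ENNReal.add_lt_add (hM M) hn1)
  rw [ENNReal.add_halves] at this
  exact lt_irrefl _ this

theorem median_of_convolution_semigroup_continuous_strictMono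
    (μ : ℝ → Measure ℝ) (g : ℝ → ℝ → ℝ) (m : ℝ → ℝ)
    (hprob : ∀ x > (0:ℝ), IsProbabilityMeasure (μ x))
    (hdens : ∀ x > (0:ℝ),
      μ x = (volume.restrict (Set.Ici (0:ℝ))).withDensity (fun t => ENNReal.ofReal (g x t)))
    (hpos : ∀ x > (0:ℝ), ∀ᵐ t ∂(volume.restrict (Set.Ici (0:ℝ))), 0 < g x t)
    (hconv : ∀ x > (0:ℝ), ∀ y > (0:ℝ), Measure.conv (μ x) (μ y) = μ (x + y))
    (hweak : ∀ f : BoundedContinuousFunction ℝ ℝ,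
      Tendsto (fun x => ∫ t, f t ∂(μ x)) (nhdsWithin 0 (Set.Ioi 0)) (nhds (f 0)))
    (hmed : ∀ x > (0:ℝ), μ x (Set.Icc 0 (m x)) = 1/2) :
    ContinuousOn m (Set.Ioi 0) ∧ StrictMonoOn m (Set.Ioi 0) := by
  have hac : ∀ x > (0:ℝ), μ x ≪ volume.restrict (Set.Ici (0:ℝ)) := by
    intro x hx
    rw [hdens x hx]
    exact withDensity_absolutelyContinuous _ _
  have hnn : ∀ x > (0:ℝ), μ x (Iio 0) = 0 := by
    intro x hx
    apply hac x hx
    rw [Measure.restrict_apply measurableSet_Iio]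
    have : Iio (0:ℝ) ∩ Ici 0 = ∅ := by ext; simp
    rw [this, measure_empty]
  have hat : ∀ x > (0:ℝ), ∀ a, μ x {a} = 0 := by
    intro x hx a
    apply (hac x hx).trans Measure.restrict_le_self.absolutelyContinuous
    simp
  have hunif : ∀ x > (0:ℝ), ∀ q : ENNReal, q ≠ 0 → ∃ ε > (0:ℝ), ∀ M : ℝ,
      μ x (Ioo (M - ε) (M + ε)) < q := by
    intro x hx q hq
    have := hprob x hx
    have hfin : ∫⁻ t, ENNReal.ofReal (g x t) ∂(volume.restrict (Set.Ici (0:ℝ))) ≠ ⊤ := by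
      rw [← setLIntegral_univ, ← withDensity_apply _ MeasurableSet.univ, ← hdens x hx]
      exact measure_ne_top _ _
    obtain ⟨δ, hδ, h⟩ := exists_pos_setLIntegral_lt_of_measure_lt hfin hq
    obtain ⟨r, hr, hr0, hrδ⟩ : ∃ r : ℝ, 0 < r ∧ 0 < ENNReal.ofReal r ∧ ENNReal.ofReal r < δ := by
      obtain ⟨r, hr0, hr⟩ := ENNReal.lt_iff_exists_nnreal_btwn.1 hδ
      refine ⟨r, by exact_mod_cast hr0, by simpa using hr0, by simpa using hr⟩
    refine ⟨r / 2, by positivity, fun M => ?_⟩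
    rw [hdens x hx, withDensity_apply _ measurableSet_Ioo]
    apply h
    refine lt_of_le_of_lt (Measure.restrict_apply_le _ _) ?_
    rw [Real.volume_Ioo]
    ring_nf
    exact hrδ
  have hA : ∀ x > (0:ℝ), ∀ c d : ℝ, c < d → μ x (Iic c) ≠ 0 → μ x (Ioo c d) ≠ 0 :=
    fun x hx c d hcd hc => no_gap μ hprob hconv hnn hunif hx hcd hc
  have hhalf : ∀ x > (0:ℝ), μ x (Iic (m x)) = 1/2 := by
    intro x hx
    rw [← hmed x hx]
    apply le_antisymm
    · refine (measure_mono (t := Iio 0 ∪ Icc 0 (m x)) ?_).trans ((measure_union_le _ _).trans ?_)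
      · intro t ht
        rcases lt_or_ge t 0 with h | h
        · exact Or.inl h
        · exact Or.inr ⟨h, ht⟩
      · rw [hnn x hx, zero_add]
    · exact measure_mono Icc_subset_Iic_self
  have hh0 : (1/2 : ENNReal) ≠ 0 := by simp
  have hht : (1/2 : ENNReal) ≠ ⊤ := by simp
  -- strict increase of the distribution function
  have hstrict : ∀ x > (0:ℝ), ∀ c d : ℝ, c < d → μ x (Iic d) ≠ 0 →
      μ x (Iic c) < μ x (Iic d) := by
    intro x hx c d hcd hd
    have := hprob x hx
    by_cases hc : μ x (Iic c) = 0
    · rw [hc]; exact pos_iff_ne_zero.2 hd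
    · have h1 := hA x hx c d hcd hc
      have h2 : μ x (Iic c) + μ x (Ioo c d) ≤ μ x (Iic d) := by
        rw [← measure_union _ measurableSet_Ioo]
        · apply measure_mono
          rintro t (ht | ht)
          · exact le_trans ht hcd.le
          · exact ht.2.le
        · rw [Set.disjoint_left]
          intro t ht ht'
          exact absurd ht'.1 (not_lt.2 ht)
      exact (ENNReal.lt_add_right (measure_ne_top _ _) h1).trans_le h2
  have hlt_of : ∀ x > (0:ℝ), ∀ t, μ x (Iic t) < 1/2 → t < m x := by
    intro x hx t ht
    by_contra h
    push Not at h
    have := measure_mono (μ := μ x) (Iic_subset_Iic.2 h)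
    rw [hhalf x hx] at this
    exact absurd ht (not_lt.2 this)
  have hgt_of : ∀ x > (0:ℝ), ∀ t, 1/2 < μ x (Iic t) → m x < t := by
    intro x hx t ht
    by_contra h
    push Not at h
    have := measure_mono (μ := μ x) (Iic_subset_Iic.2 h)
    rw [hhalf x hx] at this
    exact absurd ht (not_lt.2 this)
  have hmono : StrictMonoOn m (Set.Ioi 0) := by
    intro x hx z hz hxz
    have hx : 0 < x := hx
    have hy : 0 < z - x := by linarith
    have := hprob x hx
    have := hprob _ hy
    apply hlt_of z hz
    have h1 : μ z (Iic (m x)) = ∫⁻ s, μ x (Iic (m x - s)) ∂(μ (z - x)) := by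
      have h2 : μ z = Measure.conv (μ (z - x)) (μ x) := by
        rw [hconv _ hy _ hx]; congr 1; ring
      rw [h2, Measure.conv, Measure.map_apply (by fun_prop) measurableSet_Iic,
        Measure.prod_apply ((by fun_prop : Measurable fun p : ℝ × ℝ => p.1 + p.2) measurableSet_Iic)]
      apply lintegral_congr
      intro s
      congr 1
      ext t
      simp [le_sub_iff_add_le, add_comm]
    have h3 : (1/2 : ENNReal) = ∫⁻ s, 1/2 ∂(μ (z - x)) := by simp
    rw [h1, h3]
    apply lintegral_strict_mono (IsProbabilityMeasure.ne_zero _) (by fun_prop)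
    · rw [← h1]
      have := hprob z hz
      exact measure_ne_top _ _
    · have ha : ∀ᵐ s ∂(μ (z - x)), s ∉ Iio (0:ℝ) := measure_eq_zero_iff_ae_notMem.1 (hnn _ hy)
      have hb : ∀ᵐ s ∂(μ (z - x)), s ∉ ({0} : Set ℝ) :=
        measure_eq_zero_iff_ae_notMem.1 (hat _ hy 0)
      filter_upwards [ha, hb] with s hs1 hs2
      have : 0 < s := lt_of_le_of_ne (by simpa using hs1) (fun h => hs2 (by simp [h]))
      rw [← hhalf x hx]
      exact hstrict x hx _ _ (by linarith) (by rw [hhalf x hx]; exact hh0)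
  refine ⟨?_, hmono⟩
  have hprod : ∀ x > (0:ℝ), ∀ h > (0:ℝ), ∀ a b : ℝ,
      μ x (Iic a) * μ h (Iic b) ≤ μ (x + h) (Iic (a + b)) := by
    intro x hx h hh a b
    have := hprob x hx
    have := hprob h hh
    rw [← hconv x hx h hh, Measure.conv, Measure.map_apply (by fun_prop) measurableSet_Iic,
      ← Measure.prod_prod]
    apply measure_mono
    rintro ⟨s, t⟩ ⟨hs, ht⟩
    have hs : s ≤ a := hs
    have ht : t ≤ b := ht
    change s + t ≤ a + b
    exact add_le_add hs ht
  have hlim : ∀ ε > (0:ℝ), Tendsto (fun h => μ h (Iic ε)) (nhdsWithin 0 (Ioi 0)) (nhds 1) := by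
    intro ε hε
    let f : BoundedContinuousFunction ℝ ℝ :=
      BoundedContinuousFunction.ofNormedAddCommGroup (fun t => max 0 (1 - |t| / ε))
        (by fun_prop) 1 (by
          intro t
          rw [Real.norm_eq_abs, abs_of_nonneg (le_max_left _ _)]
          apply max_le zero_le_one
          have : 0 ≤ |t| / ε := by positivity
          linarith)
    have hf : ∀ t, f t = max 0 (1 - |t| / ε) := fun t => rfl
    have h1 := ENNReal.tendsto_ofReal (hweak f)
    have h2 : ENNReal.ofReal (f 0) = 1 := by simp [hf]
    rw [h2] at h1
    refine tendsto_of_tendsto_of_tendsto_of_le_of_le' h1 tendsto_const_nhds ?_ ?_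
    · filter_upwards [self_mem_nhdsWithin] with h hh
      have := hprob h hh
      rw [ofReal_integral_eq_lintegral_ofReal (f.integrable _)
        (Eventually.of_forall fun t => le_max_left _ _), ← lintegral_indicator_one measurableSet_Iic]
      apply lintegral_mono
      intro t
      by_cases ht : t ≤ ε
      · rw [indicator_of_mem (by exact ht)]
        simp only [Pi.one_apply, ENNReal.ofReal_le_one, hf]
        apply max_le zero_le_one
        have : 0 ≤ |t| / ε := by positivity
        linarith
      · push Not at ht
        have : 1 ≤ |t| / ε := by
          rw [le_div_iff₀ hε]; linarith [le_abs_self t]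
        have : f t = 0 := by rw [hf]; exact max_eq_left (by linarith)
        simp [this]
    · filter_upwards [self_mem_nhdsWithin] with h hh
      have := hprob h hh
      exact prob_le_one
  have hlimmul : ∀ ε > (0:ℝ), ∀ a : ENNReal, 1/2 < a → a ≠ ⊤ →
      ∃ r > (0:ℝ), ∀ h, 0 < h → h < r → 1/2 < a * μ h (Iic ε) := by
    intro ε hε a ha hat
    have h1 : Tendsto (fun h => a * μ h (Iic ε)) (nhdsWithin 0 (Ioi 0)) (nhds (a * 1)) :=
      ENNReal.Tendsto.const_mul (hlim ε hε) (Or.inr hat)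
    rw [mul_one] at h1
    have h2 := h1.eventually_const_lt ha
    rw [eventually_nhdsWithin_iff, Metric.eventually_nhds_iff] at h2
    obtain ⟨r, hr, h3⟩ := h2
    refine ⟨r, hr, fun h h0 hlt => h3 ?_ h0⟩
    rw [Real.dist_eq, sub_zero, abs_of_pos h0]; exact hlt
  have hlimmul2 : ∀ ε > (0:ℝ), ∀ a : ENNReal, a < 1/2 →
      ∃ r > (0:ℝ), ∀ h, 0 < h → h < r → a < 1/2 * μ h (Iic ε) := by
    intro ε hε a ha
    have h1 : Tendsto (fun h => (1/2 : ENNReal) * μ h (Iic ε)) (nhdsWithin 0 (Ioi 0))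
        (nhds (1/2 * 1)) :=
      ENNReal.Tendsto.const_mul (hlim ε hε) (Or.inr hht)
    rw [mul_one] at h1
    have h2 := h1.eventually_const_lt ha
    rw [eventually_nhdsWithin_iff, Metric.eventually_nhds_iff] at h2
    obtain ⟨r, hr, h3⟩ := h2
    refine ⟨r, hr, fun h h0 hlt => h3 ?_ h0⟩
    rw [Real.dist_eq, sub_zero, abs_of_pos h0]; exact hlt
  intro x hx
  have hx : 0 < x := hx
  have := hprob x hx
  apply ContinuousAt.continuousWithinAt
  rw [Metric.continuousAt_iff]
  intro e he
  have hup : 1/2 < μ x (Iic (m x + e / 2)) := by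
    rw [← hhalf x hx]
    apply hstrict x hx _ _ (by linarith)
    have := measure_mono (μ := μ x) (Iic_subset_Iic.2 (by linarith : m x ≤ m x + e / 2))
    rw [hhalf x hx] at this
    exact (lt_of_lt_of_le (pos_iff_ne_zero.2 hh0) this).ne'
  have hdown : μ x (Iic (m x - e / 2)) < 1/2 := by
    rw [← hhalf x hx]
    exact hstrict x hx _ _ (by linarith) (by rw [hhalf x hx]; exact hh0)
  obtain ⟨r1, hr1, h1⟩ := hlimmul (e / 2) (by positivity) _ hup (measure_ne_top _ _)
  obtain ⟨r2, hr2, h2⟩ := hlimmul2 (e / 2) (by positivity) _ hdown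
  refine ⟨min x (min r1 r2), by positivity, fun {z} hz => ?_⟩
  rw [Real.dist_eq] at hz ⊢
  obtain ⟨hzx, hz1, hz2⟩ : |z - x| < x ∧ |z - x| < r1 ∧ |z - x| < r2 := by
    simpa [lt_min_iff] using hz
  have hz0 : 0 < z := by linarith [(abs_lt.1 hzx).1]
  rcases lt_trichotomy z x with h | h | h
  · have hm1 := hmono hz0 hx h
    have hh : 0 < x - z := by linarith
    have h3 := h2 (x - z) hh (by rw [abs_sub_comm, abs_of_pos hh] at hz2; exact hz2)
    have h4 := hprod z hz0 (x - z) hh (m z) (e / 2)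
    rw [hhalf z hz0, add_sub_cancel] at h4
    have h5 : m x - e / 2 < m z + e / 2 := by
      by_contra hcon
      push Not at hcon
      exact absurd (h3.trans_le (h4.trans (measure_mono (Iic_subset_Iic.2 hcon)))) (lt_irrefl _)
    rw [abs_lt]; constructor <;> linarith
  · subst h; simpa using he
  · have hm1 := hmono hx hz0 h
    have hh : 0 < z - x := by linarith
    have h3 := h1 (z - x) hh (by rw [abs_of_pos hh] at hz1; exact hz1)
    have h4 := hprod x hx (z - x) hh (m x + e / 2) (e / 2)
    rw [add_sub_cancel] at h4
    have h5 := hgt_of z hz0 _ (h3.trans_le h4)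
    rw [abs_lt]; constructor <;> linarith
end

section
/- The median function m of the gamma distributions is real analytic on (0,∞). -/
open MeasureTheory Filter Set

namespace GammaMedianAux

open Topology

/-- The integrand after rescaling to the unit interval. -/
noncomputable def gI (p : ℂ × ℂ) (s : ℝ) : ℂ :=
  Complex.exp (-(p.2 * s) + (p.1 - 1) * (Real.log s : ℝ))

/-- Its complex derivative in the parameters. -/
noncomputable def gI' (p : ℂ × ℂ) (s : ℝ) : ℂ × ℂ →L[ℂ] ℂ :=
  gI p s • (-((s : ℂ) • ContinuousLinearMap.snd ℂ ℂ ℂ) +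
    ((Real.log s : ℝ) : ℂ) • ContinuousLinearMap.fst ℂ ℂ ℂ)

noncomputable def G (p : ℂ × ℂ) : ℂ := ∫ s in Ioc (0:ℝ) 1, gI p s

lemma gI_hasFDerivAt (p : ℂ × ℂ) (s : ℝ) : HasFDerivAt (fun p => gI p s) (gI' p s) p := by
  unfold gI gI'
  apply HasFDerivAt.cexp
  apply HasFDerivAt.add
  · apply HasFDerivAt.neg
    exact (hasFDerivAt_snd (𝕜 := ℂ) (p := p)).mul_const (s : ℂ)
  · exact ((hasFDerivAt_fst (𝕜 := ℂ) (p := p)).sub_const 1).mul_const _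

lemma gI'_continuous (s : ℝ) : Continuous (fun p => gI' p s) := by
  unfold gI' gI
  fun_prop

lemma gI_measurable (p : ℂ × ℂ) : Measurable (gI p) := by
  unfold gI
  fun_prop

lemma gI'_aesm (p : ℂ × ℂ) (μ : Measure ℝ) : AEStronglyMeasurable (gI' p) μ := by
  unfold gI'
  have h1 : AEStronglyMeasurable
      (fun s : ℝ => (s : ℂ) • ContinuousLinearMap.snd ℂ ℂ ℂ) μ :=
    (Complex.measurable_ofReal.aestronglyMeasurable).smul_const _
  have h2 : AEStronglyMeasurable
      (fun s : ℝ => ((Real.log s : ℝ) : ℂ) • ContinuousLinearMap.fst ℂ ℂ ℂ) μ :=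
    (Complex.measurable_ofReal.comp Real.measurable_log).aestronglyMeasurable.smul_const _
  exact (gI_measurable p).aestronglyMeasurable.smul (h1.neg.add h2)

lemma gI_norm_le {δ R : ℝ} {p : ℂ × ℂ} (h1 : 2 * δ < p.1.re) (h2 : ‖p.2‖ < R)
    {s : ℝ} (hs : s ∈ Ioc (0:ℝ) 1) : ‖gI p s‖ ≤ Real.exp R * s ^ (2 * δ - 1) := by
  obtain ⟨hs0, hs1⟩ := hs
  rw [gI, Complex.norm_exp, Real.rpow_def_of_pos hs0, ← Real.exp_add]
  apply Real.exp_le_exp.2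
  have hl : Real.log s ≤ 0 := Real.log_nonpos hs0.le hs1
  have e : (-(p.2 * s) + (p.1 - 1) * (Real.log s : ℝ) : ℂ).re
      = -(p.2.re * s) + (p.1.re - 1) * Real.log s := by simp
  rw [e]
  have h3 : |p.2.re| ≤ R := (Complex.abs_re_le_norm _).trans h2.le
  have h4 := abs_le.1 h3
  have h5 : 0 ≤ R := (abs_nonneg _).trans h3
  nlinarith [mul_nonneg (sub_nonneg.2 hs1) h5]

lemma gI'_norm_le {δ R : ℝ} (hδ : 0 < δ) {p : ℂ × ℂ} (h1 : 2 * δ < p.1.re) (h2 : ‖p.2‖ < R)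
    {s : ℝ} (hs : s ∈ Ioc (0:ℝ) 1) :
    ‖gI' p s‖ ≤ Real.exp R * (1 + 1 / δ) * s ^ (δ - 1) := by
  have hg := gI_norm_le h1 h2 hs
  obtain ⟨hs0, hs1⟩ := hs
  have hl := (Real.abs_log_mul_self_rpow_lt s δ hs0 hs1 hδ).le
  rw [abs_mul, abs_of_pos (Real.rpow_pos_of_pos hs0 δ)] at hl
  have hsp : s ^ (2 * δ - 1) = s ^ δ * s ^ (δ - 1) := by
    rw [← Real.rpow_add hs0]; ring_nf
  have hL : ‖(-((s : ℂ) • ContinuousLinearMap.snd ℂ ℂ ℂ) +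
    ((Real.log s : ℝ) : ℂ) • ContinuousLinearMap.fst ℂ ℂ ℂ)‖ ≤ s + |Real.log s| := by
    refine (norm_add_le _ _).trans ?_
    rw [norm_neg, norm_smul, norm_smul, Complex.norm_real, Complex.norm_real, Real.norm_eq_abs,
      Real.norm_eq_abs, abs_of_pos hs0]
    have a1 := ContinuousLinearMap.norm_fst_le ℂ ℂ ℂ
    have a2 := ContinuousLinearMap.norm_snd_le ℂ ℂ ℂ
    nlinarith [abs_nonneg (Real.log s)]
  rw [gI', norm_smul]
  have hA : s ^ δ ≤ 1 := Real.rpow_le_one hs0.le hs1 hδ.le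
  have hA0 := Real.rpow_pos_of_pos hs0 δ
  calc _ ≤ (Real.exp R * s ^ (2 * δ - 1)) * (s + |Real.log s|) := by gcongr
    _ = Real.exp R * (s ^ δ * s + |Real.log s| * s ^ δ) * s ^ (δ - 1) := by rw [hsp]; ring
    _ ≤ _ := by
      gcongr
      nlinarith

lemma rpow_int {a : ℝ} (ha : 0 < a) (C : ℝ) :
    IntegrableOn (fun s : ℝ => C * s ^ (a - 1)) (Ioc 0 1) := by
  apply Integrable.const_mul
  exact (intervalIntegrable_iff_integrableOn_Ioc_of_le zero_le_one).1
    (intervalIntegral.intervalIntegrable_rpow' (by linarith))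

lemma G_contDiffAt (p : ℂ × ℂ) (hp : 0 < p.1.re) : ContDiffAt ℂ 1 G p := by
  obtain ⟨δ, hδ, hδ'⟩ : ∃ δ > 0, 2 * δ < p.1.re := ⟨p.1.re / 4, by linarith, by linarith⟩
  let U : Set (ℂ × ℂ) := {q | 2 * δ < q.1.re} ∩ {q | ‖q.2‖ < ‖p.2‖ + 1}
  have hU : IsOpen U := by
    apply IsOpen.inter
    · exact isOpen_lt (by fun_prop) (by fun_prop)
    · exact isOpen_lt (by fun_prop) (by fun_prop)
  have hpU : p ∈ U := ⟨hδ', by simp⟩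
  have hb : ∀ᵐ s ∂(volume.restrict (Ioc (0:ℝ) 1)), ∀ q ∈ U,
      ‖gI' q s‖ ≤ Real.exp (‖p.2‖ + 1) * (1 + 1 / δ) * s ^ (δ - 1) := by
    filter_upwards [ae_restrict_mem measurableSet_Ioc] with s hs q hq
    exact gI'_norm_le hδ hq.1 hq.2 hs
  rw [contDiffAt_one_iff]
  refine ⟨fun q => ∫ s in Ioc (0:ℝ) 1, gI' q s, U, hU.mem_nhds hpU, ?_, ?_⟩
  · intro q hq
    apply ContinuousAt.continuousWithinAt
    apply continuousAt_of_dominated (Eventually.of_forall fun q => gI'_aesm q _) _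
      (rpow_int hδ (Real.exp (‖p.2‖ + 1) * (1 + 1 / δ)))
      (Eventually.of_forall fun s => (gI'_continuous s).continuousAt)
    filter_upwards [hU.mem_nhds hq] with r hr
    filter_upwards [hb] with s hs using hs r hr
  · intro q hq
    apply hasFDerivAt_integral_of_dominated_of_fderiv_le (hU.mem_nhds hq)
      (Eventually.of_forall fun q => (gI_measurable q).aestronglyMeasurable) _ (gI'_aesm q _) hb
      (rpow_int hδ (Real.exp (‖p.2‖ + 1) * (1 + 1 / δ)))
      (Eventually.of_forall fun s r _ => gI_hasFDerivAt r s)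
    refine Integrable.mono' (rpow_int (a := 2 * δ) (by linarith) (Real.exp (‖p.2‖ + 1)))
      (gI_measurable q).aestronglyMeasurable ?_
    filter_upwards [ae_restrict_mem measurableSet_Ioc] with s hs
    exact gI_norm_le hq.1 hq.2 hs

/-- The complexified implicit equation. -/
noncomputable def H (p : ℂ × ℂ) : ℂ :=
  Complex.exp (p.1 * Complex.log p.2) * G p - (1/2) * Complex.Gamma p.1

lemma H_contDiffAt (p : ℂ × ℂ) (hp : 0 < p.1.re) (hp2 : p.2 ∈ Complex.slitPlane) :
    ContDiffAt ℂ 1 H p := by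
  have hG := G_contDiffAt p hp
  have hl : ContDiffAt ℂ 1 (fun q : ℂ × ℂ => Complex.log q.2) p :=
    (Complex.contDiffAt_log hp2).comp p contDiffAt_snd
  have hΓ : ContDiffAt ℂ 1 (fun q : ℂ × ℂ => Complex.Gamma q.1) p := by
    have : AnalyticAt ℂ Complex.Gamma p.1 := by
      have ho : IsOpen {z : ℂ | 0 < z.re} := isOpen_lt (by fun_prop) (by fun_prop)
      apply DifferentiableOn.analyticAt (s := {z : ℂ | 0 < z.re}) _ (ho.mem_nhds hp)
      intro z hz
      apply DifferentiableAt.differentiableWithinAt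
      apply Complex.differentiableAt_Gamma
      intro k hk
      simp [hk] at hz
      have : (0:ℝ) ≤ k := Nat.cast_nonneg k
      linarith
    exact this.contDiffAt.comp p contDiffAt_fst
  unfold H
  exact ((contDiffAt_fst.mul hl).cexp.mul hG).sub (contDiffAt_const.mul hΓ)

/-- The real implicit equation. -/
noncomputable def F (x y : ℝ) : ℝ :=
  (∫ t in Set.Ioc (0:ℝ) y, Real.exp (-t) * t ^ (x - 1)) -
        (1/2) * ∫ t in Set.Ioi (0:ℝ), Real.exp (-t) * t ^ (x - 1)

lemma H_ofReal {x y : ℝ} (hx : 0 < x) (hy : 0 < y) : H ((x : ℂ), (y : ℂ)) = (F x y : ℝ) := by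
  have hG : G ((x : ℂ), (y : ℂ))
      = ((∫ s in Ioc (0:ℝ) 1, Real.exp (-(y * s)) * s ^ (x - 1) : ℝ) : ℂ) := by
    rw [G, ← integral_complex_ofReal]
    apply setIntegral_congr_fun measurableSet_Ioc
    intro s hs
    simp only [gI]
    rw [Real.rpow_def_of_pos hs.1, ← Real.exp_add, Complex.ofReal_exp]
    push_cast
    ring_nf
  have hI : (∫ t in Set.Ioc (0:ℝ) y, Real.exp (-t) * t ^ (x - 1))
      = Real.exp (x * Real.log y) * ∫ s in Ioc (0:ℝ) 1, Real.exp (-(y * s)) * s ^ (x - 1) := by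
    have := intervalIntegral.mul_integral_comp_mul_left (a := 0) (b := 1) y
      (f := fun t => Real.exp (-t) * t ^ (x - 1))
    rw [mul_zero, mul_one, intervalIntegral.integral_of_le hy.le,
      intervalIntegral.integral_of_le zero_le_one] at this
    rw [← this, ← integral_const_mul, ← integral_const_mul]
    apply setIntegral_congr_fun measurableSet_Ioc
    intro s hs
    simp only
    rw [Real.mul_rpow hy.le hs.1.le, mul_comm x, ← Real.rpow_def_of_pos hy, Real.rpow_sub_one hy.ne']
    field_simp
  rw [H, hG, F, hI, Complex.Gamma_eq_integral (by simpa using hx), Complex.GammaIntegral_ofReal,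
    ← Complex.ofReal_log hy.le]
  push_cast
  rfl

lemma integrable {x : ℝ} (hx : 0 < x) (y : ℝ) :
    IntegrableOn (fun t : ℝ => Real.exp (-t) * t ^ (x - 1)) (Ioc 0 y) :=
  (Real.GammaIntegral_convergent hx).mono_set Ioc_subset_Ioi_self

lemma F_hasDerivAt {x y : ℝ} (hx : 0 < x) (hy : 0 < y) :
    HasDerivAt (F x) (Real.exp (-y) * y ^ (x - 1)) y := by
  unfold F
  apply HasDerivAt.sub_const
  have hc : ContinuousAt (fun t : ℝ => Real.exp (-t) * t ^ (x - 1)) y := by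
    apply ContinuousAt.mul (by fun_prop)
    exact Real.continuousAt_rpow_const _ _ (Or.inl hy.ne')
  have hm : Measurable (fun t : ℝ => Real.exp (-t) * t ^ (x - 1)) := by fun_prop
  have := intervalIntegral.integral_hasDerivAt_right
    ((intervalIntegrable_iff_integrableOn_Ioc_of_le hy.le).2 (integrable hx y))
    hm.stronglyMeasurable.stronglyMeasurableAtFilter hc
  apply this.congr_of_eventuallyEq
  filter_upwards [lt_mem_nhds hy] with z hz
  rw [intervalIntegral.integral_of_le hz.le]

lemma F_strictMono {x : ℝ} (hx : 0 < x) : StrictMonoOn (F x) (Ioi 0) := by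
  apply strictMonoOn_of_deriv_pos (convex_Ioi 0)
  · intro y hy
    exact (F_hasDerivAt hx hy).continuousAt.continuousWithinAt
  · intro y hy
    rw [interior_Ioi] at hy
    rw [(F_hasDerivAt hx hy).deriv]
    have := Real.rpow_pos_of_pos hy (x - 1)
    positivity

lemma F_continuousAt {x y : ℝ} (hx : 0 < x) (hy : 0 < y) :
    ContinuousAt (fun z => F z y) x := by
  have h1 : ContinuousAt (fun z : ℝ => (H ((z : ℂ), (y : ℂ))).re) x := by
    have := (H_contDiffAt ((x : ℂ), (y : ℂ)) (by simpa using hx) (by simpa using hy)).continuousAt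
    have h2 : ContinuousAt (fun z : ℝ => ((z : ℂ), (y : ℂ))) x := by fun_prop
    exact Complex.continuous_re.continuousAt.comp
      (ContinuousAt.comp (f := fun z : ℝ => ((z : ℂ), (y : ℂ))) this h2)
  apply h1.congr
  filter_upwards [lt_mem_nhds hx] with z hz
  rw [H_ofReal hz hy, Complex.ofReal_re]

end GammaMedianAux

open GammaMedianAux in
/-- The median function of the gamma distributions is real analytic on
`(0,∞)`.  Here `m x` is characterized by `m x > 0` and
`∫_0^{m x} e^{-t} t^{x-1} dt = (1/2) ∫_0^∞ e^{-t} t^{x-1} dt`. -/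
theorem gammaMedian_analytic (m : ℝ → ℝ)
    (hm : ∀ x > (0:ℝ), 0 < m x ∧
      (∫ t in Set.Ioc (0:ℝ) (m x), Real.exp (-t) * t ^ (x - 1)) =
        (1/2) * ∫ t in Set.Ioi (0:ℝ), Real.exp (-t) * t ^ (x - 1)) :
    AnalyticOnNhd ℝ m (Set.Ioi 0) := by
  intro x hx
  have hx : 0 < x := hx
  have hpos : ∀ z > 0, 0 < m z := fun z hz => (hm z hz).1
  have hF : ∀ z > 0, F z (m z) = 0 := fun z hz => sub_eq_zero.2 (hm z hz).2
  have hmx := hpos x hx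
  -- continuity
  have hcont : ContinuousAt m x := by
    apply tendsto_order.2
    constructor
    · intro a ha
      rcases le_or_gt a 0 with h0 | h0
      · filter_upwards [lt_mem_nhds hx] with z hz using h0.trans_lt (hpos z hz)
      · have h1 : F x a < 0 := hF x hx ▸ F_strictMono hx h0 hmx ha
        filter_upwards [lt_mem_nhds hx, (F_continuousAt hx h0).eventually_lt_const h1] with z hz h2
        rw [← hF z hz] at h2
        exact ((F_strictMono hz).lt_iff_lt h0 (hpos z hz)).1 h2
    · intro a ha
      have h0 : 0 < a := hmx.trans ha
      have h1 : 0 < F x a := hF x hx ▸ F_strictMono hx hmx h0 ha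
      filter_upwards [lt_mem_nhds hx, (F_continuousAt hx h0).eventually_const_lt h1] with z hz h2
      rw [← hF z hz] at h2
      exact ((F_strictMono hz).lt_iff_lt (hpos z hz) h0).1 h2
  have cdf := H_contDiffAt ((x : ℂ), (m x : ℂ)) (by simpa using hx) (by simpa using hmx)
  -- the partial derivative does not vanish
  have hd : fderiv ℂ H ((x : ℂ), (m x : ℂ)) (0, 1) ≠ 0 := by
    have h1 : HasFDerivAt H _ ((x : ℂ), (m x : ℂ)) :=
      (cdf.differentiableAt one_ne_zero).hasFDerivAt
    have h2 : HasDerivAt (fun y : ℂ => ((x : ℂ), y)) (0, 1) (m x : ℂ) :=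
      (hasDerivAt_const _ _).prodMk (hasDerivAt_id _)
    have h3 := (HasFDerivAt.comp_hasDerivAt (m x : ℂ) h1 h2).comp_ofReal
    have h4 := (F_hasDerivAt hx hmx).ofReal_comp
    have h5 := h3.congr_of_eventuallyEq (f₁ := fun y : ℝ => ((F x y : ℝ) : ℂ)) (by
      filter_upwards [lt_mem_nhds hmx] with y hy
      exact (H_ofReal hx hy).symm)
    rw [h5.unique h4]
    have := Real.rpow_pos_of_pos hmx (x - 1)
    exact Complex.ofReal_ne_zero.2 (by positivity)
  have if₂ : (fderiv ℂ H ((x : ℂ), (m x : ℂ)) ∘L .inr ℂ ℂ ℂ).IsInvertible := by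
    refine ⟨ContinuousLinearEquiv.unitsEquivAut ℂ (Units.mk0 _ hd), ?_⟩
    ext
    simp
  have hφ := cdf.contDiffAt_implicitFunction one_ne_zero if₂
  have hiff := cdf.eventually_apply_eq_iff_implicitFunction one_ne_zero if₂
  set φ := cdf.implicitFunction one_ne_zero if₂ with hφdef
  have hφa : AnalyticAt ℂ φ (x : ℂ) := by
    rw [Complex.analyticAt_iff_eventually_differentiableAt]
    filter_upwards [hφ.eventually (by simp)] with z hz
    exact hz.differentiableAt one_ne_zero
  have hre : AnalyticAt ℝ (fun z : ℝ => (φ z).re) x := by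
    have h1 : AnalyticAt ℝ φ (x : ℂ) := hφa.restrictScalars
    have h2 : AnalyticAt ℝ (fun z : ℝ => φ z) x :=
      AnalyticAt.comp (g := φ) (f := fun z : ℝ => (z : ℂ)) h1 (Complex.ofRealCLM.analyticAt x)
    exact (Complex.reCLM.analyticAt _).comp h2
  apply hre.congr
  have ht : Tendsto (fun z : ℝ => ((z : ℂ), (m z : ℂ))) (nhds x) (nhds ((x : ℂ), (m x : ℂ))) := by
    apply Tendsto.prodMk_nhds
    · exact Complex.continuous_ofReal.continuousAt
    · exact (Complex.continuous_ofReal.continuousAt).comp hcont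
  filter_upwards [ht.eventually hiff, lt_mem_nhds hx] with z hz hz0
  have := hz.1 (by rw [H_ofReal hz0 (hpos z hz0), H_ofReal hx hmx, hF z hz0, hF x hx])
  rw [this, Complex.ofReal_re]
end

section
/- For every x > 0 one has x·2^{-1/x} < m(x) < x·e^{-1/(3x)}; equivalently, 1/3 < x·φ(x) < log 2 for all x > 0. -/
open MeasureTheory Filter Set

/-- auxiliary exponent -/
noncomputable def gmF (u : ℝ) : ℝ := Real.exp u - 1 - u
noncomputable def gmR (s : ℝ) : ℝ := (s + 2 - 2 * Real.exp (-s)) / 3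

lemma gm_mono (f f' : ℝ → ℝ) (h : ∀ s, HasDerivAt f (f' s) s) (h0 : f 0 = 0)
    (hn : ∀ s, 0 < s → 0 ≤ f' s) {s : ℝ} (hs : 0 ≤ s) : 0 ≤ f s := by
  have : MonotoneOn f (Ici 0) := by
    apply monotoneOn_of_deriv_nonneg (convex_Ici 0)
    · exact fun x _ => (h x).continuousAt.continuousWithinAt
    · exact fun x _ => (h x).differentiableAt.differentiableWithinAt
    · intro x hx
      rw [interior_Ici] at hx
      rw [(h x).deriv]; exact hn x hx
  have := this (mem_Ici.2 le_rfl) (mem_Ici.2 hs) hs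
  linarith

lemma gm_dexp (s : ℝ) : HasDerivAt (fun s : ℝ => Real.exp (-s)) (-Real.exp (-s)) s := by
  simpa using (hasDerivAt_neg s).exp

lemma gm_k {s : ℝ} (hs : 0 ≤ s) : 0 ≤ 1 - Real.exp (-s) ^ 2 - 2 * Real.exp (-s) * s := by
  refine gm_mono (fun s => 1 - Real.exp (-s) ^ 2 - 2 * Real.exp (-s) * s)
    (fun s => 2 * Real.exp (-s) * (Real.exp (-s) - 1 + s)) ?_ (by simp) ?_ hs
  · intro s
    have := (((gm_dexp s).pow 2).const_sub 1).sub (((gm_dexp s).const_mul 2).mul (hasDerivAt_id s))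
    refine this.congr_deriv ?_
    simp [-neg_sub]; ring
  · intro s _
    have := Real.add_one_le_exp (-s)
    have := Real.exp_pos (-s)
    apply mul_nonneg <;> linarith

lemma gm_h {s : ℝ} (hs : 0 ≤ s) :
    0 ≤ Real.exp (-s) ^ 2 + 4 * Real.exp (-s) - 5 + 2 * s + 4 * Real.exp (-s) * s := by
  refine gm_mono (fun s => Real.exp (-s) ^ 2 + 4 * Real.exp (-s) - 5 + 2 * s + 4 * Real.exp (-s) * s)
    (fun s => 2 * (1 - Real.exp (-s) ^ 2 - 2 * Real.exp (-s) * s)) ?_ (by norm_num) ?_ hs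
  · intro s
    have := (((((gm_dexp s).pow 2).add ((gm_dexp s).const_mul 4)).sub_const 5).add
      ((hasDerivAt_id s).const_mul 2)).add (((gm_dexp s).const_mul 4).mul (hasDerivAt_id s))
    refine this.congr_deriv ?_
    simp [-neg_sub]; ring
  · intro s h
    have := gm_k h.le
    linarith

lemma gm_dR (s : ℝ) : HasDerivAt gmR ((1 + 2 * Real.exp (-s)) / 3) s := by
  have := (((hasDerivAt_id s).add_const 2).sub ((gm_dexp s).const_mul 2)).div_const 3
  refine this.congr_deriv ?_
  ring

/-- `exp (-R) * (e^{-s}+4s+2)/3 ≤ 1` -/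
lemma gm_key {s : ℝ} (hs : 0 ≤ s) : gmF (-s) ≤ gmF (gmR s) := by
  have := gm_mono (fun s => 1 - Real.exp (-gmR s) * ((Real.exp (-s) + 4 * s + 2) / 3))
    (fun s => Real.exp (-gmR s) * (2 / 9) * (Real.exp (-s) ^ 2 + 4 * Real.exp (-s) - 5 + 2 * s + 4 * Real.exp (-s) * s))
    ?_ (by norm_num [gmR]) ?_ hs
  · have h1 : Real.exp (gmR s) * Real.exp (-gmR s) = 1 := by rw [← Real.exp_add]; simp
    have h2 := mul_nonneg (Real.exp_pos (gmR s)).le this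
    have : (Real.exp (-s) + 4 * s + 2) / 3 ≤ Real.exp (gmR s) := by
      have : Real.exp (gmR s) * (1 - Real.exp (-gmR s) * ((Real.exp (-s) + 4 * s + 2) / 3))
        = Real.exp (gmR s) - (Real.exp (gmR s) * Real.exp (-gmR s)) * ((Real.exp (-s) + 4 * s + 2) / 3) := by ring
      rw [this, h1] at h2
      linarith
    have e : gmR s = (s + 2 - 2 * Real.exp (-s)) / 3 := rfl
    unfold gmF
    linarith
  · intro s
    have := (((gm_dR s).neg.exp).mul
      ((((gm_dexp s).add ((hasDerivAt_id s).const_mul 4)).add_const 2).div_const 3)).const_sub 1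
    refine this.congr_deriv ?_
    simp [-neg_sub]; ring
  · intro s h
    exact mul_nonneg (by positivity) (gm_h h.le)

lemma gm_key2 {s : ℝ} (hs : 0 ≤ s) : gmF (1 - Real.exp (-s)) ≤ gmF (-s) := by
  have := gm_mono (fun s => s + 1 - Real.exp (1 - Real.exp (-s)))
    (fun s => 1 - Real.exp (1 - Real.exp (-s)) * Real.exp (-s)) ?_ (by norm_num) ?_ hs
  · unfold gmF
    linarith
  · intro s
    have := ((hasDerivAt_id s).add_const 1).sub (((gm_dexp s).const_sub 1).exp)
    refine this.congr_deriv ?_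
    simp
  · intro s _
    rw [← Real.exp_add, sub_nonneg, Real.exp_le_one_iff]
    have := Real.add_one_le_exp (-s)
    linarith

noncomputable def gmG (x u : ℝ) : ℝ := Real.exp (-(x * gmF u))

lemma gmG_cont (x : ℝ) : Continuous (gmG x) := by unfold gmG gmF; fun_prop

lemma gmG_pos (x u : ℝ) : 0 < gmG x u := Real.exp_pos _

lemma gm_sub {x : ℝ} (hx : 0 < x) (u : ℝ) :
    (x * Real.exp u) • (Real.exp (-(x * Real.exp u)) * (x * Real.exp u) ^ (x - 1))
      = (Real.exp (-x) * x ^ x) * gmG x u := by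
  have h : 0 < x * Real.exp u := by positivity
  have h1 : (x * Real.exp u) ^ (x - 1) * (x * Real.exp u) = (x * Real.exp u) ^ x := by
    rw [← Real.rpow_add_one h.ne']; simp
  have h2 : (x * Real.exp u) ^ x = x ^ x * Real.exp (u * x) := by
    rw [Real.mul_rpow hx.le (Real.exp_pos u).le, ← Real.exp_mul]
  have h3 : gmG x u = Real.exp x * Real.exp (-(x * Real.exp u)) * Real.exp (u * x) := by
    unfold gmG gmF; rw [← Real.exp_add, ← Real.exp_add]; congr 1; ring
  have h4 : Real.exp (-x) * Real.exp x = 1 := by rw [← Real.exp_add]; simp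
  rw [h3, smul_eq_mul]
  calc _ = Real.exp (-(x * Real.exp u)) * ((x * Real.exp u) ^ (x - 1) * (x * Real.exp u)) := by ring
    _ = Real.exp (-(x * Real.exp u)) * (x ^ x * Real.exp (u * x)) := by rw [h1, h2]
    _ = (Real.exp (-x) * Real.exp x) * (Real.exp (-(x * Real.exp u)) * (x ^ x * Real.exp (u * x))) := by
      rw [h4, one_mul]
    _ = _ := by ring

lemma gm_mexp {x : ℝ} (hx : 0 < x) : StrictMono (fun u => x * Real.exp u) :=
  fun _ _ h => mul_lt_mul_of_pos_left (Real.exp_lt_exp.2 h) hx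

lemma gm_cv {x : ℝ} (hx : 0 < x) {S : Set ℝ} (hS : MeasurableSet S) :
    ∫ t in (fun u => x * Real.exp u) '' S, Real.exp (-t) * t ^ (x - 1)
      = (Real.exp (-x) * x ^ x) * ∫ u in S, gmG x u := by
  rw [integral_image_eq_integral_deriv_smul_of_monotoneOn hS (f' := fun u => x * Real.exp u)
    (fun u _ => ((Real.hasDerivAt_exp u).const_mul x).hasDerivWithinAt)
    ((gm_mexp hx).monotone.monotoneOn _), ← integral_const_mul]
  simp_rw [gm_sub hx]

lemma gm_im_univ {x : ℝ} (hx : 0 < x) : (fun u => x * Real.exp u) '' univ = Ioi 0 := by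
  ext t
  simp only [image_univ, mem_range, mem_Ioi]
  constructor
  · rintro ⟨u, rfl⟩; positivity
  · intro h
    exact ⟨Real.log (t / x), by rw [Real.exp_log (by positivity)]; field_simp⟩

lemma gm_im_Iic {x m : ℝ} (hx : 0 < x) (hm : 0 < m) :
    (fun u => x * Real.exp u) '' Iic (Real.log (m / x)) = Ioc 0 m := by
  have e : ∀ t, 0 < t → x * Real.exp (Real.log (t / x)) = t := fun t ht => by
    rw [Real.exp_log (by positivity)]; field_simp
  ext t
  simp only [mem_image, mem_Iic, mem_Ioc]
  constructor
  · rintro ⟨u, hu, rfl⟩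
    refine ⟨by positivity, ?_⟩
    have := (gm_mexp hx).monotone hu
    simp only [e m hm] at this
    exact this
  · rintro ⟨h, h'⟩
    refine ⟨Real.log (t / x), ?_, e t h⟩
    apply Real.log_le_log (by positivity)
    gcongr

lemma gmG_int {x : ℝ} (hx : 0 < x) : Integrable (gmG x) := by
  have h := Real.GammaIntegral_convergent hx
  rw [← gm_im_univ hx, integrableOn_image_iff_integrableOn_deriv_smul_of_monotoneOn
    MeasurableSet.univ (f' := fun u => x * Real.exp u)
    (fun u _ => ((Real.hasDerivAt_exp u).const_mul x).hasDerivWithinAt)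
    ((gm_mexp hx).monotone.monotoneOn _)] at h
  simp_rw [gm_sub hx] at h
  rw [integrableOn_univ] at h
  have hc : Real.exp (-x) * x ^ x ≠ 0 := by positivity
  exact (integrable_const_mul_iff (IsUnit.mk0 _ hc) _).1 h

lemma gm_dF (s : ℝ) : HasDerivAt (fun s => gmF (-s)) (1 - Real.exp (-s)) s := by
  have := ((gm_dexp s).sub_const 1).sub (hasDerivAt_neg s)
  refine this.congr_deriv ?_
  ring

lemma gm_one {x : ℝ} (hx : 0 < x) :
    ∫ s in Ioi 0, (1 - Real.exp (-s)) * gmG x (-s) = 1 / x := by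
  have hd : ∀ s ∈ Ici (0:ℝ), HasDerivAt (fun s => -(gmG x (-s) / x))
      ((1 - Real.exp (-s)) * gmG x (-s)) s := by
    intro s _
    have := ((((gm_dF s).const_mul x).neg.exp).div_const x).neg
    refine this.congr_deriv ?_
    unfold gmG
    simp only [Pi.neg_apply]
    field_simp
  rw [integral_Ioi_of_hasDerivAt_of_nonneg' hd (l := 0)]
  · simp [gmG, gmF]
  · intro s hs
    refine mul_nonneg ?_ (gmG_pos _ _).le
    have hs : 0 < s := hs
    have := Real.exp_le_one_iff.2 (by linarith : -s ≤ 0)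
    linarith
  · have : Tendsto (fun s => gmG x (-s)) atTop (nhds 0) := by
      unfold gmG
      apply Real.tendsto_exp_neg_atTop_nhds_zero.comp
      apply Tendsto.const_mul_atTop hx
      apply tendsto_atTop_mono (f := fun s => s + (-1))
      · intro s
        have := Real.exp_pos (-s)
        unfold gmF; linarith
      · exact tendsto_atTop_add_const_right _ _ tendsto_id
    simpa using (this.div_const x).neg

lemma gm_negint {x : ℝ} (hx : 0 < x) : Integrable (fun s => gmG x (-s)) := (gmG_int hx).comp_neg

lemma gm_bdd {x : ℝ} (hx : 0 < x) (c : ℝ → ℝ) (hc : Continuous c)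
    (hb : ∀ s, 0 < s → |c s| ≤ 1) : IntegrableOn (fun s => c s * gmG x (-s)) (Ioi 0) := by
  refine Integrable.bdd_mul (c := 1) (gm_negint hx).integrableOn hc.aestronglyMeasurable ?_
  exact (ae_restrict_mem measurableSet_Ioi).mono (fun s hs => hb s hs)

lemma gm_Rmono : StrictMono gmR := by
  apply strictMono_of_deriv_pos
  intro s
  rw [(gm_dR s).deriv]; positivity

lemma gm_im_R : gmR '' Ioi 0 ⊆ Ioi 0 ∧ Ioi 0 ⊆ gmR '' Ioi 0 := by
  have h0 : gmR 0 = 0 := by norm_num [gmR]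
  constructor
  · rintro _ ⟨s, hs, rfl⟩
    have := gm_Rmono (mem_Ioi.1 hs)
    rw [h0] at this; exact this
  · intro t ht
    have ht : 0 < t := ht
    have hc : ContinuousOn gmR (Icc 0 (3 * t)) := fun s _ => (gm_dR s).continuousAt.continuousWithinAt
    have h3 : t ≤ gmR (3 * t) := by
      have := Real.exp_le_one_iff.2 (by linarith : -(3*t) ≤ 0)
      unfold gmR; linarith
    obtain ⟨s, hs, rfl⟩ := intermediate_value_Icc (by linarith) hc ⟨h0.le.trans ht.le, h3⟩
    refine ⟨s, ?_, rfl⟩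
    rcases hs.1.eq_or_lt with h | h
    · rw [← h, h0] at ht; exact absurd ht (lt_irrefl _)
    · exact h

lemma gm_exp_le {s : ℝ} (hs : 0 < s) : Real.exp (-s) ≤ 1 := Real.exp_le_one_iff.2 (by linarith)

lemma gmG_anti {x u v : ℝ} (hx : 0 < x) (h : gmF u ≤ gmF v) : gmG x v ≤ gmG x u := by
  unfold gmG
  apply Real.exp_le_exp.2
  have := mul_le_mul_of_nonneg_left h hx.le
  linarith

lemma gm_A {x : ℝ} : ∫ u in Iic 0, gmG x u = ∫ s in Ioi 0, gmG x (-s) := by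
  rw [integral_comp_neg_Ioi]; simp

lemma gm_lower {x : ℝ} (hx : 0 < x) :
    2 / (3 * x) ≤ (∫ u in Iic 0, gmG x u) - ∫ u in Ioi 0, gmG x u := by
  have hB : ∫ u in Ioi 0, gmG x u = ∫ s in Ioi 0, ((1 + 2 * Real.exp (-s)) / 3) • gmG x (gmR s) := by
    rw [← integral_image_eq_integral_deriv_smul_of_monotoneOn measurableSet_Ioi
      (fun s _ => (gm_dR s).hasDerivWithinAt) (gm_Rmono.monotone.monotoneOn _),
      gm_im_R.1.antisymm gm_im_R.2]
  have hI : IntegrableOn (fun s => ((1 + 2 * Real.exp (-s)) / 3) • gmG x (gmR s)) (Ioi 0) := by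
    rw [← integrableOn_image_iff_integrableOn_deriv_smul_of_monotoneOn measurableSet_Ioi
      (fun s _ => (gm_dR s).hasDerivWithinAt) (gm_Rmono.monotone.monotoneOn _)]
    exact (gmG_int hx).integrableOn
  have hJ : IntegrableOn (fun s => ((1 + 2 * Real.exp (-s)) / 3) * gmG x (-s)) (Ioi 0) := by
    apply gm_bdd hx _ (by fun_prop)
    intro s hs
    have := gm_exp_le hs
    rw [abs_of_nonneg (by positivity)]; linarith
  have hK : IntegrableOn (fun s => (1 - Real.exp (-s)) * gmG x (-s)) (Ioi 0) := by
    apply gm_bdd hx _ (by fun_prop)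
    intro s hs
    have := gm_exp_le hs
    have := Real.exp_pos (-s)
    rw [abs_of_nonneg (by linarith)]; linarith
  have h1 : ∫ s in Ioi 0, ((1 + 2 * Real.exp (-s)) / 3) • gmG x (gmR s)
      ≤ ∫ s in Ioi 0, ((1 + 2 * Real.exp (-s)) / 3) * gmG x (-s) := by
    apply setIntegral_mono_on hI hJ measurableSet_Ioi
    intro s hs
    exact mul_le_mul_of_nonneg_left (gmG_anti hx (gm_key (le_of_lt hs))) (by positivity)
  have h2 : ∫ s in Ioi 0, gmG x (-s) = (∫ s in Ioi 0, ((1 + 2 * Real.exp (-s)) / 3) * gmG x (-s))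
      + (2 / 3) * ∫ s in Ioi 0, (1 - Real.exp (-s)) * gmG x (-s) := by
    rw [← integral_const_mul, ← integral_add hJ (hK.const_mul _)]
    congr 1; ext s; ring
  rw [gm_A, h2, gm_one hx, hB]
  have : 2 / (3 * x) = 2 / 3 * (1 / x) := by field_simp
  linarith

lemma gm_d1 (s : ℝ) : HasDerivAt (fun s : ℝ => 1 - Real.exp (-s)) (Real.exp (-s)) s := by
  simpa using (gm_dexp s).const_sub 1

lemma gm_upper {x : ℝ} (hx : 0 < x) :
    (∫ u in Iic 0, gmG x u) - (∫ u in Ioi 0, gmG x u) ≤ 1 / x := by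
  have hmono : Monotone (fun s : ℝ => 1 - Real.exp (-s)) := by
    intro a b h
    have := Real.exp_le_exp.2 (neg_le_neg h)
    simp only; linarith
  have hsub : (fun s : ℝ => 1 - Real.exp (-s)) '' Ioi 0 ⊆ Ioi 0 := by
    rintro _ ⟨s, hs, rfl⟩
    have hs : 0 < s := hs
    have := Real.exp_lt_one_iff.2 (by linarith : -s < 0)
    simp only [mem_Ioi]; linarith
  have hB : ∫ s in Ioi 0, (Real.exp (-s)) • gmG x (1 - Real.exp (-s)) ≤ ∫ u in Ioi 0, gmG x u := by
    rw [← integral_image_eq_integral_deriv_smul_of_monotoneOn measurableSet_Ioi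
      (fun s _ => (gm_d1 s).hasDerivWithinAt) (hmono.monotoneOn _)]
    exact setIntegral_mono_set (gmG_int hx).integrableOn
      (Eventually.of_forall fun u => (gmG_pos x u).le) hsub.eventuallyLE
  have hI : IntegrableOn (fun s => (Real.exp (-s)) • gmG x (1 - Real.exp (-s))) (Ioi 0) := by
    rw [← integrableOn_image_iff_integrableOn_deriv_smul_of_monotoneOn measurableSet_Ioi
      (fun s _ => (gm_d1 s).hasDerivWithinAt) (hmono.monotoneOn _)]
    exact (gmG_int hx).integrableOn
  have hJ : IntegrableOn (fun s => (Real.exp (-s)) * gmG x (-s)) (Ioi 0) := by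
    apply gm_bdd hx _ (by fun_prop)
    intro s hs
    rw [abs_of_nonneg (by positivity)]; exact gm_exp_le hs
  have hK : IntegrableOn (fun s => (1 - Real.exp (-s)) * gmG x (-s)) (Ioi 0) := by
    apply gm_bdd hx _ (by fun_prop)
    intro s hs
    have := gm_exp_le hs
    have := Real.exp_pos (-s)
    rw [abs_of_nonneg (by linarith)]; linarith
  have h1 : ∫ s in Ioi 0, (Real.exp (-s)) * gmG x (-s)
      ≤ ∫ s in Ioi 0, (Real.exp (-s)) • gmG x (1 - Real.exp (-s)) := by
    apply setIntegral_mono_on hJ hI measurableSet_Ioi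
    intro s hs
    exact mul_le_mul_of_nonneg_left (gmG_anti hx (gm_key2 (le_of_lt hs))) (by positivity)
  have h2 : ∫ s in Ioi 0, gmG x (-s) = (∫ s in Ioi 0, (Real.exp (-s)) * gmG x (-s))
      + ∫ s in Ioi 0, (1 - Real.exp (-s)) * gmG x (-s) := by
    rw [← integral_add hJ hK]
    congr 1; ext s; ring
  rw [gm_A, h2, gm_one hx]
  linarith

lemma gmF_pos {u : ℝ} (h : u ≠ 0) : 0 < gmF u := by
  have := Real.add_one_lt_exp h
  unfold gmF; linarith

lemma gm_main {x a : ℝ} (hx : 0 < x) (h : ∫ u in Iic a, gmG x u = ∫ u in Ioi a, gmG x u) :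
    x * a < -(1 / 3) ∧ -Real.log 2 < x * a := by
  have hi := gmG_int hx
  have hL := gm_lower hx
  have hU := gm_upper hx
  have e1 : (∫ u in Iic 0, gmG x u) - ∫ u in Iic a, gmG x u = ∫ u in a..0, gmG x u :=
    intervalIntegral.integral_Iic_sub_Iic hi.integrableOn hi.integrableOn
  have e2 : (∫ u in Ioi a, gmG x u) - ∫ u in Ioi 0, gmG x u = ∫ u in a..0, gmG x u := by
    have t1 := integral_add_compl (measurableSet_Iic (a := a)) hi
    have t2 := integral_add_compl (measurableSet_Iic (a := (0:ℝ))) hi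
    rw [compl_Iic] at t1 t2
    linarith
  have e3 : (∫ u in Iic 0, gmG x u) - (∫ u in Ioi 0, gmG x u) = 2 * ∫ u in a..0, gmG x u := by
    linarith
  rw [e3] at hL hU
  have hpos : 0 < 2 / (3 * x) := by positivity
  have ha : a < 0 := by
    by_contra hcon
    push Not at hcon
    rw [intervalIntegral.integral_symm] at hL
    have := intervalIntegral.integral_nonneg (μ := volume) hcon (fun u _ => (gmG_pos x u).le)
    linarith
  have hs1 : ∫ u in a..0, gmG x u < ∫ u in a..0, (1:ℝ) := by
    apply intervalIntegral.integral_lt_integral_of_continuousOn_of_le_of_exists_lt ha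
      (gmG_cont x).continuousOn continuousOn_const
    · intro u _
      have : gmG x u ≤ gmG x 0 := gmG_anti hx (by
        have := Real.add_one_le_exp u
        simp [gmF]; linarith)
      simpa [gmG, gmF] using this
    · refine ⟨a, ⟨le_rfl, ha.le⟩, ?_⟩
      unfold gmG
      apply Real.exp_lt_one_iff.2
      have := mul_pos hx (gmF_pos ha.ne)
      linarith
  have hs2 : ∫ u in a..0, Real.exp (x * u) < ∫ u in a..0, gmG x u := by
    apply intervalIntegral.integral_lt_integral_of_continuousOn_of_le_of_exists_lt ha
      (by fun_prop) (gmG_cont x).continuousOn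
    · intro u hu
      apply Real.exp_le_exp.2
      have := mul_nonneg hx.le (sub_nonneg.2 (Real.exp_le_one_iff.2 hu.2))
      unfold gmF; linarith
    · refine ⟨a, ⟨le_rfl, ha.le⟩, ?_⟩
      apply Real.exp_lt_exp.2
      have := mul_pos hx (sub_pos.2 (Real.exp_lt_one_iff.2 ha))
      unfold gmF; linarith
  have e4 : ∫ u in a..0, Real.exp (x * u) = (1 - Real.exp (x * a)) / x := by
    rw [intervalIntegral.integral_comp_mul_left (fun u => Real.exp u) hx.ne', integral_exp]
    simp; field_simp
  rw [e4] at hs2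
  simp only [intervalIntegral.integral_const, smul_eq_mul, mul_one, zero_sub] at hs1
  constructor
  · have : 2 / (3 * x) < 2 * (-a) := by linarith
    rw [div_lt_iff₀ (by positivity)] at this
    linarith
  · have h5 : 2 * ((1 - Real.exp (x * a)) / x) < 1 / x := by linarith
    rw [← mul_div_assoc, div_lt_div_iff_of_pos_right hx] at h5
    rw [← Real.log_inv]
    rw [Real.log_lt_iff_lt_exp (by norm_num)]
    linarith

/-- For every `x > 0` one has `x·2^{-1/x} < m(x) < x·e^{-1/(3x)}`;
equivalently, `1/3 < x·φ(x) < log 2`, where `φ(x) = log (x / m x)` and `m` is the median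
of the gamma distribution with parameter `x`. -/
theorem gammaMedian_bounds (m : ℝ → ℝ)
    (hm : ∀ x > (0:ℝ), 0 < m x ∧
      (∫ t in Set.Ioc (0:ℝ) (m x), Real.exp (-t) * t ^ (x - 1)) =
        (1/2) * ∫ t in Set.Ioi (0:ℝ), Real.exp (-t) * t ^ (x - 1)) :
    ∀ x > (0:ℝ),
      (x * (2:ℝ) ^ (-(1/x)) < m x ∧ m x < x * Real.exp (-(1/(3*x)))) ∧
      (1/3 < x * Real.log (x / m x) ∧ x * Real.log (x / m x) < Real.log 2) := by
  intro x hx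
  obtain ⟨hp, h⟩ := hm x hx
  have hx : 0 < x := hx
  rw [← gm_im_univ hx, ← gm_im_Iic hx hp, gm_cv hx measurableSet_Iic, gm_cv hx MeasurableSet.univ,
    setIntegral_univ, ← integral_add_compl (measurableSet_Iic (a := Real.log (m x / x))) (gmG_int hx),
    compl_Iic] at h
  have hc : 0 < Real.exp (-x) * x ^ x := by positivity
  have h' := mul_left_cancel₀ hc.ne' (h.trans (mul_left_comm _ _ _))
  obtain ⟨h1, h2⟩ := gm_main (a := Real.log (m x / x)) hx (by linarith)
  have hl : Real.log (x / m x) = - Real.log (m x / x) := by rw [← Real.log_inv, inv_div]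
  have hd : 0 < m x / x := by positivity
  refine ⟨⟨?_, ?_⟩, ?_, ?_⟩
  · have : -(Real.log 2 / x) < Real.log (m x / x) := by
      rw [← neg_div, div_lt_iff₀ hx]; linarith
    rw [Real.lt_log_iff_exp_lt hd, lt_div_iff₀ hx] at this
    rw [Real.rpow_def_of_pos (by norm_num)]
    have e : Real.log 2 * -(1 / x) = -(Real.log 2 / x) := by ring
    rw [e]; linarith
  · have : Real.log (m x / x) < -(1 / (3 * x)) := by
      have e : -(1 / (3 * x)) = (-(1/3)) / x := by field_simp
      rw [e, lt_div_iff₀ hx]; linarith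
    rw [Real.log_lt_iff_lt_exp hd, div_lt_iff₀ hx] at this
    linarith
  · rw [hl]; linarith
  · rw [hl]; linarith
end

section
/- The function x ↦ x·φ(x) = x·log(x/m(x)) is strictly decreasing on (0,∞). -/
open MeasureTheory Filter Set

noncomputable def gmK (c a : ℝ) : ℝ :=
  -Real.log (1 - a) - a - a / (1 - c * a) + Real.log (1 + a / (1 - c * a))

noncomputable def gmQ (c a : ℝ) : ℝ := (2 - 3 * c) * (1 - c * a) + c ^ 2 * (1 - c) * a ^ 2

lemma gmK_deriv (c a : ℝ) (h0 : 0 ≤ a) (h1 : a < 1) (h2 : c * a < 1) :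
    HasDerivAt (gmK c)
      (gmQ c a * (a ^ 2 / ((1 - a) * (1 - c * a) ^ 2 * (1 - c * a + a)))) a := by
  have e1 : 1 - a ≠ 0 := by linarith
  have e2 : 1 - c * a ≠ 0 := by linarith
  have p2 : 0 < 1 - c * a := by linarith
  have p3 : 0 < 1 + a / (1 - c * a) := by positivity
  have e4 : 1 - c * a + a ≠ 0 := by positivity
  have hA : HasDerivAt (fun a : ℝ => 1 - a) (-1) a := by
    simpa using (hasDerivAt_id a).const_sub 1
  have hB : HasDerivAt (fun a : ℝ => 1 - c * a) (-c) a := by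
    simpa using ((hasDerivAt_id a).const_mul c).const_sub 1
  have hC : HasDerivAt (fun a : ℝ => a / (1 - c * a)) _ a := (hasDerivAt_id' a).div hB e2
  have hD := (hC.const_add 1).log p3.ne'
  have hE := (((hA.log e1).neg.sub (hasDerivAt_id' a)).sub hC).add hD
  unfold gmK
  refine hE.congr_deriv ?_
  have e5 : 1 + a / (1 - c * a) = (1 - c * a + a) / (1 - c * a) := by rw [add_div, div_self e2]
  rw [e5]
  have e2' : 1 - a * c ≠ 0 := by rwa [mul_comm a c]
  have e4' : 1 - a * c + a ≠ 0 := by rwa [mul_comm a c]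
  unfold gmQ
  field_simp
  ring

lemma gm_ca {a b p : ℝ} (h0 : 0 < a) (hb : 0 < b) (hp0 : 0 ≤ p) (hp : p ≤ a) :
    (1 / a - 1 / b) * p < 1 := by
  have h1 : 1 / a * p ≤ 1 := by
    rw [one_div, inv_mul_le_one₀ h0]; exact hp
  rcases hp0.eq_or_lt with h | h
  · rw [← h]; norm_num
  · have : 0 < 1 / b * p := by positivity
    linarith

lemma gmK_eq {a b : ℝ} (h0 : 0 < a) (hb : 0 < b) :
    gmK (1 / a - 1 / b) a = (-Real.log (1 - a) - a) - (b - Real.log (1 + b)) := by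
  have : a / (1 - (1 / a - 1 / b) * a) = b := by field_simp; ring_nf; field_simp
  unfold gmK
  rw [this]; ring

lemma gmK_cont {a b : ℝ} (h0 : 0 < a) (h1 : a < 1) (hb : 0 < b) :
    ContinuousOn (gmK (1 / a - 1 / b)) (Icc 0 a) := fun p hp =>
  (gmK_deriv _ p hp.1 (by linarith [hp.2]) (gm_ca h0 hb hp.1 hp.2)).continuousAt.continuousWithinAt

lemma gm_pos {a b p : ℝ} (h0 : 0 < a) (h1 : a < 1) (hb : 0 < b) (hp0 : 0 < p) (hp : p ≤ a) :
    0 < p ^ 2 / ((1 - p) * (1 - (1 / a - 1 / b) * p) ^ 2 * (1 - (1 / a - 1 / b) * p + p)) := by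
  have := gm_ca h0 hb hp0.le hp
  have h2 : 0 < 1 - (1 / a - 1 / b) * p := by linarith
  have h3 : 0 < 1 - p := by linarith
  positivity

lemma gmK_zero (c : ℝ) : gmK c 0 = 0 := by simp [gmK]

lemma gm_ge {a b : ℝ} (h0 : 0 < a) (h1 : a < 1) (hb : 0 < b)
    (h : -Real.log (1 - a) - a = b - Real.log (1 + b)) : 2 / 3 ≤ 1 / a - 1 / b := by
  by_contra hc
  push Not at hc
  have hK := gmK_eq h0 hb
  have hcont := gmK_cont h0 h1 hb
  have hca := fun p hp0 hp => gm_ca (a := a) (b := b) (p := p) h0 hb hp0 hp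
  have hpos := fun p hp0 hp => gm_pos (a := a) (b := b) (p := p) h0 h1 hb hp0 hp
  set c := 1 / a - 1 / b with hcdef
  obtain ⟨p, hp, hp'⟩ := exists_hasDerivAt_eq_zero h0 hcont (by rw [hK, gmK_zero, h]; ring)
    (fun p hp => gmK_deriv c p hp.1.le (hp.2.trans h1) (hca p hp.1.le hp.2.le))
  have h3 := hpos p hp.1 hp.2.le
  have h4 := hca p hp.1.le hp.2.le
  have : gmQ c p = 0 := by
    rcases mul_eq_zero.1 hp' with h | h
    · exact h
    · exact absurd h h3.ne'
  have : 0 < gmQ c p := by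
    unfold gmQ
    have : 0 < (2 - 3 * c) * (1 - c * p) := mul_pos (by linarith) (by linarith)
    have : 0 ≤ c ^ 2 * (1 - c) * p ^ 2 :=
      mul_nonneg (mul_nonneg (sq_nonneg _) (by linarith)) (sq_nonneg _)
    linarith
  linarith

lemma gm_mono_s3 {a b a' b' : ℝ} (h0' : 0 < a') (hlt : a' < a) (h1 : a < 1) (hb : 0 < b)
    (hb' : 0 < b')
    (h : -Real.log (1 - a) - a = b - Real.log (1 + b))
    (h' : -Real.log (1 - a') - a' = b' - Real.log (1 + b')) :
    1 / a' - 1 / b' ≤ 1 / a - 1 / b := by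
  have h0 : 0 < a := h0'.trans hlt
  by_contra hcc
  push Not at hcc
  have hge := gm_ge h0 h1 hb h
  have hK := gmK_eq h0 hb
  have hcont := gmK_cont h0 h1 hb
  have hca := fun p hp0 hp => gm_ca (a := a) (b := b) (p := p) h0 hb hp0 hp
  have hpos := fun p hp0 hp => gm_pos (a := a) (b := b) (p := p) h0 h1 hb hp0 hp
  set c := 1 / a - 1 / b with hcdef
  have hKa : gmK c a = 0 := by rw [hK, h]; ring
  have hKa' : 0 < gmK c a' := by
    have hq : 0 < 1 - c * a' := by linarith [hca a' h0'.le hlt.le]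
    have hbc : a' / (1 - c * a') < b' := by
      rw [div_lt_iff₀ hq]
      have : c * a' < (1 / a' - 1 / b') * a' := by gcongr
      have e : (1 / a' - 1 / b') * a' = 1 - a' / b' := by field_simp
      have e2 : b' * (a' / b') = a' := by field_simp
      nlinarith
    have hbc0 : 0 < a' / (1 - c * a') := by positivity
    unfold gmK
    set s := a' / (1 - c * a')
    have : Real.log (1 + b') - Real.log (1 + s) < b' - s := by
      rw [← Real.log_div (by positivity) (by positivity)]
      have hne : (1 + b') / (1 + s) ≠ 1 := by
        rw [Ne, div_eq_one_iff_eq (by positivity)]; intro h; linarith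
      have := Real.log_lt_sub_one_of_pos (x := (1 + b') / (1 + s)) (by positivity) hne
      have e : (1 + b') / (1 + s) - 1 = (b' - s) / (1 + s) := by field_simp; ring
      have : (b' - s) / (1 + s) ≤ b' - s := div_le_self (by linarith) (by linarith)
      linarith
    linarith
  have hd : ∀ p, 0 ≤ p → p ≤ a → HasDerivAt (gmK c) _ p := fun p hp0 hp =>
    gmK_deriv c p hp0 (by linarith) (hca p hp0 hp)
  obtain ⟨p, hp, hp'⟩ := exists_hasDerivAt_eq_slope (gmK c) _ h0'
    (hcont.mono (Icc_subset_Icc le_rfl hlt.le))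
    (fun p hp => hd p hp.1.le (hp.2.trans hlt).le)
  obtain ⟨q, hq, hq'⟩ := exists_hasDerivAt_eq_slope (gmK c) _ hlt
    (hcont.mono (Icc_subset_Icc h0'.le le_rfl))
    (fun p hp => hd p (h0'.trans hp.1).le hp.2.le)
  rw [gmK_zero] at hp'
  rw [hKa] at hq'
  have hpp := hpos p hp.1 (hp.2.trans hlt).le
  have hqp := hpos q (h0'.trans hq.1) hq.2.le
  have hQp : 0 < gmQ c p := by
    refine pos_of_mul_pos_left (b := _) ?_ hpp.le
    rw [hp']; apply div_pos <;> linarith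
  have hQq : gmQ c q < 0 := by
    by_contra hh
    push Not at hh
    have h1 := mul_nonneg hh hqp.le
    rw [hq'] at h1
    have : (0 - gmK c a') / (a - a') < 0 := div_neg_of_neg_of_pos (by linarith) (by linarith)
    linarith
  have hcp := hca p hp.1.le (hp.2.trans hlt).le
  have hcq := hca q (h0'.trans hq.1).le hq.2.le
  unfold gmQ at hQp hQq
  have hpq : p < q := hp.2.trans hq.1
  have hp0 := hp.1
  have hc1 : 0 < 1 - c := by
    by_contra hh
    push Not at hh
    have : 0 ≤ (3 * c - 2) * (1 - c * p) := mul_nonneg (by linarith) (by linarith)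
    have : c ^ 2 * (1 - c) * p ^ 2 ≤ 0 :=
      mul_nonpos_of_nonpos_of_nonneg (mul_nonpos_of_nonneg_of_nonpos (sq_nonneg _) hh) (sq_nonneg _)
    linarith
  have i1 : c ^ 2 * (1 - c) * p ^ 2 ≤ c ^ 2 * (1 - c) * q ^ 2 := by gcongr
  have i2 : (3 * c - 2) * (1 - c * q) ≤ (3 * c - 2) * (1 - c * p) := by
    have : 0 ≤ 3 * c - 2 := by linarith
    gcongr
  linarith

noncomputable def gmw (r : ℝ) : ℝ := r - 1 - Real.log r

lemma gmw_pos {r : ℝ} (h : 0 < r) (h1 : r ≠ 1) : 0 < gmw r := by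
  have := Real.log_lt_sub_one_of_pos h h1
  unfold gmw; linarith

lemma gmw_deriv {r : ℝ} (h : 0 < r) : HasDerivAt gmw (1 - r⁻¹) r := by
  have := ((hasDerivAt_id' r).sub_const 1).sub (Real.hasDerivAt_log h.ne')
  exact this

lemma gmw_cont : ContinuousOn gmw (Ioi 0) := fun _ hr =>
  (gmw_deriv hr).continuousAt.continuousWithinAt

lemma gmw_anti : StrictAntiOn gmw (Ioc 0 1) := by
  apply strictAntiOn_of_deriv_neg (convex_Ioc 0 1) (gmw_cont.mono Ioc_subset_Ioi_self)
  intro r hr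
  rw [interior_Ioc] at hr
  rw [(gmw_deriv hr.1).deriv]
  have := (one_lt_inv₀ hr.1).2 hr.2
  linarith

lemma gmw_mono : StrictMonoOn gmw (Ici 1) := by
  apply strictMonoOn_of_deriv_pos (convex_Ici 1)
    (gmw_cont.mono (fun x hx => mem_Ioi.2 (lt_of_lt_of_le one_pos (mem_Ici.1 hx))))
  intro r hr
  rw [interior_Ici] at hr
  have h1 : (1:ℝ) < r := hr
  rw [(gmw_deriv (by linarith)).deriv]
  have := inv_lt_one_of_one_lt₀ h1
  linarith

lemma gmR_exists (v : ℝ) (hv : 0 < v) : ∃ r, 0 < r ∧ r < 1 ∧ gmw r = v := by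
  set e := Real.exp (-(v + 1)) with he
  have he0 : 0 < e := Real.exp_pos _
  have he1 : e ≤ 1 := by rw [he, Real.exp_le_one_iff]; linarith
  have hle : gmw e = e + v := by unfold gmw; rw [he, Real.log_exp]; ring
  have h1 : gmw 1 = 0 := by simp [gmw]
  obtain ⟨r, hr, hrv⟩ := intermediate_value_Icc' he1
    (gmw_cont.mono (fun x hx => lt_of_lt_of_le he0 hx.1))
    (show v ∈ Icc (gmw 1) (gmw e) from ⟨by linarith, by linarith⟩)
  refine ⟨r, lt_of_lt_of_le he0 hr.1, lt_of_le_of_ne hr.2 ?_, hrv⟩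
  rintro rfl; linarith

lemma gmS_exists (v : ℝ) (hv : 0 < v) : ∃ r, 1 < r ∧ gmw r = v := by
  have h1 : gmw 1 = 0 := by simp [gmw]
  have h2 : v ≤ gmw (2 * (v + 1)) := by
    unfold gmw
    rw [Real.log_mul (by norm_num) (by positivity)]
    have := Real.log_le_sub_one_of_pos (show 0 < v + 1 by linarith)
    have := Real.log_le_sub_one_of_pos (show (0:ℝ) < 2 by norm_num)
    linarith
  obtain ⟨r, hr, hrv⟩ := intermediate_value_Icc (show 1 ≤ 2 * (v + 1) by linarith)
    (gmw_cont.mono (fun x hx => lt_of_lt_of_le one_pos hx.1))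
    (show v ∈ Icc (gmw 1) (gmw (2 * (v + 1))) from ⟨by linarith, h2⟩)
  refine ⟨r, lt_of_le_of_ne hr.1 ?_, hrv⟩
  rintro rfl; linarith

lemma gm_change {x : ℝ} (hx : 0 < x) (s : Set ℝ) (hsm : MeasurableSet s)
    (hs0 : ∀ t ∈ s, 0 < t ∧ t ≠ x) (T : ℝ → ℝ)
    (hT : ∀ w > 0, x * T w ∈ s ∧ gmw (T w) = w)
    (hTl : ∀ t ∈ s, T (gmw (t / x)) = t / x) :
    IntegrableOn (fun v => Real.exp (-v) / |1 - T (v / x)|) (Ioi 0) ∧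
    (∫ t in s, Real.exp (-t) * t ^ (x - 1)) =
      (Real.exp (-x) * x ^ (x - 1)) * ∫ v in Ioi 0, Real.exp (-v) / |1 - T (v / x)| := by
  set κ := Real.exp (-x) * x ^ (x - 1) with hκ
  have hκ0 : 0 < κ := by positivity
  have hder : ∀ t ∈ s, HasDerivWithinAt (fun t => x * gmw (t / x)) (1 - x / t) s t := by
    intro t ht
    have ht0 := (hs0 t ht).1
    have h1 : HasDerivAt (fun t => t / x) (1 / x) t := (hasDerivAt_id' t).div_const x
    have h2 := ((gmw_deriv (div_pos ht0 hx)).comp t h1).const_mul x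
    refine (h2.congr_deriv ?_).hasDerivWithinAt
    field_simp
  have hinj : InjOn (fun t => x * gmw (t / x)) s := by
    intro t ht t' ht' h
    have h1 : gmw (t / x) = gmw (t' / x) := mul_left_cancel₀ hx.ne' h
    have h2 : t / x = t' / x := by rw [← hTl t ht, ← hTl t' ht', h1]
    field_simp at h2
    exact h2
  have him : (fun t => x * gmw (t / x)) '' s = Ioi 0 := by
    ext v
    constructor
    · rintro ⟨t, ht, rfl⟩
      have := hs0 t ht
      refine mul_pos hx (gmw_pos (div_pos this.1 hx) ?_)
      rw [Ne, div_eq_one_iff_eq hx.ne']; exact this.2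
    · intro hv
      have := hT (v / x) (div_pos hv hx)
      refine ⟨_, this.1, ?_⟩
      simp only
      rw [mul_div_cancel_left₀ _ hx.ne', this.2]
      field_simp
  have heq : ∀ t ∈ s, |1 - x / t| • (Real.exp (-(x * gmw (t / x))) /
      |1 - T ((x * gmw (t / x)) / x)|) = κ⁻¹ * (Real.exp (-t) * t ^ (x - 1)) := by
    intro t ht
    obtain ⟨ht0, htx⟩ := hs0 t ht
    rw [mul_div_cancel_left₀ _ hx.ne', hTl t ht]
    have e1 : |1 - x / t| = |x - t| / t := by
      rw [← abs_of_pos ht0, ← abs_div, abs_of_pos ht0, abs_sub_comm]; congr 1; field_simp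
    have e2 : |1 - t / x| = |x - t| / x := by
      rw [← abs_of_pos hx, ← abs_div, abs_of_pos hx]; congr 1; field_simp
    have e3 : |x - t| ≠ 0 := by rw [abs_ne_zero, sub_ne_zero]; exact htx.symm
    have e4 : Real.exp (-(x * gmw (t / x))) = Real.exp (-t) * Real.exp x * t ^ x / x ^ x := by
      rw [Real.rpow_def_of_pos ht0, Real.rpow_def_of_pos hx, ← Real.exp_add, ← Real.exp_add,
        ← Real.exp_sub]
      congr 1
      unfold gmw
      rw [Real.log_div ht0.ne' hx.ne']
      field_simp
      ring
    rw [e1, e2, e4, hκ, Real.rpow_sub_one hx.ne', Real.rpow_sub_one ht0.ne', Real.exp_neg x,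
      smul_eq_mul]
    field_simp
  have hg : IntegrableOn (fun t => Real.exp (-t) * t ^ (x - 1)) s :=
    (Real.GammaIntegral_convergent hx).mono_set (fun t ht => (hs0 t ht).1)
  constructor
  · rw [← him, integrableOn_image_iff_integrableOn_abs_deriv_smul hsm hder hinj]
    exact (integrableOn_congr_fun heq hsm).2 (hg.const_mul _)
  · rw [← him, integral_image_eq_integral_abs_deriv_smul hsm hder hinj,
      setIntegral_congr_fun hsm heq, integral_const_mul, ← mul_assoc, mul_inv_cancel₀ hκ0.ne',
      one_mul]

lemma gm_sub_s3 {x m : ℝ} (hx : 0 < x) (hm : 0 < m) :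
    (∫ t in m..x, Real.exp (-t) * t ^ (x - 1)) = (Real.exp (-x) * x ^ (x - 1)) *
      ∫ s in (0:ℝ)..(x * Real.log (x / m)), Real.exp (x - x * Real.exp (-(s / x)) - s) := by
  have hd : ∀ s ∈ uIcc 0 (x * Real.log (x / m)),
      HasDerivAt (fun s => x * Real.exp (-(s / x))) (-Real.exp (-(s / x))) s := by
    intro s _
    have := (((hasDerivAt_id' s).div_const x).neg.exp).const_mul x
    refine this.congr_deriv ?_
    field_simp
    rfl
  have h := intervalIntegral.integral_comp_mul_deriv' (g := fun t => Real.exp (-t) * t ^ (x - 1)) hd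
    (by fun_prop) (by
      rintro t ⟨s, _, rfl⟩
      apply ContinuousAt.continuousWithinAt
      apply ContinuousAt.mul (by fun_prop)
      apply Real.continuousAt_rpow_const
      left; positivity)
  have e1 : x * Real.exp (-(0 / x)) = x := by simp
  have e2 : x * Real.exp (-((x * Real.log (x / m)) / x)) = m := by
    rw [mul_div_cancel_left₀ _ hx.ne', Real.exp_neg, Real.exp_log (by positivity)]
    field_simp
  simp only [e1, e2] at h
  rw [intervalIntegral.integral_symm, ← h, ← intervalIntegral.integral_neg,
    ← intervalIntegral.integral_const_mul]
  congr 1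
  ext s
  simp only [Function.comp]
  rw [Real.mul_rpow hx.le (Real.exp_pos _).le, ← Real.exp_mul]
  have : Real.exp (x - x * Real.exp (-(s / x)) - s) =
    Real.exp x * Real.exp (-(x * Real.exp (-(s / x)))) *
      (Real.exp (-(s / x) * (x - 1)) * Real.exp (-(s / x))) := by
    rw [← Real.exp_add, ← Real.exp_add, ← Real.exp_add]
    congr 1
    field_simp
    ring
  rw [this, Real.exp_neg x]
  field_simp

lemma gm_h_mono {x y s : ℝ} (hx : 0 < x) (hxy : x < y) (hs : 0 < s) :
    Real.exp (x - x * Real.exp (-(s / x)) - s) < Real.exp (y - y * Real.exp (-(s / y)) - s) := by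
  apply Real.exp_lt_exp.2
  have hy : 0 < y := hx.trans hxy
  -- y e^{-s/y} - y < x e^{-s/x} - x
  have hder : ∀ z ∈ Ioi (0:ℝ), HasDerivAt (fun z => z - z * Real.exp (-(s / z)))
      (1 - (1 + s / z) * Real.exp (-(s / z))) z := by
    intro z hz
    have hz' : z ≠ 0 := ne_of_gt hz
    have h1 : HasDerivAt (fun z : ℝ => -(s / z)) (s / z ^ 2) z := by
      have := ((hasDerivAt_const z s).div (hasDerivAt_id' z) hz').neg
      refine this.congr_deriv ?_
      ring
    have := (hasDerivAt_id' z).sub ((hasDerivAt_id' z).mul h1.exp)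
    refine this.congr_deriv ?_
    field_simp
  have hmono : StrictMonoOn (fun z => z - z * Real.exp (-(s / z))) (Ioi 0) := by
    apply strictMonoOn_of_deriv_pos (convex_Ioi 0)
      (fun z hz => (hder z hz).continuousAt.continuousWithinAt)
    intro z hz
    rw [interior_Ioi] at hz
    rw [(hder z hz).deriv]
    have hz0 : 0 < z := hz
    have h1 : s / z + 1 < Real.exp (s / z) := Real.add_one_lt_exp (by positivity)
    have h2 : Real.exp (-(s / z)) * Real.exp (s / z) = 1 := by rw [← Real.exp_add]; simp
    nlinarith [Real.exp_pos (-(s / z))]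
  have := hmono (show x ∈ Ioi 0 from hx) (show y ∈ Ioi 0 from hy) hxy
  simp only at this
  linarith

/-- The function `x ↦ x·φ(x) = x·log (x / m x)` is strictly decreasing on
`(0,∞)`, where `m` is the median of the gamma distribution with parameter `x`. -/
theorem gammaMedian_xphi_strictAnti (m : ℝ → ℝ)
    (hm : ∀ x > (0:ℝ), 0 < m x ∧
      (∫ t in Set.Ioc (0:ℝ) (m x), Real.exp (-t) * t ^ (x - 1)) =
        (1/2) * ∫ t in Set.Ioi (0:ℝ), Real.exp (-t) * t ^ (x - 1)) :
    StrictAntiOn (fun x => x * Real.log (x / m x)) (Set.Ioi 0) := by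
  choose! R hR0 hR1 hRw using gmR_exists
  choose! S hS1 hSw using gmS_exists
  set ξ : ℝ → ℝ := fun w => 1 / (1 - R w) - 1 / (S w - 1) with hξ
  have hrel : ∀ w > 0, -Real.log (1 - (1 - R w)) - (1 - R w) =
      (S w - 1) - Real.log (1 + (S w - 1)) := by
    intro w hw
    have h1 := hRw w hw
    have h2 := hSw w hw
    unfold gmw at h1 h2
    rw [sub_sub_cancel, add_sub_cancel]
    linarith
  have hξpos : ∀ w > 0, 2 / 3 ≤ ξ w := fun w hw =>
    gm_ge (by linarith [hR1 w hw]) (by linarith [hR0 w hw]) (by linarith [hS1 w hw]) (hrel w hw)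
  have hξmono : ∀ w > 0, ∀ w' > 0, w < w' → ξ w ≤ ξ w' := by
    intro w hw w' hw' hlt
    refine gm_mono_s3 (by linarith [hR1 w hw]) ?_ (by linarith [hR0 w' hw'])
      (by linarith [hS1 w' hw']) (by linarith [hS1 w hw]) (hrel w' hw') (hrel w hw)
    have : R w' < R w := by
      rw [← gmw_anti.lt_iff_gt ⟨hR0 w hw, (hR1 w hw).le⟩ ⟨hR0 w' hw', (hR1 w' hw').le⟩,
        hRw w hw, hRw w' hw']
      exact hlt
    linarith
  -- the main identity
  have main : ∀ x > 0, IntegrableOn (fun v => Real.exp (-v) * ξ (v / x)) (Ioi 0) ∧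
      2 * (∫ s in (0:ℝ)..(x * Real.log (x / m x)), Real.exp (x - x * Real.exp (-(s / x)) - s)) =
        ∫ v in Ioi 0, Real.exp (-v) * ξ (v / x) := by
    intro x hx
    obtain ⟨hm0, hmx⟩ := hm x hx
    have hint := Real.GammaIntegral_convergent hx
    obtain ⟨iL, eL⟩ := gm_change hx (Ioo 0 x) measurableSet_Ioo (fun t ht => ⟨ht.1, ht.2.ne⟩) R
      (fun w hw => ⟨⟨mul_pos hx (hR0 w hw), by nlinarith [hR1 w hw]⟩, hRw w hw⟩)
      (by
        intro t ht
        have h0 : 0 < t / x := div_pos ht.1 hx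
        have h1 : t / x < 1 := (div_lt_one hx).2 ht.2
        have hp := gmw_pos h0 h1.ne
        exact gmw_anti.injOn ⟨hR0 _ hp, (hR1 _ hp).le⟩ ⟨h0, h1.le⟩ (hRw _ hp))
    obtain ⟨iU, eU⟩ := gm_change hx (Ioi x) measurableSet_Ioi
      (fun t ht => ⟨hx.trans ht, ne_of_gt ht⟩) S
      (fun w hw => ⟨by rw [mem_Ioi]; nlinarith [hS1 w hw], hSw w hw⟩)
      (by
        intro t ht
        have h1 : 1 < t / x := (one_lt_div hx).2 ht
        have hp := gmw_pos (by linarith) h1.ne'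
        exact gmw_mono.injOn (hS1 _ hp).le h1.le (hSw _ hp))
    have hfun : ∀ v ∈ Ioi (0:ℝ), Real.exp (-v) / |1 - R (v / x)| - Real.exp (-v) / |1 - S (v / x)| =
        Real.exp (-v) * ξ (v / x) := by
      intro v hv
      have hw : 0 < v / x := div_pos hv hx
      rw [abs_of_pos (by linarith [hR1 _ hw]), abs_of_neg (by linarith [hS1 _ hw]), neg_sub, hξ]
      simp only
      ring
    refine ⟨(integrableOn_congr_fun hfun measurableSet_Ioi).1 (iL.sub iU), ?_⟩
    rw [← setIntegral_congr_fun measurableSet_Ioi hfun, integral_sub iL iU]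
    have hκ0 : 0 < Real.exp (-x) * x ^ (x - 1) := by positivity
    apply mul_left_cancel₀ hκ0.ne'
    rw [mul_sub, ← eL, ← eU, mul_left_comm, ← gm_sub_s3 hx hm0]
    have hii : ∀ a > 0, IntervalIntegrable (fun t => Real.exp (-t) * t ^ (x - 1)) volume 0 a := by
      intro a ha
      rw [intervalIntegrable_iff_integrableOn_Ioc_of_le ha.le]
      exact hint.mono_set Ioc_subset_Ioi_self
    have h1 := intervalIntegral.integral_add_adjacent_intervals (hii _ hm0)
      ((hii _ hm0).symm.trans (hii _ hx))
    rw [intervalIntegral.integral_of_le hm0.le, hmx, intervalIntegral.integral_of_le hx.le] at h1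
    have h2 : (∫ t in Ioi 0, Real.exp (-t) * t ^ (x - 1)) =
        (∫ t in Ioc 0 x, Real.exp (-t) * t ^ (x - 1)) +
        ∫ t in Ioi x, Real.exp (-t) * t ^ (x - 1) := by
      rw [← Ioc_union_Ioi_eq_Ioi hx.le]
      exact setIntegral_union (Ioc_disjoint_Ioi le_rfl) measurableSet_Ioi
        (hint.mono_set Ioc_subset_Ioi_self) (hint.mono_set (Ioi_subset_Ioi hx.le))
    rw [← integral_Ioc_eq_integral_Ioo]
    linarith
  intro x hx y hy hxy
  have hx0 : 0 < x := hx
  have hy0 : 0 < y := hy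
  simp only
  by_contra hcon
  push Not at hcon
  obtain ⟨ix, ex⟩ := main x hx
  obtain ⟨iy, ey⟩ := main y hy
  set p := x * Real.log (x / m x)
  set q := y * Real.log (y / m y)
  have hD : (∫ v in Ioi 0, Real.exp (-v) * ξ (v / y)) ≤ ∫ v in Ioi 0, Real.exp (-v) * ξ (v / x) := by
    apply setIntegral_mono_on iy ix measurableSet_Ioi
    intro v hv
    have hv0 : 0 < v := hv
    apply mul_le_mul_of_nonneg_left _ (Real.exp_pos _).le
    exact hξmono _ (by positivity) _ (by positivity) (by gcongr)
  have hDpos : 0 < ∫ v in Ioi 0, Real.exp (-v) * ξ (v / x) := by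
    have : (∫ v in Ioi (0:ℝ), Real.exp (-v) * (2 / 3)) ≤
        ∫ v in Ioi 0, Real.exp (-v) * ξ (v / x) := by
      apply setIntegral_mono_on ((integrableOn_exp_neg_Ioi 0).mul_const _) ix measurableSet_Ioi
      intro v hv
      exact mul_le_mul_of_nonneg_left (hξpos _ (div_pos hv hx0)) (Real.exp_pos _).le
    rw [integral_mul_const, integral_exp_neg_Ioi] at this
    norm_num at this
    linarith
  have hci : ∀ z a b : ℝ, IntervalIntegrable
      (fun s => Real.exp (z - z * Real.exp (-(s / z)) - s)) volume a b := fun z a b =>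
    Continuous.intervalIntegrable (by fun_prop) a b
  have hp : 0 < p := by
    by_contra hp
    push Not at hp
    have : 0 ≤ ∫ s in p..0, Real.exp (x - x * Real.exp (-(s / x)) - s) :=
      intervalIntegral.integral_nonneg hp (fun s _ => (Real.exp_pos _).le)
    rw [intervalIntegral.integral_symm] at this
    linarith
  have h1 : (∫ s in (0:ℝ)..p, Real.exp (x - x * Real.exp (-(s / x)) - s)) <
      ∫ s in (0:ℝ)..p, Real.exp (y - y * Real.exp (-(s / y)) - s) := by
    apply intervalIntegral.integral_lt_integral_of_continuousOn_of_le_of_exists_lt hp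
      (by fun_prop) (by fun_prop)
    · intro s hs
      exact (gm_h_mono hx0 hxy hs.1).le
    · exact ⟨p, ⟨hp.le, le_rfl⟩, gm_h_mono hx0 hxy hp⟩
  have h2 : 0 ≤ ∫ s in p..q, Real.exp (y - y * Real.exp (-(s / y)) - s) :=
    intervalIntegral.integral_nonneg hcon (fun s _ => (Real.exp_pos _).le)
  have h3 := intervalIntegral.integral_add_adjacent_intervals (hci y 0 p) (hci y p q)
  linarith
end

section
/- One has lim_{x→0+} x·φ(x) = log 2 and lim_{x→∞} x·φ(x) = 1/3, where φ(x) = log(x/m(x)). -/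
open MeasureTheory Filter Set

lemma gm_zero_aux (x a : ℝ) (hx : 0 < x) (ha : 0 < a) :
    IntegrableOn (fun t : ℝ => t ^ (x - 1)) (Ioc 0 a) ∧
    (∫ t in Ioc (0:ℝ) a, t ^ (x - 1)) = a ^ x / x := by
  have h := intervalIntegral.intervalIntegrable_rpow' (a := 0) (b := a) (r := x - 1) (by linarith)
  refine ⟨(intervalIntegrable_iff_integrableOn_Ioc_of_le ha.le).1 h, ?_⟩
  rw [← intervalIntegral.integral_of_le ha.le, integral_rpow (Or.inl (by linarith))]
  simp [Real.zero_rpow hx.ne']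

lemma gm_zero (m : ℝ → ℝ)
    (hm : ∀ x > (0:ℝ), 0 < m x ∧
      (∫ t in Set.Ioc (0:ℝ) (m x), Real.exp (-t) * t ^ (x - 1)) =
        (1/2) * ∫ t in Set.Ioi (0:ℝ), Real.exp (-t) * t ^ (x - 1)) :
    Tendsto (fun x => x * Real.log (x / m x)) (nhdsWithin 0 (Set.Ioi 0))
        (nhds (Real.log 2)) := by
  have hxp : ∀ᶠ x : ℝ in nhdsWithin 0 (Ioi 0), 0 < x := eventually_mem_nhdsWithin
  have hid : Tendsto (fun x : ℝ => x) (nhdsWithin 0 (Ioi 0)) (nhds 0) :=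
    tendsto_id.mono_left nhdsWithin_le_nhds
  have hG : Tendsto (fun x : ℝ => Real.Gamma (x + 1)) (nhdsWithin 0 (Ioi 0)) (nhds 1) := by
    have h1 : ContinuousAt Real.Gamma (0 + 1) := by
      apply (Real.differentiableAt_Gamma _).continuousAt
      intro n; have : (0:ℝ) ≤ n := Nat.cast_nonneg n
      linarith
    have := h1.tendsto.comp (hid.add_const (1:ℝ))
    simpa [Function.comp_def] using this
  -- normalized median equation
  have key : ∀ x > (0:ℝ), x * (∫ t in Ioc (0:ℝ) (m x), Real.exp (-t) * t ^ (x - 1)) =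
      Real.Gamma (x + 1) / 2 := by
    intro x hx
    rw [(hm x hx).2, ← Real.Gamma_eq_integral hx, Real.Gamma_add_one hx.ne']; ring
  have hint : ∀ x > (0:ℝ), IntegrableOn (fun t : ℝ => Real.exp (-t) * t ^ (x - 1)) (Ioi 0) :=
    fun x hx => Real.GammaIntegral_convergent hx
  have mono : ∀ x > (0:ℝ), ∀ a b, a ≤ b →
      (∫ t in Ioc (0:ℝ) a, Real.exp (-t) * t ^ (x - 1)) ≤
      ∫ t in Ioc (0:ℝ) b, Real.exp (-t) * t ^ (x - 1) := by
    intro x hx a b hab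
    apply setIntegral_mono_set ((hint x hx).mono_set Ioc_subset_Ioi_self)
    · filter_upwards [ae_restrict_mem measurableSet_Ioc] with t ht
      have := ht.1
      simp only [Pi.zero_apply]; positivity
    · exact (Ioc_subset_Ioc_right hab).eventuallyLE
  have upper : ∀ x > (0:ℝ), ∀ a > 0,
      x * (∫ t in Ioc (0:ℝ) a, Real.exp (-t) * t ^ (x - 1)) ≤ a ^ x := by
    intro x hx a ha
    obtain ⟨h1, h2⟩ := gm_zero_aux x a hx ha
    have : (∫ t in Ioc (0:ℝ) a, Real.exp (-t) * t ^ (x - 1)) ≤ a ^ x / x := by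
      rw [← h2]
      apply setIntegral_mono_on ((hint x hx).mono_set Ioc_subset_Ioi_self) h1 measurableSet_Ioc
      intro t ht
      have := ht.1
      have h3 : Real.exp (-t) ≤ 1 := Real.exp_le_one_iff.2 (by linarith)
      have h4 : 0 ≤ t ^ (x - 1) := by positivity
      nlinarith
    rw [le_div_iff₀ hx] at this
    linarith
  have lower : ∀ x > (0:ℝ), ∀ a > 0,
      Real.exp (-a) * a ^ x ≤ x * (∫ t in Ioc (0:ℝ) a, Real.exp (-t) * t ^ (x - 1)) := by
    intro x hx a ha
    obtain ⟨h1, h2⟩ := gm_zero_aux x a hx ha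
    have : Real.exp (-a) * (a ^ x / x) ≤ (∫ t in Ioc (0:ℝ) a, Real.exp (-t) * t ^ (x - 1)) := by
      rw [← h2, ← integral_const_mul]
      apply setIntegral_mono_on (h1.const_mul _) ((hint x hx).mono_set Ioc_subset_Ioi_self)
        measurableSet_Ioc
      intro t ht
      have := ht.1
      have h3 : Real.exp (-a) ≤ Real.exp (-t) := Real.exp_le_exp.2 (by linarith [ht.2])
      have h4 : 0 ≤ t ^ (x - 1) := by positivity
      nlinarith
    calc Real.exp (-a) * a ^ x = x * (Real.exp (-a) * (a ^ x / x)) := by field_simp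
      _ ≤ _ := by gcongr
  have hexp : ∀ x > (0:ℝ), ∀ L : ℝ, (Real.exp (-L / x)) ^ x = Real.exp (-L) := by
    intro x hx L
    rw [← Real.exp_mul]; congr 1; field_simp
  have hmain : Tendsto (fun x => -(x * Real.log (m x))) (nhdsWithin 0 (Ioi 0))
      (nhds (Real.log 2)) := by
    rw [tendsto_order]
    constructor
    · intro L' hL'
      obtain ⟨L, hL1, hL2⟩ := exists_between (max_lt hL' (Real.log_pos one_lt_two))
      have hLL := (le_max_left _ _).trans_lt hL1
      have hL0 := (le_max_right _ _).trans_lt hL1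
      have hLh : 1 / 2 < Real.exp (-L) := by
        rw [one_div, ← Real.exp_log (two_pos (α := ℝ)), ← Real.exp_neg]
        exact Real.exp_lt_exp.2 (by linarith)
      have ha : Tendsto (fun x : ℝ => Real.exp (-L / x)) (nhdsWithin 0 (Ioi 0)) (nhds 0) := by
        apply Real.tendsto_exp_atBot.comp
        have := tendsto_inv_nhdsGT_zero (𝕜 := ℝ)
        exact (this.const_mul_atTop_of_neg (r := -L) (by linarith)).congr
          fun x => (div_eq_mul_inv _ _).symm
      have hl : Tendsto (fun x : ℝ => Real.exp (-Real.exp (-L / x)) * Real.exp (-L) -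
          Real.Gamma (x + 1) / 2) (nhdsWithin 0 (Ioi 0)) (nhds (1 * Real.exp (-L) - 1 / 2)) := by
        refine Tendsto.sub (Tendsto.mul_const _ ?_) (hG.div_const _)
        simpa [Function.comp_def] using (Real.continuous_exp.tendsto _).comp ha.neg
      filter_upwards [hxp, hl.eventually (lt_mem_nhds (a := 0) (by linarith))] with x hx h
      refine hLL.trans ?_
      by_contra hc
      have hmp := (hm x hx).1
      have hle : Real.exp (-L / x) ≤ m x := by
        rw [← Real.le_log_iff_exp_le hmp, div_le_iff₀ hx]; linarith
      have h1 := lower x hx _ (Real.exp_pos (-L / x))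
      rw [hexp x hx] at h1
      have h2 := mul_le_mul_of_nonneg_left (mono x hx _ _ hle) hx.le
      rw [key x hx] at h2
      linarith
    · intro L hL
      have hLh : Real.exp (-L) < 1 / 2 := by
        rw [one_div, ← Real.exp_log (two_pos (α := ℝ)), ← Real.exp_neg]
        exact Real.exp_lt_exp.2 (by linarith)
      have hl : Tendsto (fun x : ℝ => Real.Gamma (x + 1) / 2) (nhdsWithin 0 (Ioi 0))
        (nhds (1 / 2)) := hG.div_const _
      filter_upwards [hxp, hl.eventually (lt_mem_nhds hLh)] with x hx h
      by_contra hc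
      have hmp := (hm x hx).1
      have hle : m x ≤ Real.exp (-L / x) := by
        rw [← Real.log_le_iff_le_exp hmp, le_div_iff₀ hx]; linarith
      have h1 := upper x hx _ (Real.exp_pos (-L / x))
      rw [hexp x hx] at h1
      have h2 := mul_le_mul_of_nonneg_left (mono x hx _ _ hle) hx.le
      rw [key x hx] at h2
      linarith
  have hlog := tendsto_log_mul_rpow_nhdsGT_zero (r := 1) one_pos
  simp only [Real.rpow_one] at hlog
  have := hlog.add hmain
  rw [zero_add] at this
  refine this.congr' ?_
  filter_upwards [hxp] with x hx
  rw [Real.log_div hx.ne' (hm x hx).1.ne']; ring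

noncomputable def gmH (x u : ℝ) : ℝ := Real.exp (-(x * (Real.exp u - 1 - u)))

lemma gmH_cont (x : ℝ) : Continuous (gmH x) := by unfold gmH; fun_prop

lemma gm_deriv_eq (x u : ℝ) (hx : 0 < x) :
    |x * Real.exp u| • (Real.exp (-(x * Real.exp u)) * (x * Real.exp u) ^ (x - 1)) =
      (x ^ x * Real.exp (-x)) * gmH x u := by
  have h0 : 0 < x * Real.exp u := by positivity
  rw [abs_of_pos h0, smul_eq_mul, Real.rpow_sub_one h0.ne', Real.mul_rpow hx.le (Real.exp_pos u).le,
    ← Real.exp_mul, gmH]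
  have : Real.exp (-(x * Real.exp u)) * Real.exp (u * x) =
      Real.exp (-x) * Real.exp (-(x * (Real.exp u - 1 - u))) := by
    rw [← Real.exp_add, ← Real.exp_add]; congr 1; ring
  have h1 := Real.exp_pos u
  calc _ = x ^ x * (Real.exp (-(x * Real.exp u)) * Real.exp (u * x)) := by field_simp
    _ = _ := by rw [this]; ring

lemma gm_hd (x : ℝ) (S : Set ℝ) : ∀ u ∈ S,
    HasDerivWithinAt (fun u => x * Real.exp u) (x * Real.exp u) S u := fun u _ =>
  ((Real.hasDerivAt_exp u).const_mul x).hasDerivWithinAt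

lemma gm_inj (x : ℝ) (hx : 0 < x) (S : Set ℝ) : InjOn (fun u => x * Real.exp u) S := by
  intro a _ b _ h
  exact Real.exp_injective (mul_left_cancel₀ hx.ne' h)

lemma gm_subst (x : ℝ) (hx : 0 < x) (S : Set ℝ) (hS : MeasurableSet S) :
    (∫ t in (fun u => x * Real.exp u) '' S, Real.exp (-t) * t ^ (x - 1)) =
      (x ^ x * Real.exp (-x)) * ∫ u in S, gmH x u := by
  rw [integral_image_eq_integral_abs_deriv_smul hS (gm_hd x S) (gm_inj x hx S),
    ← integral_const_mul]
  simp only [gm_deriv_eq x _ hx]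

lemma gm_image_univ (x : ℝ) (hx : 0 < x) : (fun u => x * Real.exp u) '' univ = Ioi 0 := by
  ext t
  simp only [image_univ, mem_range, mem_Ioi]
  constructor
  · rintro ⟨u, rfl⟩; positivity
  · intro ht
    exact ⟨Real.log (t / x), by rw [Real.exp_log (by positivity)]; field_simp⟩

lemma gm_image_Iic (x a : ℝ) (hx : 0 < x) :
    (fun u => x * Real.exp u) '' (Iic a) = Ioc 0 (x * Real.exp a) := by
  ext t
  simp only [mem_image, mem_Iic, mem_Ioc]
  constructor
  · rintro ⟨u, hu, rfl⟩
    exact ⟨by positivity, by gcongr⟩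
  · rintro ⟨ht, h2⟩
    refine ⟨Real.log (t / x), ?_, by rw [Real.exp_log (by positivity)]; field_simp⟩
    rw [Real.log_le_iff_le_exp (by positivity), div_le_iff₀ hx]; linarith

lemma gmH_int (x : ℝ) (hx : 0 < x) : Integrable (gmH x) := by
  have h := Real.GammaIntegral_convergent hx
  rw [← gm_image_univ x hx, integrableOn_image_iff_integrableOn_abs_deriv_smul MeasurableSet.univ
    (gm_hd x _) (gm_inj x hx _)] at h
  simp only [gm_deriv_eq x _ hx, integrableOn_univ] at h
  have hN : x ^ x * Real.exp (-x) ≠ 0 := by positivity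
  exact (integrable_const_mul_iff (IsUnit.mk0 _ hN) _).1 h

/-- the median equation in logarithmic coordinates -/
lemma gm_median (m x : ℝ) (hx : 0 < x) (hm : 0 < m)
    (h : (∫ t in Set.Ioc (0:ℝ) m, Real.exp (-t) * t ^ (x - 1)) =
        (1/2) * ∫ t in Set.Ioi (0:ℝ), Real.exp (-t) * t ^ (x - 1)) :
    2 * ∫ u in Iic (-Real.log (x / m)), gmH x u = ∫ u, gmH x u := by
  have h1 : m = x * Real.exp (-Real.log (x / m)) := by
    rw [Real.exp_neg, Real.exp_log (by positivity)]; field_simp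
  rw [h1, ← gm_image_Iic x _ hx, ← gm_image_univ x hx, gm_subst x hx _ measurableSet_Iic,
    gm_subst x hx _ MeasurableSet.univ, Measure.restrict_univ] at h
  have hN : x ^ x * Real.exp (-x) ≠ 0 := by positivity
  apply mul_left_cancel₀ hN
  linarith

/-- decomposition -/
lemma gm_split (x c : ℝ) (hx : 0 < x) :
    2 * (∫ u in Iic (-c), gmH x u) - ∫ u, gmH x u =
      (∫ u in Ioi 0, (gmH x (-u) - gmH x u)) - 2 * ∫ u in (-c)..0, gmH x u := by
  have hi := gmH_int x hx
  have h1 := intervalIntegral.integral_Iic_add_Ioi (b := 0) hi.integrableOn hi.integrableOn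
  have h2 := intervalIntegral.integral_Iic_sub_Iic (a := -c) (b := 0) hi.integrableOn
    hi.integrableOn
  have h3 := integral_comp_neg_Ioi 0 (gmH x)
  rw [neg_zero] at h3
  rw [integral_sub hi.comp_neg.integrableOn hi.integrableOn, h3]
  linarith

lemma gm_small (c : ℝ) (hc : 0 < c) :
    Tendsto (fun x : ℝ => x * ∫ u in (-(c / x))..0, gmH x u) atTop (nhds c) := by
  have hlow : Tendsto (fun x : ℝ => c * Real.exp (-(c ^ 2 / x))) atTop (nhds c) := by
    have h1 : Tendsto (fun x : ℝ => -(c ^ 2 / x)) atTop (nhds (-0)) :=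
      (tendsto_const_nhds.div_atTop tendsto_id).neg
    simpa [Function.comp_def] using ((Real.continuous_exp.tendsto _).comp h1).const_mul c
  refine tendsto_of_tendsto_of_tendsto_of_le_of_le' hlow tendsto_const_nhds ?_ ?_
  · filter_upwards [eventually_gt_atTop 0, eventually_ge_atTop c] with x hx hxc
    have hcx : 0 < c / x := by positivity
    have : ∫ u in (-(c / x))..0, Real.exp (-(c ^ 2 / x)) ≤ ∫ u in (-(c / x))..0, gmH x u := by
      apply intervalIntegral.integral_mono_on (by linarith) (by simp)
        ((gmH_cont x).intervalIntegrable _ _)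
      intro u hu
      unfold gmH
      apply Real.exp_le_exp.2
      have h1 : c / x ≤ 1 := by rw [div_le_one hx]; exact hxc
      have hu1 : |u| ≤ c / x := by rw [abs_le]; constructor <;> linarith [hu.1, hu.2]
      have h2 := (abs_le.1 (Real.abs_exp_sub_one_sub_id_le (hu1.trans h1))).2
      have h3 : u ^ 2 ≤ (c / x) ^ 2 := by
        rw [← sq_abs u]; gcongr
      have h4 : x * (Real.exp u - 1 - u) ≤ x * (c / x) ^ 2 := by gcongr; linarith
      have h5 : x * (c / x) ^ 2 = c ^ 2 / x := by field_simp
      linarith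
    rw [intervalIntegral.integral_const, smul_eq_mul] at this
    calc c * Real.exp (-(c ^ 2 / x)) = x * ((0 - -(c / x)) * Real.exp (-(c ^ 2 / x))) := by
          field_simp; ring
      _ ≤ _ := by gcongr
  · filter_upwards [eventually_gt_atTop 0] with x hx
    have hcx : 0 < c / x := by positivity
    have : ∫ u in (-(c / x))..0, gmH x u ≤ ∫ u in (-(c / x))..0, (1:ℝ) := by
      apply intervalIntegral.integral_mono_on (by linarith)
        ((gmH_cont x).intervalIntegrable _ _) (by simp)
      intro u hu
      unfold gmH
      rw [Real.exp_le_one_iff]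
      have := Real.add_one_le_exp u
      have : 0 ≤ x * (Real.exp u - 1 - u) := mul_nonneg hx.le (by linarith)
      linarith
    rw [intervalIntegral.integral_const, smul_eq_mul] at this
    calc _ ≤ x * ((0 - -(c / x)) * 1) := by gcongr
      _ = c := by field_simp; ring

lemma gm_taylor2 : Tendsto (fun w : ℝ => (Real.exp w - 1 - w) / w ^ 2) (nhdsWithin 0 {0}ᶜ)
    (nhds (1/2)) := by
  have hz : Tendsto (fun w : ℝ => |w|) (nhdsWithin 0 {0}ᶜ) (nhds 0) := by
    simpa using (continuous_abs.tendsto (0:ℝ)).mono_left nhdsWithin_le_nhds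
  rw [tendsto_iff_norm_sub_tendsto_zero]
  refine squeeze_zero' (Eventually.of_forall fun _ => norm_nonneg _) ?_ hz
  filter_upwards [hz.eventually (gt_mem_nhds one_pos), eventually_mem_nhdsWithin] with w hw hw0
  have hw0 : w ≠ 0 := hw0
  have h := Real.exp_bound hw.le (n := 3) (by norm_num)
  simp [Finset.sum_range_succ, Nat.factorial] at h
  have e : (Real.exp w - 1 - w) / w ^ 2 - 1 / 2 = (Real.exp w - (1 + w + w ^ 2 / 2)) / w ^ 2 := by
    field_simp; ring
  rw [e, Real.norm_eq_abs, abs_div, div_le_iff₀ (by positivity), abs_of_nonneg (sq_nonneg w)]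
  have : |w| * w ^ 2 = |w| ^ 3 := by rw [← sq_abs w]; ring
  rw [this]
  have : 0 ≤ |w| ^ 3 := by positivity
  linarith

lemma gm_taylor3 : Tendsto (fun w : ℝ => (Real.exp w - Real.exp (-w) - 2 * w) / w ^ 3)
    (nhdsWithin 0 {0}ᶜ) (nhds (1/3)) := by
  have hz : Tendsto (fun w : ℝ => |w|) (nhdsWithin 0 {0}ᶜ) (nhds 0) := by
    simpa using (continuous_abs.tendsto (0:ℝ)).mono_left nhdsWithin_le_nhds
  rw [tendsto_iff_norm_sub_tendsto_zero]
  refine squeeze_zero' (Eventually.of_forall fun _ => norm_nonneg _) ?_ hz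
  filter_upwards [hz.eventually (gt_mem_nhds one_pos), eventually_mem_nhdsWithin] with w hw hw0
  have hw0 : w ≠ 0 := hw0
  have h := Real.exp_bound hw.le (n := 4) (by norm_num)
  have h' := Real.exp_bound (x := -w) (by simpa using hw.le) (n := 4) (by norm_num)
  simp [Finset.sum_range_succ, Nat.factorial] at h h'
  have e : (Real.exp w - Real.exp (-w) - 2 * w) / w ^ 3 - 1 / 3 =
      ((Real.exp w - Real.exp (-w) - 2 * w) - w ^ 3 / 3) / w ^ 3 := by
    field_simp
  rw [e, Real.norm_eq_abs, abs_div, div_le_iff₀ (by positivity), abs_pow]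
  have : |w| * |w| ^ 3 = |w| ^ 4 := by ring
  rw [this]
  have : 0 ≤ |w| ^ 4 := by positivity
  have e3 : (-w) ^ 3 = - w ^ 3 := by ring
  rw [abs_le] at h h' ⊢
  rw [e3] at h'
  constructor <;> linarith [h.1, h.2, h'.1, h'.2]

lemma gm_bound_small (w : ℝ) (h0 : 0 ≤ w) (h1 : w ≤ 1) :
    w ^ 2 / 4 ≤ Real.exp (-w) - 1 + w ∧ Real.exp w - Real.exp (-w) - 2 * w ≤ w ^ 3 := by
  have hw : |w| = w := abs_of_nonneg h0
  have h := Real.exp_bound (x := w) (by rw [hw]; exact h1) (n := 3) (by norm_num)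
  have h' := Real.exp_bound (x := -w) (by rw [abs_neg, hw]; exact h1) (n := 3) (by norm_num)
  simp [Finset.sum_range_succ, Nat.factorial] at h h'
  rw [hw, abs_le] at h h'
  have : 0 ≤ w ^ 3 := by positivity
  have : w ^ 3 ≤ w ^ 2 := pow_le_pow_of_le_one h0 h1 (by norm_num)
  constructor <;> linarith [h.1, h.2, h'.1, h'.2]

lemma gm_bound_large (w : ℝ) (h1 : 1 ≤ w) : w / 4 ≤ Real.exp (-w) - 1 + w := by
  have h := Real.add_one_le_exp (1 - w)
  have e : Real.exp (-w) = Real.exp (-1) * Real.exp (1 - w) := by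
    rw [← Real.exp_add]; congr 1; ring
  have hq1 : Real.exp (-1) ≤ 0.37 := by linarith [Real.exp_neg_one_lt_d9]
  have hq2 : 0.36 ≤ Real.exp (-1) := by linarith [Real.exp_neg_one_gt_d9]
  have : Real.exp (-1) * (1 - w + 1) ≤ Real.exp (-w) := by rw [e]; gcongr
  nlinarith

lemma gm_main_lim :
    Tendsto (fun x : ℝ => x * ∫ u in Ioi 0, (gmH x (-u) - gmH x u)) atTop (nhds (2/3)) := by
  have hlim : ∫ s in Ioi (0:ℝ), (s ^ (3:ℝ) * Real.exp (-(1/2) * s ^ (2:ℝ))) / 3 = 2 / 3 := by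
    rw [integral_div, integral_rpow_mul_exp_neg_mul_rpow (by norm_num) (by norm_num) (by norm_num)]
    have : ((3:ℝ) + 1) / 2 = 1 + 1 := by norm_num
    rw [this, Real.Gamma_add_one one_ne_zero, Real.Gamma_one]
    have : -((3:ℝ) + 1) / 2 = -2 := by norm_num
    rw [this, Real.rpow_neg (by norm_num)]
    norm_num
  rw [← hlim]
  have hresc : ∀ᶠ x : ℝ in atTop,
      (∫ s in Ioi (0:ℝ), √x * (gmH x (-((√x)⁻¹ * s)) - gmH x ((√x)⁻¹ * s))) =
      x * ∫ u in Ioi 0, (gmH x (-u) - gmH x u) := by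
    filter_upwards [eventually_gt_atTop 0] with x hx
    have hr : 0 < (√x)⁻¹ := by positivity
    rw [integral_const_mul, integral_comp_mul_left_Ioi (fun u => gmH x (-u) - gmH x u) 0 hr,
      inv_inv, mul_zero, smul_eq_mul, ← mul_assoc, Real.mul_self_sqrt hx.le]
  refine Tendsto.congr' hresc ?_
  apply tendsto_integral_filter_of_dominated_convergence
    (fun s => s ^ (3:ℝ) * Real.exp (-(1/4) * s ^ (2:ℝ)) + s ^ (1:ℝ) * Real.exp (-(1/4) * s ^ (1:ℝ)))
  · refine Eventually.of_forall fun x => Continuous.aestronglyMeasurable ?_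
    have := gmH_cont x
    fun_prop
  · filter_upwards [eventually_ge_atTop 1] with x hx
    filter_upwards [ae_restrict_mem measurableSet_Ioi] with s hs
    have hs : 0 < s := hs
    have hx0 : 0 < x := by linarith
    have hr1 : 1 ≤ √x := Real.one_le_sqrt.2 hx
    have hrx : √x ^ 2 = x := Real.sq_sqrt hx0.le
    simp only [Real.rpow_one, Real.rpow_ofNat]
    generalize hr : √x = r at *
    set w := r⁻¹ * s with hw
    have hr0 : 0 < r := by linarith
    have hw0 : 0 < w := by positivity
    have hsw : s = r * w := by rw [hw]; field_simp
    have hBA : 0 ≤ Real.exp w - Real.exp (-w) - 2 * w := by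
      have := Real.self_le_sinh_iff.2 hw0.le
      rw [Real.sinh_eq] at this
      linarith
    set y := x * (Real.exp w - Real.exp (-w) - 2 * w) with hy
    have hy0 : 0 ≤ y := by positivity
    have hB : gmH x w = gmH x (-w) * Real.exp (-y) := by
      unfold gmH; rw [← Real.exp_add]; congr 1; rw [hy]; ring
    have hA0 : 0 < gmH x (-w) := Real.exp_pos _
    have e1 : Real.exp (-y) ≤ 1 := Real.exp_le_one_iff.2 (by linarith)
    have e2 := Real.one_sub_le_exp_neg y
    have e3 := Real.exp_pos (-y)
    have e : r * (gmH x (-w) - gmH x w) = r * gmH x (-w) * (1 - Real.exp (-y)) := by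
      rw [hB]; ring
    rw [e, Real.norm_eq_abs, abs_of_nonneg (mul_nonneg (by positivity) (by linarith))]
    rcases le_total w 1 with h1 | h1
    · obtain ⟨b1, b2⟩ := gm_bound_small w hw0.le h1
      have hA : gmH x (-w) ≤ Real.exp (-(1/4) * s ^ 2) := by
        apply Real.exp_le_exp.2
        have : x * (w ^ 2 / 4) ≤ x * (Real.exp (-w) - 1 - -w) := by gcongr; linarith
        have e5 : x * (w ^ 2 / 4) = 1 / 4 * s ^ 2 := by rw [hsw, ← hrx]; ring
        linarith
      have hyb : r * y ≤ s ^ 3 := by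
        have : r * y ≤ r * (x * w ^ 3) := by rw [hy]; gcongr
        have e5 : r * (x * w ^ 3) = s ^ 3 := by rw [hsw, ← hrx]; ring
        linarith
      calc r * gmH x (-w) * (1 - Real.exp (-y)) ≤ r * gmH x (-w) * y := by gcongr; linarith
        _ = (r * y) * gmH x (-w) := by ring
        _ ≤ s ^ 3 * Real.exp (-(1/4) * s ^ 2) := by gcongr
        _ ≤ _ := le_add_of_nonneg_right (by positivity)
    · have b := gm_bound_large w h1
      have hrs : r ≤ s := by rw [hsw]; nlinarith
      have hA : gmH x (-w) ≤ Real.exp (-(1/4) * s) := by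
        apply Real.exp_le_exp.2
        have : x * (w / 4) ≤ x * (Real.exp (-w) - 1 - -w) := by gcongr; linarith
        have e5 : x * (w / 4) = r * (1 / 4 * s) := by rw [hsw, ← hrx]; ring
        nlinarith
      calc r * gmH x (-w) * (1 - Real.exp (-y)) ≤ r * gmH x (-w) * 1 := by gcongr; linarith
        _ = r * gmH x (-w) := by ring
        _ ≤ s * Real.exp (-(1/4) * s) := by gcongr
        _ ≤ _ := le_add_of_nonneg_left (by positivity)
  · exact (integrableOn_rpow_mul_exp_neg_mul_rpow (by norm_num) (by norm_num) (by norm_num)).add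
      (integrableOn_rpow_mul_exp_neg_mul_rpow (by norm_num) (by norm_num) (by norm_num))
  · filter_upwards [ae_restrict_mem measurableSet_Ioi] with s hs
    have hs : 0 < s := hs
    have hw0 : Tendsto (fun x : ℝ => (√x)⁻¹ * s) atTop (nhds 0) := by
      simpa using (tendsto_inv_atTop_zero.comp Real.tendsto_sqrt_atTop).mul_const s
    have hw : Tendsto (fun x : ℝ => (√x)⁻¹ * s) atTop (nhdsWithin 0 {0}ᶜ) := by
      refine tendsto_nhdsWithin_iff.2 ⟨hw0, ?_⟩
      filter_upwards [eventually_gt_atTop 0] with x hx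
      have : 0 < (√x)⁻¹ * s := by positivity
      exact this.ne'
    have hwn : Tendsto (fun x : ℝ => -((√x)⁻¹ * s)) atTop (nhdsWithin 0 {0}ᶜ) := by
      refine tendsto_nhdsWithin_iff.2 ⟨by simpa using hw0.neg, ?_⟩
      filter_upwards [eventually_gt_atTop 0] with x hx
      have : 0 < (√x)⁻¹ * s := by positivity
      exact (neg_neg_of_pos this).ne
    have hgen : ∀ v : ℝ → ℝ, Tendsto v atTop (nhdsWithin 0 {0}ᶜ) →
        (∀ᶠ x in atTop, x * v x ^ 2 = s ^ 2 ∧ v x ≠ 0) →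
        Tendsto (fun x => gmH x (v x)) atTop (nhds (Real.exp (-(1/2) * s ^ 2))) := by
      intro v hv he
      have h1 := ((gm_taylor2.comp hv).mul_const (s ^ 2)).neg
      have h2 := (Real.continuous_exp.tendsto _).comp h1
      rw [← neg_mul] at h2
      refine h2.congr' ?_
      filter_upwards [he] with x hx
      simp only [Function.comp_apply, gmH]
      rw [← hx.1]
      have := hx.2
      congr 2
      field_simp
    have hA := hgen _ hwn (by
      filter_upwards [eventually_gt_atTop 0] with x hx
      have h : 0 < (√x)⁻¹ * s := by positivity
      refine ⟨?_, (neg_neg_of_pos h).ne⟩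
      rw [neg_sq, mul_pow, inv_pow, Real.sq_sqrt hx.le]; field_simp)
    have hB := hgen _ hw (by
      filter_upwards [eventually_gt_atTop 0] with x hx
      have h : 0 < (√x)⁻¹ * s := by positivity
      refine ⟨?_, h.ne'⟩
      rw [mul_pow, inv_pow, Real.sq_sqrt hx.le]; field_simp)
    have hY : Tendsto (fun x : ℝ => √x * (x * (Real.exp ((√x)⁻¹ * s) - Real.exp (-((√x)⁻¹ * s)) -
        2 * ((√x)⁻¹ * s)))) atTop (nhds (1 / 3 * s ^ 3)) := by
      refine ((gm_taylor3.comp hw).mul_const (s ^ 3)).congr' ?_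
      filter_upwards [eventually_gt_atTop 0] with x hx
      have hr0 : 0 < √x := by positivity
      have h : 0 < (√x)⁻¹ * s := by positivity
      simp only [Function.comp_apply]
      generalize Real.exp ((√x)⁻¹ * s) - Real.exp (-((√x)⁻¹ * s)) - 2 * ((√x)⁻¹ * s) = E
      have e : √x * x = √x ^ 3 := by
        nth_rewrite 2 [← Real.sq_sqrt hx.le]; ring
      rw [← mul_assoc, e]
      field_simp
    have hT : s ^ (3:ℝ) * Real.exp (-(1/2) * s ^ (2:ℝ)) / 3 =
        1 / 3 * s ^ 3 * Real.exp (-(1/2) * s ^ 2) := by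
      simp only [Real.rpow_ofNat]; ring
    rw [hT]
    refine tendsto_of_tendsto_of_tendsto_of_le_of_le' (hY.mul hB) (hY.mul hA) ?_ ?_
    all_goals
      filter_upwards [eventually_gt_atTop 0] with x hx
      have hr0 : 0 < √x := by positivity
      generalize (√x)⁻¹ * s = w
      set y := x * (Real.exp w - Real.exp (-w) - 2 * w) with hy
      have hB : gmH x (-w) = gmH x w * Real.exp y := by
        unfold gmH; rw [← Real.exp_add]; congr 1; rw [hy]; ring
      have hB' : gmH x w = gmH x (-w) * Real.exp (-y) := by
        unfold gmH; rw [← Real.exp_add]; congr 1; rw [hy]; ring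
      have hA0 : 0 < gmH x (-w) := Real.exp_pos _
      have hB0 : 0 < gmH x w := Real.exp_pos _
      rw [mul_assoc]
      apply mul_le_mul_of_nonneg_left _ hr0.le
    · rw [hB]
      nlinarith [Real.add_one_le_exp y]
    · rw [hB']
      nlinarith [Real.one_sub_le_exp_neg y]

lemma gm_K (c : ℝ) (hc : 0 < c) :
    Tendsto (fun x : ℝ => x * (2 * (∫ u in Iic (-(c / x)), gmH x u) - ∫ u, gmH x u)) atTop
      (nhds (2 / 3 - 2 * c)) := by
  refine (gm_main_lim.sub ((gm_small c hc).const_mul 2)).congr' ?_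
  filter_upwards [eventually_gt_atTop 0] with x hx
  rw [gm_split x _ hx]
  ring

lemma gm_top (m : ℝ → ℝ)
    (hm : ∀ x > (0:ℝ), 0 < m x ∧
      (∫ t in Set.Ioc (0:ℝ) (m x), Real.exp (-t) * t ^ (x - 1)) =
        (1/2) * ∫ t in Set.Ioi (0:ℝ), Real.exp (-t) * t ^ (x - 1)) :
    Tendsto (fun x => x * Real.log (x / m x)) atTop (nhds (1/3)) := by
  have mono : ∀ x > (0:ℝ), ∀ a b, a ≤ b → (∫ u in Iic a, gmH x u) ≤ ∫ u in Iic b, gmH x u := by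
    intro x hx a b hab
    apply setIntegral_mono_set (gmH_int x hx).integrableOn
    · exact Eventually.of_forall fun u => (Real.exp_pos _).le
    · exact (Iic_subset_Iic.2 hab).eventuallyLE
  rw [tendsto_order]
  constructor
  · intro c' hc'
    obtain ⟨c, hc1, hc2⟩ := exists_between (max_lt hc' (show (0:ℝ) < 1/3 by norm_num))
    have hcc := (le_max_left _ _).trans_lt hc1
    have hc0 := (le_max_right _ _).trans_lt hc1
    filter_upwards [eventually_gt_atTop 0,
      (gm_K c hc0).eventually (lt_mem_nhds (a := 0) (by linarith))] with x hx h
    refine hcc.trans ?_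
    by_contra hcon
    have hle : Real.log (x / m x) ≤ c / x := by rw [le_div_iff₀ hx]; linarith
    have h1 := mono x hx _ _ (neg_le_neg hle)
    have h2 := gm_median (m x) x hx (hm x hx).1 (hm x hx).2
    have h3 := pos_of_mul_pos_right h hx.le
    linarith
  · intro c hc
    have hc0 : 0 < c := by linarith
    filter_upwards [eventually_gt_atTop 0,
      (gm_K c hc0).eventually_lt_const (show 2 / 3 - 2 * c < 0 by linarith)] with x hx h
    by_contra hcon
    have hle : c / x ≤ Real.log (x / m x) := by rw [div_le_iff₀ hx]; linarith
    have h1 := mono x hx _ _ (neg_le_neg hle)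
    have h2 := gm_median (m x) x hx (hm x hx).1 (hm x hx).2
    have h3 := neg_of_mul_neg_right h hx.le
    linarith

/-- `lim_{x→0+} x·φ(x) = log 2` and `lim_{x→∞} x·φ(x) = 1/3`, where
`φ(x) = log (x / m x)` and `m` is the median of the gamma distribution with parameter `x`. -/
theorem gammaMedian_xphi_limits (m : ℝ → ℝ)
    (hm : ∀ x > (0:ℝ), 0 < m x ∧
      (∫ t in Set.Ioc (0:ℝ) (m x), Real.exp (-t) * t ^ (x - 1)) =
        (1/2) * ∫ t in Set.Ioi (0:ℝ), Real.exp (-t) * t ^ (x - 1)) :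
    Tendsto (fun x => x * Real.log (x / m x)) (nhdsWithin 0 (Set.Ioi 0))
        (nhds (Real.log 2)) ∧
      Tendsto (fun x => x * Real.log (x / m x)) atTop (nhds (1/3)) :=
  ⟨gm_zero m hm, gm_top m hm⟩
end

section
/- For every x > 0 one has 0 < m'(x) < 1, where m' is the derivative of the (real analytic) median function m of the gamma distributions. Equivalently, in terms of φ(x) = log(x/m(x)), one has 1 − x·φ'(x) < e^{φ(x)} for all x > 0. -/
open MeasureTheory Filter Set

lemma gm_pos_s6 {f f' : ℝ → ℝ} (hf0 : f 0 = 0) (hfc : ContinuousOn f (Ici 0))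
    (x : ℝ) (hx : 0 < x)
    (hf : ∀ y, 0 < y → y < x → HasDerivAt f (f' y) y) (hp : ∀ y, 0 < y → y < x → 0 < f' y) : 0 < f x := by
  have : StrictMonoOn f (Icc 0 x) := by
    apply strictMonoOn_of_deriv_pos (convex_Icc 0 x) (hfc.mono Icc_subset_Ici_self)
    intro y hy
    rw [interior_Icc] at hy
    rw [(hf y hy.1 hy.2).deriv]
    exact hp y hy.1 hy.2
  have := this (left_mem_Icc.2 hx.le) (right_mem_Icc.2 hx.le) hx
  rwa [hf0] at this

lemma gm_cross {f g f' g' : ℝ → ℝ} (hf0 : f 0 = 0) (hg0 : g 0 = 0)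
    (hfc : ContinuousOn f (Ici 0)) (hgc : ContinuousOn g (Ici 0))
    (hf : ∀ x, 0 < x → HasDerivAt f (f' x) x) (hg : ∀ x, 0 < x → HasDerivAt g (g' x) x)
    (hp : ∀ x, 0 < x → 0 < g' x)
    (h : ∀ c x, 0 < c → c < x → f' c * g' x < f' x * g' c) :
    ∀ c x, 0 < c → c < x → f c * g x < f x * g c := by
  have gpos : ∀ x, 0 < x → 0 < g x := fun x hx =>
    gm_pos_s6 hg0 hgc x hx (fun y hy _ => hg y hy) (fun y hy _ => hp y hy)
  have key : ∀ x, 0 < x → 0 < f' x * g x - g' x * f x := by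
    intro x hx
    refine gm_pos_s6 (f := fun c => f' x * g c - g' x * f c)
      (f' := fun c => f' x * g' c - g' x * f' c) (by simp [hf0, hg0]) ?_ x hx ?_ ?_
    · exact (hgc.const_mul _).sub (hfc.const_mul _)
    · intro y hy _
      exact ((hg y hy).const_mul _).sub ((hf y hy).const_mul _)
    · intro y hy hyx
      have := h y x hy hyx
      linarith
  have hm : StrictMonoOn (fun x => f x / g x) (Ioi 0) := by
    have hd : ∀ x, 0 < x → HasDerivAt (fun x => f x / g x) ((f' x * g x - f x * g' x) / g x ^ 2) x :=
      fun x hx => (hf x hx).div (hg x hx) (gpos x hx).ne'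
    apply strictMonoOn_of_deriv_pos (convex_Ioi 0)
    · intro x hx
      exact (hd x hx).continuousAt.continuousWithinAt
    · intro x hx
      rw [interior_Ioi] at hx
      rw [(hd x hx).deriv]
      have := key x hx
      have h2 := gpos x hx
      apply div_pos _ (by positivity)
      linarith
  intro c x hc hcx
  have := hm (show c ∈ Ioi (0:ℝ) from hc) (show x ∈ Ioi (0:ℝ) from hc.trans hcx) hcx
  simp only at this
  rwa [div_lt_div_iff₀ (gpos c hc) (gpos x (hc.trans hcx))] at this

open Real in
lemma gm_cross1 : ∀ c x : ℝ, 0 < c → c < x → c * cosh c * sinh x < x * cosh x * sinh c := by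
  refine gm_cross (f := fun w => w * cosh w) (g := sinh) (f' := fun w => 1 * cosh w + w * sinh w) (g' := cosh)
    (by simp) (by simp) (by fun_prop) (by fun_prop) ?_ ?_ ?_ ?_
  · intro x _
    exact (hasDerivAt_id x).mul (Real.hasDerivAt_cosh x)
  · intro x _; exact Real.hasDerivAt_sinh x
  · intro x _; exact Real.cosh_pos x
  · intro c x hc hcx
    have h1 : 0 < sinh (x - c) := Real.sinh_pos_iff.2 (by linarith)
    rw [Real.sinh_sub] at h1
    have h2 : 0 < sinh c := Real.sinh_pos_iff.2 hc
    have h3 := Real.cosh_pos x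
    have : c * (sinh c * cosh x) < x * (sinh x * cosh c) := by
      apply mul_lt_mul hcx (by linarith) (by positivity) (by linarith)
    nlinarith

open Real in
lemma gm_cross2 : ∀ c x : ℝ, 0 < c → c < x → c * sinh c * (cosh x - 1) < x * sinh x * (cosh c - 1) := by
  refine gm_cross (f := fun w => w * sinh w) (g := fun w => cosh w - 1)
    (f' := fun w => 1 * sinh w + w * cosh w) (g' := sinh)
    (by simp) (by simp) (by fun_prop) (by fun_prop) ?_ ?_ ?_ ?_
  · intro x _
    exact (hasDerivAt_id x).mul (Real.hasDerivAt_sinh x)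
  · intro x _; exact (Real.hasDerivAt_cosh x).sub_const 1
  · intro x hx; exact Real.sinh_pos_iff.2 hx
  · intro c x hc hcx
    have := gm_cross1 c x hc hcx
    nlinarith

open Real in
lemma gm_cross3 : ∀ c x : ℝ, 0 < c → c < x →
    (c * cosh c - sinh c) * (2 * (x * cosh x) - 2 * x) < (x * cosh x - sinh x) * (2 * (c * cosh c) - 2 * c) := by
  refine gm_cross (f := fun w => w * cosh w - sinh w) (g := fun w => 2 * (w * cosh w) - 2 * w)
    (f' := fun w => 1 * cosh w + w * sinh w - cosh w)
    (g' := fun w => 2 * (1 * cosh w + w * sinh w) - 2 * 1)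
    (by simp) (by simp) (by fun_prop) (by fun_prop) ?_ ?_ ?_ ?_
  · intro x _
    exact ((hasDerivAt_id x).mul (Real.hasDerivAt_cosh x)).sub (Real.hasDerivAt_sinh x)
  · intro x _
    exact (((hasDerivAt_id x).mul (Real.hasDerivAt_cosh x)).const_mul 2).sub ((hasDerivAt_id x).const_mul 2)
  · intro x hx
    have h1 := Real.one_le_cosh x
    have h2 := Real.sinh_pos_iff.2 hx
    have : 0 < x * sinh x := by positivity
    linarith
  · intro c x hc hcx
    have := gm_cross2 c x hc hcx
    nlinarith

open Real in
lemma gm_cross4 : ∀ c x : ℝ, 0 < c → c < x →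
    (c * sinh c - 2 * cosh c + 2) * (2 * (x * sinh x) - x ^ 2 - 2 * cosh x + 2) <
    (x * sinh x - 2 * cosh x + 2) * (2 * (c * sinh c) - c ^ 2 - 2 * cosh c + 2) := by
  refine gm_cross (f := fun w => w * sinh w - 2 * cosh w + 2)
    (g := fun w => 2 * (w * sinh w) - w ^ 2 - 2 * cosh w + 2)
    (f' := fun w => 1 * sinh w + w * cosh w - 2 * sinh w)
    (g' := fun w => 2 * (1 * sinh w + w * cosh w) - 2 * w - 2 * sinh w)
    (by simp) (by simp) (by fun_prop) (by fun_prop) ?_ ?_ ?_ ?_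
  · intro x _
    exact (((hasDerivAt_id x).mul (Real.hasDerivAt_sinh x)).sub ((Real.hasDerivAt_cosh x).const_mul 2)).add_const 2
  · intro x _
    have h := (((((hasDerivAt_id x).mul (Real.hasDerivAt_sinh x)).const_mul 2).sub (hasDerivAt_pow 2 x)).sub ((Real.hasDerivAt_cosh x).const_mul 2)).add_const 2
    refine h.congr_deriv ?_
    simp
  · intro x hx
    have h1 := Real.one_lt_cosh.2 hx.ne'
    have : 0 < x * (cosh x - 1) := mul_pos hx (by linarith)
    linarith
  · intro c x hc hcx
    have := gm_cross3 c x hc hcx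
    nlinarith

lemma gm_D1 (w : ℝ) (hw : 0 < w) : 0 < Real.exp w - 1 - w := by
  have := Real.add_one_lt_exp hw.ne'
  linarith

lemma gm_N1 (w : ℝ) (hw : 0 < w) : 0 < w * Real.exp w - Real.exp w + 1 := by
  have := Real.add_one_lt_exp (neg_ne_zero.2 hw.ne')
  have h2 : Real.exp (-w) * Real.exp w = 1 := by rw [← Real.exp_add]; simp
  nlinarith [Real.exp_pos w]

lemma gm_N1_ge (w : ℝ) (hw : 0 < w) :
    Real.exp w - 1 - w ≤ w * Real.exp w - Real.exp w + 1 := by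
  have := gm_pos_s6 (f := fun w => (w * Real.exp w - Real.exp w + 1) - (Real.exp w - 1 - w))
    (f' := fun w => (1 * Real.exp w + w * Real.exp w - Real.exp w) - (Real.exp w - 1)) (by simp)
    (by fun_prop) w hw ?_ ?_
  · linarith
  · intro x _ _
    exact (((((hasDerivAt_id x).mul (Real.hasDerivAt_exp x)).sub (Real.hasDerivAt_exp x)).add_const 1)).sub
      (((Real.hasDerivAt_exp x).sub_const 1).sub (hasDerivAt_id x))
  · intro x hx _
    have := gm_N1 x hx
    linarith

lemma gm_N1_le (w : ℝ) (hw : 0 < w) :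
    w * Real.exp w - Real.exp w + 1 ≤ Real.exp w * (Real.exp w - 1 - w) := by
  have h := Real.self_le_sinh_iff.2 hw.le
  rw [Real.sinh_eq] at h
  have h2 : Real.exp (-w) * Real.exp w = 1 := by rw [← Real.exp_add]; simp
  nlinarith [Real.exp_pos w]

noncomputable def gmLam (w : ℝ) : ℝ :=
  Real.log (w * Real.exp w - Real.exp w + 1) - Real.log (Real.exp w - 1 - w)

lemma gmLam_hasDeriv (w : ℝ) (hw : 0 < w) : HasDerivAt gmLam
    ((1 * Real.exp w + w * Real.exp w - Real.exp w) / (w * Real.exp w - Real.exp w + 1)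
      - (Real.exp w - 1) / (Real.exp w - 1 - w)) w := by
  have h1 : HasDerivAt (fun w => w * Real.exp w - Real.exp w + 1) (1 * Real.exp w + w * Real.exp w - Real.exp w) w :=
    ((((hasDerivAt_id w).mul (Real.hasDerivAt_exp w)).sub (Real.hasDerivAt_exp w)).add_const 1)
  have h2 : HasDerivAt (fun w => Real.exp w - 1 - w) (Real.exp w - 1) w :=
      (((Real.hasDerivAt_exp w).sub_const 1).sub (hasDerivAt_id w))
  exact (h1.log (gm_N1 w hw).ne').sub (h2.log (gm_D1 w hw).ne')

lemma gmLam_bd (w : ℝ) (hw : 0 < w) : 0 ≤ gmLam w ∧ gmLam w ≤ w := by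
  have h1 := gm_N1 w hw
  have h2 := gm_D1 w hw
  unfold gmLam
  constructor
  · have := Real.log_le_log h2 (gm_N1_ge w hw)
    linarith
  · have := Real.log_le_log h1 (gm_N1_le w hw)
    rw [Real.log_mul (Real.exp_pos w).ne' h2.ne', Real.log_exp] at this
    linarith

lemma gmLam_deriv_eq (w : ℝ) (hw : 0 < w) :
    (1 * Real.exp w + w * Real.exp w - Real.exp w) / (w * Real.exp w - Real.exp w + 1)
      - (Real.exp w - 1) / (Real.exp w - 1 - w) =
    1 - 2 * ((w * Real.sinh w - 2 * Real.cosh w + 2) /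
      (2 * (w * Real.sinh w) - w ^ 2 - 2 * Real.cosh w + 2)) ∧
    0 < 2 * (w * Real.sinh w) - w ^ 2 - 2 * Real.cosh w + 2 := by
  have h1 := gm_N1 w hw
  have h2 := gm_D1 w hw
  have hE := Real.exp_pos w
  rw [Real.sinh_eq, Real.cosh_eq, Real.exp_neg]
  have hD : 2 * (w * ((Real.exp w - (Real.exp w)⁻¹) / 2)) - w ^ 2 - 2 * ((Real.exp w + (Real.exp w)⁻¹) / 2) + 2
    = (w * Real.exp w - Real.exp w + 1) * (Real.exp w - 1 - w) / Real.exp w := by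
    field_simp
    ring
  rw [hD]
  refine ⟨?_, by positivity⟩
  have h1' := h1.ne'
  have h2' := h2.ne'
  generalize Real.exp w = E at *
  rw [div_sub_div _ _ h1' h2', eq_comm, ← sub_eq_zero]
  have : 2 * ((w * ((E - E⁻¹) / 2) - 2 * ((E + E⁻¹) / 2) + 2) /
        ((w * E - E + 1) * (E - 1 - w) / E)) = (w * (E^2 - 1) - 2 * (E^2+1) + 4 * E) / ((w * E - E + 1) * (E - 1 - w)) := by
    rw [div_div_eq_mul_div, mul_div_assoc']
    congr 1
    field_simp
    ring
  rw [this, one_sub_div (by positivity), ← sub_div, div_eq_zero_iff]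
  left
  ring

lemma gmLam_cross : ∀ c x : ℝ, 0 < c → c < x → - gmLam c * x < - gmLam x * c := by
  have h0 : gmLam 0 = 0 := by simp [gmLam]
  refine gm_cross (f := fun w => - gmLam w) (g := fun w => w) (g' := fun _ => 1)
    (f' := fun w => -((1 * Real.exp w + w * Real.exp w - Real.exp w) / (w * Real.exp w - Real.exp w + 1)
      - (Real.exp w - 1) / (Real.exp w - 1 - w))) (by simp [h0]) rfl ?_ (by fun_prop) ?_ ?_ ?_ ?_
  · apply ContinuousOn.neg
    intro x hx
    rcases eq_or_lt_of_le (show (0:ℝ) ≤ x from hx) with rfl | hx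
    · show Tendsto _ _ _
      rw [h0]
      refine tendsto_of_tendsto_of_tendsto_of_le_of_le' (g := fun _ => 0) (h := fun w => w) tendsto_const_nhds
        (tendsto_id.mono_left inf_le_left) ?_ ?_
      all_goals
        filter_upwards [self_mem_nhdsWithin] with w hw
        rcases eq_or_lt_of_le (show (0:ℝ) ≤ w from hw) with rfl | hw
        · simp [h0]
      · exact (gmLam_bd w hw).1
      · exact (gmLam_bd w hw).2
    · exact (gmLam_hasDeriv x hx).continuousAt.continuousWithinAt
  · intro x hx; exact (gmLam_hasDeriv x hx).neg
  · intro x _; exact hasDerivAt_id x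
  · intro x _; exact one_pos
  · intro c x hc hcx
    obtain ⟨e1, p1⟩ := gmLam_deriv_eq c hc
    obtain ⟨e2, p2⟩ := gmLam_deriv_eq x (hc.trans hcx)
    have := (div_lt_div_iff₀ p1 p2).2 (gm_cross4 c x hc hcx)
    rw [e1, e2]
    linarith

noncomputable def gmU (w : ℝ) : ℝ := w / (Real.exp w - 1)

noncomputable def gmW (μ x s : ℝ) : ℝ := Real.exp (-μ * s) * s ^ (x - 1)

noncomputable def gmSgn (s : ℝ) : ℝ := if s ≤ 1 then -1 else 1

lemma gm_E1 (w : ℝ) (hw : 0 < w) : 0 < Real.exp w - 1 := by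
  have := gm_D1 w hw
  linarith

lemma gmU_pos (w : ℝ) (hw : 0 < w) : 0 < gmU w := div_pos hw (gm_E1 w hw)

lemma gmU_eq (w : ℝ) (hw : 0 < w) : gmU w + w = Real.exp w * gmU w := by
  have := (gm_E1 w hw).ne'
  unfold gmU
  field_simp
  ring

lemma gmU_deriv (w : ℝ) (hw : 0 < w) :
    HasDerivAt gmU (-(w * Real.exp w - Real.exp w + 1) / (Real.exp w - 1) ^ 2) w := by
  have h := (hasDerivAt_id w).div ((Real.hasDerivAt_exp w).sub_const 1) (gm_E1 w hw).ne'
  refine h.congr_deriv ?_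
  simp only [id]
  congr 1
  ring

lemma gmY_deriv (w : ℝ) (hw : 0 < w) :
    HasDerivAt (fun w => gmU w + w) (Real.exp w * (Real.exp w - 1 - w) / (Real.exp w - 1) ^ 2) w := by
  have h := (gmU_deriv w hw).add (hasDerivAt_id w)
  refine h.congr_deriv ?_
  have := (gm_E1 w hw).ne'
  field_simp
  ring

lemma gmY_gt (w : ℝ) (hw : 0 < w) : 1 < gmU w + w := by
  have h1 := gm_E1 w hw
  have h2 := gm_N1 w hw
  rw [gmU_eq w hw, gmU, mul_div_assoc', lt_div_iff₀ h1]
  linarith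

lemma gmY_mono : StrictMonoOn (fun w => gmU w + w) (Ioi 0) := by
  apply strictMonoOn_of_deriv_pos (convex_Ioi 0)
  · intro x hx
    exact (gmY_deriv x hx).continuousAt.continuousWithinAt
  · intro x hx
    rw [interior_Ioi] at hx
    rw [(gmY_deriv x hx).deriv]
    have := gm_D1 x hx
    have := gm_E1 x hx
    positivity

lemma gmU_zero : Tendsto gmU (nhdsWithin 0 (Ioi 0)) (nhds 1) := by
  have h := (Real.hasDerivAt_exp 0).tendsto_slope
  have h2 := (h.mono_left (nhdsWithin_mono 0 (fun x (hx : x ∈ Ioi (0:ℝ)) => (ne_of_gt hx : x ≠ 0)))).inv₀ (by simp)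
  simp only [Real.exp_zero, inv_one] at h2
  refine h2.congr ?_
  intro x
  simp [slope_def_field, gmU]

lemma gmU_top : Tendsto gmU atTop (nhds 0) := by
  refine tendsto_of_tendsto_of_tendsto_of_le_of_le' (g := fun _ => 0) (h := fun w => (1 + w / 2)⁻¹) tendsto_const_nhds ?_ ?_ ?_
  · apply Tendsto.inv_tendsto_atTop
    apply tendsto_atTop_add_const_left
    exact tendsto_id.atTop_div_const (by norm_num)
  · filter_upwards [eventually_gt_atTop 0] with w hw using (gmU_pos w hw).le
  · filter_upwards [eventually_gt_atTop 0] with w hw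
    have h := Real.quadratic_le_exp_of_nonneg hw.le
    have h1 := gm_E1 w hw
    rw [gmU, div_le_iff₀ h1, inv_mul_eq_div, le_div_iff₀ (by positivity)]
    nlinarith

lemma gmW_pos (μ x s : ℝ) (hs : 0 < s) : 0 < gmW μ x s := by
  unfold gmW; positivity

lemma gmW_cont (μ x : ℝ) : ContinuousOn (gmW μ x) (Ioi 0) := by
  unfold gmW
  apply ContinuousOn.mul (by fun_prop)
  intro s hs
  exact (Real.continuousAt_rpow_const s (x-1) (Or.inl (ne_of_gt hs))).continuousWithinAt

/-- transported density difference -/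
noncomputable def gmT (μ x w : ℝ) : ℝ :=
  gmW μ x (gmU w + w) * (Real.exp w * (Real.exp w - 1 - w) / (Real.exp w - 1) ^ 2)
   + gmW μ x (gmU w) * (-(w * Real.exp w - Real.exp w + 1) / (Real.exp w - 1) ^ 2)

lemma gmT_eq (μ x w : ℝ) (hw : 0 < w) : gmT μ x w =
    gmW μ x (gmU w) / (Real.exp w - 1) ^ 2 *
      (Real.exp ((x - μ) * w) * (Real.exp w - 1 - w) - (w * Real.exp w - Real.exp w + 1)) := by
  have h : gmW μ x (gmU w + w) * Real.exp w = gmW μ x (gmU w) * Real.exp ((x - μ) * w) := by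
    unfold gmW
    have hu := gmU_pos w hw
    have e1 : (gmU w + w) ^ (x - 1) = Real.exp (w * (x - 1)) * gmU w ^ (x - 1) := by
      rw [gmU_eq w hw, Real.mul_rpow (Real.exp_pos w).le hu.le, ← Real.exp_mul]
    rw [e1]
    have e2 : Real.exp (-μ * (gmU w + w)) = Real.exp (-μ * gmU w) * Real.exp (-μ * w) := by
      rw [← Real.exp_add]; ring_nf
    have e3 : Real.exp ((x - μ) * w) = Real.exp (-μ * w) * Real.exp (w * (x - 1)) * Real.exp w := by
      rw [← Real.exp_add, ← Real.exp_add]; ring_nf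
    rw [e2, e3]; ring
  unfold gmT
  linear_combination ((Real.exp w - 1 - w) / (Real.exp w - 1) ^ 2) * h

lemma gmT_pos_iff (μ x w : ℝ) (hw : 0 < w) :
    (0 < (x - μ) * w - gmLam w → 0 < gmT μ x w) ∧ ((x - μ) * w - gmLam w < 0 → gmT μ x w < 0) := by
  have h1 := gm_N1 w hw
  have h2 := gm_D1 w hw
  have h3 := gm_E1 w hw
  have h4 := gmW_pos μ x _ (gmU_pos w hw)
  have h5 : 0 < gmW μ x (gmU w) / (Real.exp w - 1) ^ 2 := by positivity
  have e : Real.log (Real.exp ((x - μ) * w) * (Real.exp w - 1 - w)) = (x - μ) * w + Real.log (Real.exp w - 1 - w) := by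
    rw [Real.log_mul (Real.exp_pos _).ne' h2.ne', Real.log_exp]
  have h6 : 0 < Real.exp ((x - μ) * w) * (Real.exp w - 1 - w) := by positivity
  rw [gmT_eq μ x w hw]
  unfold gmLam
  constructor
  · intro h
    apply mul_pos h5
    rw [sub_pos, ← Real.log_lt_log_iff h1 h6, e]
    linarith
  · intro h
    apply mul_neg_of_pos_of_neg h5
    rw [sub_neg, ← Real.log_lt_log_iff h6 h1, e]
    linarith

lemma gm_main_int (μ x : ℝ) (h : ℝ → ℝ) (hc : ContinuousOn h (Ioi 0))
    (hi : IntegrableOn (fun s => h s * gmW μ x s) (Ioi 0)) (w1 : ℝ) (hw1 : 0 ≤ w1)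
    (heq : ∀ w, 0 < w → h (gmU w + w) = h (gmU w))
    (h0 : ∀ w, 0 < w → 0 ≤ h (gmU w) * gmT μ x w)
    (h1 : ∀ w, w1 < w → 0 < h (gmU w) * gmT μ x w) :
    0 < ∫ s in Ioi (0:ℝ), gmSgn s * (h s * gmW μ x s) := by
  set F : ℝ → ℝ := fun s => h s * gmW μ x s with hF
  have hFc : ContinuousOn F (Ioi 0) := hc.mul (gmW_cont μ x)
  set K : ℝ → ℝ := fun z => ∫ s in (1:ℝ)..z, F s with hK
  have hii : ∀ a b, 0 ≤ a → 0 ≤ b → IntervalIntegrable F volume a b := by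
    intro a b ha hb
    rw [intervalIntegrable_iff]
    refine hi.mono_set ?_
    intro s hs
    exact lt_of_le_of_lt (le_min ha hb) hs.1
  have hKd : ∀ z, 0 < z → HasDerivAt K (F z) z := by
    intro z hz
    apply intervalIntegral.integral_hasDerivAt_right (hii 1 z zero_le_one hz.le)
    · exact hFc.stronglyMeasurableAtFilter isOpen_Ioi z hz
    · exact hFc.continuousAt (Ioi_mem_nhds hz)
  have hK1 : K 1 = 0 := by simp [hK]
  set H : ℝ → ℝ := fun w => K (gmU w + w) + K (gmU w) with hH
  have hHd : ∀ w, 0 < w → HasDerivAt H (h (gmU w) * gmT μ x w) w := by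
    intro w hw
    have hu := gmU_pos w hw
    have a1 := HasDerivAt.comp (h := fun w => gmU w + w) w (hKd (gmU w + w) (by linarith)) (gmY_deriv w hw)
    have a2 := (hKd (gmU w) hu).comp w (gmU_deriv w hw)
    refine (a1.add a2).congr_deriv ?_
    simp only [hF, gmT]
    rw [heq w hw]
    ring
  have hmono : MonotoneOn H (Ioi 0) := by
    apply monotoneOn_of_deriv_nonneg (convex_Ioi 0)
    · intro w hw
      exact (hHd w hw).continuousAt.continuousWithinAt
    · intro w hw
      rw [interior_Ioi] at hw
      exact (hHd w hw).differentiableAt.differentiableWithinAt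
    · intro w hw
      rw [interior_Ioi] at hw
      rw [(hHd w hw).deriv]; exact h0 w hw
  have hsm : StrictMonoOn H (Ioi w1) := by
    apply strictMonoOn_of_deriv_pos (convex_Ioi w1)
    · intro w hw
      exact (hHd w (lt_of_le_of_lt hw1 hw)).continuousAt.continuousWithinAt
    · intro w hw
      rw [interior_Ioi] at hw
      rw [(hHd w (lt_of_le_of_lt hw1 hw)).deriv]; exact h1 w hw
  have hl0 : Tendsto H (nhdsWithin 0 (Ioi 0)) (nhds 0) := by
    have c1 : Tendsto K (nhds 1) (nhds 0) := by
      have := (hKd 1 one_pos).continuousAt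
      rw [ContinuousAt, hK1] at this
      exact this
    have t2 := c1.comp gmU_zero
    have t1 : Tendsto (fun w => gmU w + w) (nhdsWithin 0 (Ioi 0)) (nhds 1) := by
      have : Tendsto (fun w : ℝ => w) (nhdsWithin 0 (Ioi 0)) (nhds 0) := tendsto_id.mono_left inf_le_left
      simpa using gmU_zero.add this
    have := (c1.comp t1).add t2
    simpa using this
  have hl1 : Tendsto H atTop (nhds ((∫ s in Ioi (1:ℝ), F s) + K 0)) := by
    apply Tendsto.add
    · apply intervalIntegral_tendsto_integral_Ioi
      · exact hi.mono_set (Ioi_subset_Ioi zero_le_one)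
      · refine tendsto_atTop_mono' atTop ?_ tendsto_id
        filter_upwards [eventually_gt_atTop 0] with w hw
        have := gmU_pos w hw
        simp only [id]; linarith
    · have c : ContinuousOn K (uIcc 0 1) := by
        apply intervalIntegral.continuousOn_primitive_interval' (hii 0 1 le_rfl zero_le_one)
        simp
      have c0 := c 0 (by simp)
      have : Tendsto gmU atTop (nhdsWithin 0 (uIcc 0 1)) := by
        rw [tendsto_nhdsWithin_iff]
        refine ⟨gmU_top, ?_⟩
        filter_upwards [gmU_top.eventually (Iio_mem_nhds one_pos), eventually_gt_atTop 0] with w hw hw0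
        rw [uIcc_of_le zero_le_one]
        exact ⟨(gmU_pos w hw0).le, le_of_lt hw⟩
      exact Tendsto.comp c0 this
  have e : ∫ s in Ioi (0:ℝ), gmSgn s * F s = (∫ s in Ioi (1:ℝ), F s) + K 0 := by
    rw [← Ioc_union_Ioi_eq_Ioi (zero_le_one (α := ℝ))]
    have i1 : ∀ s ∈ Ioc (0:ℝ) 1, gmSgn s * F s = - F s := by
      intro s hs; simp [gmSgn, hs.2]
    have i2 : ∀ s ∈ Ioi (1:ℝ), gmSgn s * F s = F s := by
      intro s hs; simp [gmSgn, not_le.2 (show (1:ℝ) < s from hs)]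
    have j1 : IntegrableOn F (Ioc 0 1) := hi.mono_set Ioc_subset_Ioi_self
    have j2 : IntegrableOn F (Ioi 1) := hi.mono_set (Ioi_subset_Ioi zero_le_one)
    rw [setIntegral_union (Ioc_disjoint_Ioi le_rfl) measurableSet_Ioi
      (j1.neg.congr_fun (fun s hs => (i1 s hs).symm) measurableSet_Ioc)
      (j2.congr_fun (fun s hs => (i2 s hs).symm) measurableSet_Ioi),
      setIntegral_congr_fun measurableSet_Ioc i1, setIntegral_congr_fun measurableSet_Ioi i2]
    simp only [hK]
    rw [intervalIntegral.integral_symm, intervalIntegral.integral_of_le zero_le_one, integral_neg]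
    ring
  rw [e]
  have A1 : 0 ≤ H (w1 + 1) := by
    refine le_of_tendsto hl0 ?_
    filter_upwards [self_mem_nhdsWithin, nhdsWithin_le_nhds (Iio_mem_nhds (show (0:ℝ) < w1 + 1 by linarith))] with w hw hw2
    exact hmono hw (show (0:ℝ) < w1 + 1 by linarith) (le_of_lt hw2)
  have A2 : H (w1 + 1) < H (w1 + 2) := hsm (show w1 < w1 + 1 by linarith) (show w1 < w1 + 2 by linarith) (by linarith)
  have A3 : H (w1 + 2) ≤ (∫ s in Ioi (1:ℝ), F s) + K 0 := by
    refine ge_of_tendsto hl1 ?_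
    filter_upwards [eventually_ge_atTop (w1 + 2)] with w hw
    exact hmono (show (0:ℝ) < w1 + 2 by linarith) (show (0:ℝ) < w by linarith) hw
  linarith

lemma gm_d_mono : StrictMonoOn (fun s : ℝ => s - 1 - Real.log s) (Ici 1) := by
  have hd : ∀ s : ℝ, 0 < s → HasDerivAt (fun s : ℝ => s - 1 - Real.log s) (1 - s⁻¹) s := fun s hs =>
    ((hasDerivAt_id s).sub_const 1).sub (Real.hasDerivAt_log hs.ne')
  apply strictMonoOn_of_deriv_pos (convex_Ici 1)
  · intro s hs
    exact (hd s (lt_of_lt_of_le one_pos hs)).continuousAt.continuousWithinAt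
  · intro s hs
    rw [interior_Ici] at hs
    rw [(hd s (one_pos.trans hs)).deriv, sub_pos]
    exact inv_lt_one_of_one_lt₀ hs

lemma gm_core (μ x : ℝ) (hi : IntegrableOn (gmW μ x) (Ioi 0))
    (hid : IntegrableOn (fun s => (s - 1 - Real.log s) * gmW μ x s) (Ioi 0))
    (hz : ∫ s in Ioi (0:ℝ), gmSgn s * gmW μ x s = 0) :
    0 < ∫ s in Ioi (0:ℝ), gmSgn s * ((s - 1 - Real.log s) * gmW μ x s) := by
  set ρ : ℝ → ℝ := fun w => (x - μ) * w - gmLam w with hρ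
  have hcr : ∀ c w, 0 < c → c < w → ρ c * w < ρ w * c := by
    intro c w hc hcw
    have := gmLam_cross c w hc hcw
    simp only [hρ]; nlinarith
  have hρc : ContinuousOn ρ (Ioi 0) := by
    apply ContinuousOn.sub (by fun_prop)
    intro w hw
    exact (gmLam_hasDeriv w hw).continuousAt.continuousWithinAt
  by_cases hex : ∃ w1, 0 < w1 ∧ ρ w1 = 0
  · obtain ⟨w1, hw1, hr⟩ := hex
    have hneg : ∀ w, 0 < w → w < w1 → ρ w < 0 := by
      intro w hw hww
      have := hcr w w1 hw hww
      rw [hr, zero_mul] at this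
      by_contra hcon
      push Not at hcon
      nlinarith
    have hpos : ∀ w, w1 < w → 0 < ρ w := by
      intro w hww
      have := hcr w1 w hw1 hww
      rw [hr, zero_mul] at this
      by_contra hcon
      push Not at hcon
      nlinarith
    set d : ℝ → ℝ := fun s => s - 1 - Real.log s with hd
    have hdeq : ∀ w, 0 < w → d (gmU w + w) = d (gmU w) := by
      intro w hw
      have hu := gmU_pos w hw
      have : Real.log (gmU w + w) = w + Real.log (gmU w) := by
        rw [gmU_eq w hw, Real.log_mul (Real.exp_pos _).ne' hu.ne', Real.log_exp]
      simp only [hd, this]; ring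
    have hdm : ∀ a b, 0 < a → a < b → d (gmU a) < d (gmU b) := by
      intro a b ha hab
      rw [← hdeq a ha, ← hdeq b (ha.trans hab)]
      exact gm_d_mono (gmY_gt a ha).le (gmY_gt b (ha.trans hab)).le (gmY_mono ha (ha.trans hab) hab)
    have hstr : ∀ w, w1 < w → 0 < (d (gmU w) - d (gmU w1)) * gmT μ x w := by
      intro w hw
      exact mul_pos (sub_pos.2 (hdm _ _ hw1 hw)) ((gmT_pos_iff μ x w (hw1.trans hw)).1 (hpos w hw))
    have key := gm_main_int μ x (fun s => d s - d (gmU w1)) ?_ ?_ w1 hw1.le ?_ ?_ hstr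
    · have e : (∫ s in Ioi (0:ℝ), gmSgn s * ((d s - d (gmU w1)) * gmW μ x s)) =
        (∫ s in Ioi (0:ℝ), gmSgn s * (d s * gmW μ x s)) - d (gmU w1) * ∫ s in Ioi (0:ℝ), gmSgn s * gmW μ x s := by
        have hsm : Measurable gmSgn := Measurable.ite measurableSet_Iic measurable_const measurable_const
        have hb : ∀ s, ‖gmSgn s‖ ≤ 1 := by
          intro s; unfold gmSgn; split_ifs <;> simp
        rw [← integral_const_mul, ← integral_sub]
        · congr 1; ext s; ring
        · exact hid.bdd_mul (c := 1) hsm.aestronglyMeasurable (Eventually.of_forall hb)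
        · exact (hi.bdd_mul (c := 1) hsm.aestronglyMeasurable (Eventually.of_forall hb)).const_mul _
      rw [e, hz] at key
      linarith
    · apply ContinuousOn.sub _ continuousOn_const
      exact (by fun_prop : ContinuousOn (fun s : ℝ => s - 1) (Ioi 0)).sub
        (Real.continuousOn_log.mono (fun s hs => ne_of_gt hs))
    · have := hid.sub (hi.const_mul (d (gmU w1)))
      refine this.congr_fun ?_ measurableSet_Ioi
      intro s _
      simp only [hd, Pi.sub_apply]; ring
    · intro w hw; simp only [hdeq w hw]
    · intro w hw
      rcases lt_trichotomy w w1 with hlt | rfl | hgt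
      · exact (mul_pos_of_neg_of_neg (sub_neg.2 (hdm _ _ hw hlt)) ((gmT_pos_iff μ x w hw).2 (hneg w hw hlt))).le
      · simp
      · exact (hstr w hgt).le
  · exfalso
    push Not at hex
    have hsg : (∀ w, 0 < w → 0 < ρ w) ∨ (∀ w, 0 < w → ρ w < 0) := by
      by_contra hcon
      push Not at hcon
      obtain ⟨⟨a, ha, ha'⟩, ⟨b, hb, hb'⟩⟩ := hcon
      obtain ⟨c, hc, hc'⟩ := isPreconnected_Ioi.intermediate_value (show a ∈ Ioi (0:ℝ) from ha) (show b ∈ Ioi (0:ℝ) from hb) hρc ⟨ha', hb'⟩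
      exact hex c hc hc'
    rcases hsg with hs | hs
    · have key := gm_main_int μ x (fun _ => 1) continuousOn_const (by simpa using hi) 0 le_rfl (by simp)
        (fun w hw => by simpa using ((gmT_pos_iff μ x w hw).1 (hs w hw)).le)
        (fun w hw => by simpa using ((gmT_pos_iff μ x w hw).1 (hs w hw)))
      simp [hz] at key
    · have key := gm_main_int μ x (fun _ => -1) continuousOn_const (by simpa using hi.neg) 0 le_rfl (by simp)
        (fun w hw => by simpa using ((gmT_pos_iff μ x w hw).2 (hs w hw)).le)
        (fun w hw => by simpa using ((gmT_pos_iff μ x w hw).2 (hs w hw)))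
      simp [hz, integral_neg] at key

lemma gmW_int (μ p : ℝ) (hμ : 0 < μ) (hp : 0 < p) : IntegrableOn (gmW μ p) (Ioi 0) := by
  have := integrableOn_rpow_mul_exp_neg_mul_rpow (p := 1) (s := p - 1) (b := μ) (by linarith) one_pos hμ
  refine this.congr_fun ?_ measurableSet_Ioi
  intro s _
  simp [gmW, mul_comm]

lemma gmW_mul (μ p a s : ℝ) (hs : 0 < s) : s ^ a * gmW μ p s = gmW μ (p + a) s := by
  unfold gmW
  rw [show p + a - 1 = a + (p - 1) by ring, Real.rpow_add hs]
  ring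

lemma gmW_mul_self (μ p s : ℝ) (hs : 0 < s) : s * gmW μ p s = gmW μ (p + 1) s := by
  rw [← gmW_mul μ p 1 s hs, Real.rpow_one]

lemma gmW_exp (μ p s : ℝ) (hs : 0 < s) : gmW μ p s = Real.exp (-μ * s + (p - 1) * Real.log s) := by
  unfold gmW
  rw [Real.exp_add, Real.rpow_def_of_pos hs, mul_comm (Real.log s)]

lemma gm_log_bd (ε s : ℝ) (hε : 0 < ε) (hs : 0 < s) : |Real.log s| ≤ s + ε⁻¹ * s ^ (-ε) := by
  have h3 : 0 < s ^ ε := by positivity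
  rcases le_total s 1 with h | h
  · have h2 := (Real.abs_log_mul_self_rpow_lt s ε hs h hε).le
    rw [abs_mul, abs_of_pos h3, one_div] at h2
    rw [Real.rpow_neg hs.le, ← div_eq_mul_inv]
    have := (le_div_iff₀ h3).2 h2
    linarith
  · rw [abs_of_nonneg (Real.log_nonneg h)]
    have := Real.log_le_self hs.le
    have : 0 < ε⁻¹ * s ^ (-ε) := by positivity
    linarith

lemma gm_meas (μ p : ℝ) : Measurable (gmW μ p) := by
  unfold gmW
  fun_prop

lemma gmSgn_meas : Measurable gmSgn := Measurable.ite measurableSet_Iic measurable_const measurable_const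

lemma gmSgn_bd (s : ℝ) : ‖gmSgn s‖ ≤ 1 := by
  unfold gmSgn; split_ifs <;> simp

/-- `(C s + |log s|) * gmW` is integrable -/
lemma gm_bound_int (C μ p : ℝ) (hC : 0 ≤ C) (hμ : 0 < μ) (hp : 0 < p) :
    IntegrableOn (fun s => (C * s + |Real.log s|) * gmW μ p s) (Ioi 0) := by
  have i1 := (gmW_int μ (p + 1) hμ (by linarith)).const_mul (C + 1)
  have i2 := (gmW_int μ (p + -(p/2)) hμ (by linarith)).const_mul (p/2)⁻¹
  refine Integrable.mono' (i1.add i2) ?_ ?_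
  · have := gm_meas μ p
    apply Measurable.aestronglyMeasurable
    apply Measurable.mul _ this
    have := Real.measurable_log
    exact (measurable_id.const_mul C).add (by simpa using this.norm)
  · filter_upwards [ae_restrict_mem measurableSet_Ioi] with s hs
    have hs : 0 < s := hs
    have hW := gmW_pos μ p s hs
    have hb := gm_log_bd (p/2) s (by linarith) hs
    rw [Real.norm_of_nonneg (by positivity)]
    simp only [Pi.add_apply]
    rw [← gmW_mul_self μ p s hs, ← gmW_mul μ p _ s hs]
    have := mul_le_mul_of_nonneg_right hb hW.le
    nlinarith

lemma gm_exp_lip (A B M : ℝ) (hA : Real.exp A ≤ M) (hB : Real.exp B ≤ M) :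
    |Real.exp A - Real.exp B| ≤ |A - B| * M := by
  have key : ∀ A B, Real.exp A ≤ M → Real.exp A - Real.exp B ≤ |A - B| * M := by
    intro A B hA
    have h1 := Real.add_one_le_exp (B - A)
    have h2 : Real.exp B = Real.exp A * Real.exp (B - A) := by rw [← Real.exp_add]; ring_nf
    have h3 := Real.exp_pos A
    have h4 : (A - B) * Real.exp A ≤ |A - B| * M :=
      mul_le_mul (le_abs_self _) hA h3.le (abs_nonneg _)
    nlinarith
  rw [abs_le]
  have h1 := key A B hA
  have h2 := key B A hB
  rw [abs_sub_comm] at h2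
  constructor <;> linarith

lemma gmW_le (μ μ' p a b s : ℝ) (hs : 0 < s) (hμ : μ' ≤ μ) (ha : a ≤ p) (hb : p ≤ b) :
    gmW μ p s ≤ gmW μ' a s + gmW μ' b s := by
  unfold gmW
  have h1 : Real.exp (-μ * s) ≤ Real.exp (-μ' * s) := Real.exp_le_exp.2 (by nlinarith)
  have h2 : s ^ (p - 1) ≤ s ^ (a - 1) + s ^ (b - 1) := by
    have e1 : 0 < s ^ (a - 1) := by positivity
    have e2 : 0 < s ^ (b - 1) := by positivity
    rcases le_total s 1 with h | h
    · have := Real.rpow_le_rpow_of_exponent_ge hs h (show a - 1 ≤ p - 1 by linarith)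
      linarith
    · have := Real.rpow_le_rpow_of_exponent_le h (show p - 1 ≤ b - 1 by linarith)
      linarith
  rw [← mul_add]
  exact mul_le_mul h1 h2 (by positivity) (by positivity)

lemma gm_deriv_int (m : ℝ → ℝ) (x m1 : ℝ) (hx : 0 < x) (hm0 : 0 < m x) (hd : HasDerivAt m m1 x) :
    HasDerivAt (fun y => ∫ s in Ioi (0:ℝ), gmSgn s * gmW (m y) y s)
      (∫ s in Ioi (0:ℝ), gmSgn s * ((-m1 * s + Real.log s) * gmW (m x) x s)) x := by
  obtain ⟨C, hC, hCb⟩ : ∃ C, 0 ≤ C ∧ ∀ᶠ y in nhds x, |m y - m x| ≤ C * |y - x| := by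
    obtain ⟨C, hC, h⟩ := hd.isBigO_sub.exists_nonneg
    exact ⟨C, hC, by simpa using h.bound⟩
  have hs1 : ∀ᶠ y in nhds x, m x / 2 < m y := hd.continuousAt.eventually (Ioi_mem_nhds (by linarith))
  have hs2 : ∀ᶠ y in nhds x, y ∈ Ioo (x/2) (3*x/2) := Ioo_mem_nhds (by linarith) (by linarith)
  let S : Set ℝ := {y | |m y - m x| ≤ C * |y - x| ∧ m x / 2 < m y ∧ y ∈ Ioo (x/2) (3*x/2)}
  have hS : S ∈ nhds x := hCb.and (hs1.and hs2)
  let F' : ℝ → ℝ →L[ℝ] ℝ := fun s => (gmSgn s * ((-m1 * s + Real.log s) * gmW (m x) x s)) • ContinuousLinearMap.id ℝ ℝ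
  have hmeasF' : Measurable (fun s => gmSgn s * ((-m1 * s + Real.log s) * gmW (m x) x s)) :=
    gmSgn_meas.mul (((measurable_id.const_mul _).add Real.measurable_log).mul (gm_meas _ _))
  have key := hasFDerivAt_integral_of_dominated_loc_of_lip' (𝕜 := ℝ) (μ := volume.restrict (Ioi (0:ℝ)))
    (F := fun y s => gmSgn s * gmW (m y) y s) (x₀ := x) (s := S) (F' := F')
    (bound := fun s => (C * s + |Real.log s|) * gmW (m x / 2) (x / 2) s + (C * s + |Real.log s|) * gmW (m x / 2) (3*x / 2) s)
    hS ?_ ?_ ?_ ?_ ?_ ?_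
  · obtain ⟨k1, k2⟩ := key
    have := k2.hasDerivAt
    refine this.congr_deriv ?_
    rw [ContinuousLinearMap.integral_apply k1]
    simp [F']
  · intro y _
    exact (gmSgn_meas.mul (gm_meas _ _)).aestronglyMeasurable
  · exact (gmW_int (m x) x hm0 hx).bdd_mul (c := 1) gmSgn_meas.aestronglyMeasurable (Eventually.of_forall gmSgn_bd)
  · exact (hmeasF'.smul_const _).aestronglyMeasurable
  · filter_upwards [ae_restrict_mem measurableSet_Ioi] with s hs y hy
    have hs : 0 < s := hs
    obtain ⟨y1, y2, y3, y4⟩ := hy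
    rw [← mul_sub, norm_mul]
    have l1 := gmW_le (m y) (m x / 2) y (x/2) (3*x/2) s hs y2.le y3.le y4.le
    have l2 := gmW_le (m x) (m x / 2) x (x/2) (3*x/2) s hs (by linarith) (by linarith) (by linarith)
    have l0 : 0 < gmW (m x / 2) (x/2) s + gmW (m x / 2) (3*x/2) s :=
      add_pos (gmW_pos _ _ _ hs) (gmW_pos _ _ _ hs)
    rw [← mul_add]
    generalize gmW (m x / 2) (x/2) s + gmW (m x / 2) (3*x/2) s = M at l1 l2 l0 ⊢
    rw [gmW_exp _ _ _ hs] at l1 l2 ⊢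
    rw [gmW_exp _ _ _ hs]
    have l3 := gm_exp_lip _ _ M l1 l2
    have l4 : |(-m y * s + (y - 1) * Real.log s) - (-m x * s + (x - 1) * Real.log s)| ≤
        (C * s + |Real.log s|) * |y - x| := by
      have e : (-m y * s + (y - 1) * Real.log s) - (-m x * s + (x - 1) * Real.log s) =
        -(m y - m x) * s + (y - x) * Real.log s := by ring
      rw [e]
      refine (abs_add_le _ _).trans ?_
      rw [abs_mul, abs_mul, abs_neg, abs_of_pos hs]
      have := mul_le_mul_of_nonneg_right y1 hs.le
      linarith
    have l5 := mul_le_mul_of_nonneg_right l4 l0.le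
    have l6 := mul_le_mul (gmSgn_bd s) (l3.trans l5) (abs_nonneg _) zero_le_one
    rw [Real.norm_eq_abs (_ - _), Real.norm_eq_abs (y - x)]
    refine l6.trans (le_of_eq ?_)
    ring
  · exact (gm_bound_int C _ _ hC (by linarith) (by linarith)).add (gm_bound_int C _ _ hC (by linarith) (by linarith))
  · filter_upwards [ae_restrict_mem measurableSet_Ioi] with s hs
    have hs : 0 < s := hs
    have h1 : HasDerivAt (fun y => Real.exp (-m y * s + (y - 1) * Real.log s))
        (Real.exp (-m x * s + (x - 1) * Real.log s) * (-m1 * s + 1 * Real.log s)) x :=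
      ((hd.neg.mul_const s).add (((hasDerivAt_id x).sub_const 1).mul_const (Real.log s))).exp
    have h2 := (h1.const_mul (gmSgn s)).hasFDerivAt
    have e1 : (fun y => gmSgn s * gmW (m y) y s) = (fun y => gmSgn s * Real.exp (-m y * s + (y - 1) * Real.log s)) := by
      ext y; rw [gmW_exp _ _ _ hs]
    rw [e1]
    refine h2.congr_fderiv ?_
    ext
    simp only [F', gmW_exp _ _ _ hs, ContinuousLinearMap.toSpanSingleton_apply, ContinuousLinearMap.smul_apply, ContinuousLinearMap.id_apply, smul_eq_mul]
    ring

lemma gm_zero_s6 (m x : ℝ) (hx : 0 < x) (hm : 0 < m)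
    (h : (∫ t in Set.Ioc (0:ℝ) m, Real.exp (-t) * t ^ (x - 1)) =
        (1/2) * ∫ t in Set.Ioi (0:ℝ), Real.exp (-t) * t ^ (x - 1)) :
    ∫ s in Ioi (0:ℝ), gmSgn s * gmW m x s = 0 := by
  have hi : IntegrableOn (fun t => Real.exp (-t) * t ^ (x - 1)) (Ioi 0) := by
    have := gmW_int 1 x one_pos hx
    refine this.congr_fun ?_ measurableSet_Ioi
    intro t _
    simp [gmW]
  set f : ℝ → ℝ := fun t => Real.exp (-t) * t ^ (x - 1) with hf
  have j1 : IntegrableOn f (Ioc 0 m) := hi.mono_set Ioc_subset_Ioi_self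
  have j2 : IntegrableOn f (Ioi m) := hi.mono_set (Ioi_subset_Ioi hm.le)
  have hsplit : ∫ t in Ioi (0:ℝ), f t = (∫ t in Ioc 0 m, f t) + ∫ t in Ioi m, f t := by
    rw [← Ioc_union_Ioi_eq_Ioi hm.le, setIntegral_union (Ioc_disjoint_Ioi le_rfl) measurableSet_Ioi j1 j2]
  have i1 : ∀ s ∈ Ioc (0:ℝ) m, gmSgn (s / m) * f s = - f s := by
    intro s hs
    have : s / m ≤ 1 := (div_le_one hm).2 hs.2
    simp [gmSgn, this]
  have i2 : ∀ s ∈ Ioi m, gmSgn (s / m) * f s = f s := by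
    intro s hs
    have : ¬ s / m ≤ 1 := by rw [div_le_one hm]; exact not_le.2 hs
    simp [gmSgn, this]
  have e : ∫ t in Ioi (0:ℝ), gmSgn (t / m) * f t = 0 := by
    rw [← Ioc_union_Ioi_eq_Ioi hm.le, setIntegral_union (Ioc_disjoint_Ioi le_rfl) measurableSet_Ioi
      (j1.neg.congr_fun (fun s hs => (i1 s hs).symm) measurableSet_Ioc)
      (j2.congr_fun (fun s hs => (i2 s hs).symm) measurableSet_Ioi),
      setIntegral_congr_fun measurableSet_Ioc i1, setIntegral_congr_fun measurableSet_Ioi i2, integral_neg]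
    linarith
  have c := integral_comp_mul_left_Ioi (fun t => gmSgn (t / m) * f t) 0 hm
  rw [mul_zero, e, smul_zero] at c
  have c2 : ∫ s in Ioi (0:ℝ), gmSgn (m * s / m) * f (m * s) = ∫ s in Ioi (0:ℝ), m ^ (x - 1) * (gmSgn s * gmW m x s) := by
    apply setIntegral_congr_fun measurableSet_Ioi
    intro s hs
    have hs : 0 < s := hs
    simp only [hf, gmW]
    rw [mul_div_cancel_left₀ _ hm.ne', Real.mul_rpow hm.le hs.le, neg_mul]
    ring
  rw [c2, integral_const_mul] at c
  have : 0 < m ^ (x - 1) := by positivity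
  rcases mul_eq_zero.1 c with h | h
  · exact absurd h this.ne'
  · exact h

lemma gm_final (m : ℝ → ℝ) (x m1 : ℝ) (hx : 0 < x)
    (hm : ∀ x > (0:ℝ), 0 < m x ∧
      (∫ t in Set.Ioc (0:ℝ) (m x), Real.exp (-t) * t ^ (x - 1)) =
        (1/2) * ∫ t in Set.Ioi (0:ℝ), Real.exp (-t) * t ^ (x - 1))
    (hd : HasDerivAt m m1 x) : 0 < m1 ∧ m1 < 1 := by
  have hm0 := (hm x hx).1
  have D := gm_deriv_int m x m1 hx hm0 hd
  have Z : (fun y => ∫ s in Ioi (0:ℝ), gmSgn s * gmW (m y) y s) =ᶠ[nhds x] fun _ => 0 := by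
    filter_upwards [Ioi_mem_nhds hx] with y hy
    exact gm_zero_s6 (m y) y hy (hm y hy).1 (hm y hy).2
  have D0 := D.unique ((hasDerivAt_const x (0:ℝ)).congr_of_eventuallyEq Z)
  have hi := gmW_int (m x) x hm0 hx
  have hsi : IntegrableOn (fun s => s * gmW (m x) x s) (Ioi 0) :=
    (gmW_int (m x) (x + 1) hm0 (by linarith)).congr_fun (fun s hs => (gmW_mul_self _ _ s hs).symm) measurableSet_Ioi
  have hli : IntegrableOn (fun s => Real.log s * gmW (m x) x s) (Ioi 0) := by
    have := gm_bound_int 0 (m x) x le_rfl hm0 hx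
    refine Integrable.mono' this (Real.measurable_log.mul (gm_meas _ _)).aestronglyMeasurable ?_
    filter_upwards [ae_restrict_mem measurableSet_Ioi] with s hs
    rw [norm_mul, Real.norm_eq_abs, Real.norm_of_nonneg (gmW_pos _ _ _ hs).le]
    simp
  have bm : ∀ {g : ℝ → ℝ}, IntegrableOn g (Ioi 0) → IntegrableOn (fun s => gmSgn s * g s) (Ioi 0) := by
    intro g hg
    exact hg.bdd_mul (c := 1) gmSgn_meas.aestronglyMeasurable (Eventually.of_forall gmSgn_bd)
  have hz := gm_zero_s6 (m x) x hx hm0 (hm x hx).2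
  have core := gm_core (m x) x hi (by
    refine ((hsi.sub hi).sub hli).congr_fun ?_ measurableSet_Ioi
    intro s _
    simp only [Pi.sub_apply]; ring) hz
  set A := ∫ s in Ioi (0:ℝ), gmSgn s * (s * gmW (m x) x s) with hA
  set B := ∫ s in Ioi (0:ℝ), gmSgn s * (Real.log s * gmW (m x) x s) with hB
  have e1 : ∫ s in Ioi (0:ℝ), gmSgn s * ((-m1 * s + Real.log s) * gmW (m x) x s) = -m1 * A + B := by
    rw [hA, hB, ← integral_const_mul, ← integral_add ((bm hsi).const_mul _) (bm hli)]
    congr 1; ext s; ring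
  have e2 : ∫ s in Ioi (0:ℝ), gmSgn s * ((s - 1 - Real.log s) * gmW (m x) x s) = A - B := by
    have : A - B = A - (∫ s in Ioi (0:ℝ), gmSgn s * gmW (m x) x s) - B := by rw [hz]; ring
    rw [this, hA, hB, ← integral_sub (bm hsi) (bm hi), ← integral_sub (by exact (bm hsi).sub (bm hi)) (bm hli)]
    congr 1; ext s; ring
  have hBpos : 0 < B := by
    rw [hB, setIntegral_pos_iff_support_of_nonneg_ae _ (bm hli)]
    · refine lt_of_lt_of_le ?_ (measure_mono (s := Ioo 1 2) ?_)
      · simp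
      · intro s hs
        have h1 : ¬ s ≤ 1 := not_le.2 hs.1
        have h0 : 0 < s := by linarith [hs.1]
        have := gmW_pos (m x) x s h0
        have := Real.log_pos hs.1
        refine ⟨?_, h0⟩
        simp only [Function.mem_support, gmSgn, h1, if_false]
        positivity
    · filter_upwards [ae_restrict_mem measurableSet_Ioi] with s hs
      have hs : 0 < s := hs
      have hw := gmW_pos (m x) x s hs
      simp only [Pi.zero_apply, gmSgn]
      split_ifs with h
      · have := Real.log_nonpos hs.le h
        nlinarith
      · have := Real.log_pos (not_le.1 h)
        positivity
  rw [e1] at D0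
  rw [e2] at core
  have hApos : 0 < A := by linarith
  constructor
  · by_contra hc
    push Not at hc
    nlinarith
  · by_contra hc
    push Not at hc
    nlinarith

/-- For every `x > 0` one has `0 < m'(x) < 1`, where `m` is the median of
the gamma distribution with parameter `x`; equivalently, with `φ(x) = log (x / m x)`,
`1 − x·φ'(x) < e^{φ(x)}` for all `x > 0`. -/
theorem gammaMedian_deriv_between_zero_and_one (m m' φ' : ℝ → ℝ)
    (hm : ∀ x > (0:ℝ), 0 < m x ∧
      (∫ t in Set.Ioc (0:ℝ) (m x), Real.exp (-t) * t ^ (x - 1)) =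
        (1/2) * ∫ t in Set.Ioi (0:ℝ), Real.exp (-t) * t ^ (x - 1))
    (hm' : ∀ x > (0:ℝ), HasDerivAt m (m' x) x)
    (hφ' : ∀ x > (0:ℝ), HasDerivAt (fun y => Real.log (y / m y)) (φ' x) x) :
    (∀ x > (0:ℝ), 0 < m' x ∧ m' x < 1) ∧
      (∀ x > (0:ℝ), 1 - x * φ' x < Real.exp (Real.log (x / m x))) := by
  have main : ∀ x > (0:ℝ), 0 < m' x ∧ m' x < 1 := fun x hx => gm_final m x (m' x) hx hm (hm' x hx)
  refine ⟨main, ?_⟩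
  intro x hx
  have hm0 := (hm x hx).1
  rw [Real.exp_log (by positivity)]
  have h1 := ((hasDerivAt_id x).div (hm' x hx) hm0.ne').log (by simp only [id, Pi.div_apply]; positivity)
  have h2 := (hφ' x hx).unique h1
  simp only [id, Pi.div_apply] at h2
  have h3 : 1 - x * φ' x = x * m' x / m x := by
    rw [h2]; field_simp; ring
  rw [h3]
  apply div_lt_div_of_pos_right _ hm0
  nlinarith [(main x hx).2]
end

section
/- The function x ↦ m(x) − x is strictly decreasing on (0,∞). In particular the sequence m(n) − n, n ≥ 1, is strictly decreasing (the conjecture of Chen and Rubin). -/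
open MeasureTheory Filter Set

def SC (h : ℝ → ℝ) : Prop := ∀ s t, 0 < s → s < t → 0 < h s → 0 < h t

lemma SC_of_deriv {H h p : ℝ → ℝ} (h0 : H 0 = 0) (hd : ∀ t, HasDerivAt H (p t * h t) t)
    (hp : ∀ t, 0 < p t) (hS : SC h) : SC H := by
  intro s t hs hst hHs
  have hc : Continuous H := continuous_iff_continuousAt.2 fun t => (hd t).continuousAt
  obtain ⟨r, hr, hr'⟩ := exists_hasDerivAt_eq_slope H _ hs hc.continuousOn (fun x _ => hd x)
  rw [h0, sub_zero, sub_zero] at hr'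
  have hr2 : 0 < h r := by
    have : 0 < p r * h r := by rw [hr']; positivity
    exact (mul_pos_iff_of_pos_left (hp r)).1 this
  obtain ⟨q, hq, hq'⟩ := exists_hasDerivAt_eq_slope H _ hst hc.continuousOn (fun x _ => hd x)
  have : 0 < p q * h q := mul_pos (hp q) (hS r q hr.1 (hr.2.trans hq.1) hr2)
  rw [hq'] at this
  have h3 : 0 < t - s := sub_pos.2 hst
  have := (div_pos_iff_of_pos_right h3).1 this
  linarith

lemma SC_k (c : ℝ) (hc : 0 < c) : SC (fun T => c^2*(1+c)*Real.exp T + (3*c-1-c^2-c^3) - c*(1-c)^2*T) := by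
  intro s t hs hst h
  simp only at h ⊢
  have e1 := Real.add_one_le_exp t
  have hc2 : 0 < c^2*(1+c) := by positivity
  rcases le_or_gt (1/3) c with h3 | h3
  · have ht : 0 < t := hs.trans hst
    have e1 : t + 1 < Real.exp t := Real.add_one_lt_exp ht.ne'
    have := mul_lt_mul_of_pos_left e1 hc2
    have : 0 ≤ c * (3*c-1) * t := by
      have : 0 ≤ 3*c-1 := by linarith
      positivity
    nlinarith
  · -- convexity : exp s * (1 + (t-s)) <= exp t, exp s * (1 - s) <= 1
    have a1 : Real.exp s * (1 + (t-s)) ≤ Real.exp t := by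
      have := Real.add_one_le_exp (t-s)
      have h2 : Real.exp t = Real.exp s * Real.exp (t-s) := by rw [← Real.exp_add]; ring_nf
      rw [h2]; gcongr; linarith
    have a2 : Real.exp s * (1 - s) ≤ 1 := by
      have := Real.add_one_le_exp (-s)
      have h2 : (1:ℝ) = Real.exp s * Real.exp (-s) := by rw [← Real.exp_add]; simp
      conv_rhs => rw [h2]
      gcongr; linarith
    -- slope at s is positive
    have b : 0 < (c^2*(1+c)*Real.exp s - c*(1-c)^2) * s := by nlinarith
    have b2 : 0 < c^2*(1+c)*Real.exp s - c*(1-c)^2 := pos_of_mul_pos_left b hs.le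
    have b3 := mul_pos b2 (sub_pos.2 hst)
    nlinarith

lemma SC_h (c : ℝ) (hc : 0 < c) :
    SC (fun T => Real.exp (c*T) * (Real.exp T - 1 - T) - (Real.exp T * (T-1) + 1)) := by
  have hE : ∀ t : ℝ, HasDerivAt (fun T : ℝ => Real.exp T) (Real.exp t) t := Real.hasDerivAt_exp
  have hN : ∀ t : ℝ, HasDerivAt (fun T : ℝ => Real.exp (-T)) (-Real.exp (-t)) t := fun t => by
    simpa using (hasDerivAt_neg t).exp
  have hC : ∀ t : ℝ, HasDerivAt (fun T : ℝ => Real.exp (c*T)) (c*Real.exp (c*t)) t := fun t => by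
    simpa [mul_comm] using ((hasDerivAt_id t).const_mul c).exp
  have hI : ∀ t : ℝ, HasDerivAt (fun T : ℝ => T) 1 t := hasDerivAt_id
  have hinv : ∀ t, Real.exp t * Real.exp (-t) = 1 := fun t => by rw [← Real.exp_add]; simp
  refine SC_of_deriv (p := fun t => Real.exp t) (h := fun T => Real.exp (c*T) * ((1+c) - (1+c)*Real.exp (-T) - c*T*Real.exp (-T)) - T) (by simp) ?_ (fun t => Real.exp_pos t) ?_
  · intro t
    have := ((hC t).mul (((hE t).sub_const 1).sub (hI t))).sub (((hE t).mul ((hI t).sub_const 1)).add_const 1)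
    refine this.congr_deriv ?_
    simp only [Pi.sub_apply, Pi.mul_apply, Pi.add_apply]
    linear_combination ((1+c) + c*t) * Real.exp (c*t) * hinv t
  refine SC_of_deriv (p := fun t => 1) (h := fun T => Real.exp (c*T) * (c*(1+c) + (1-c-c^2)*Real.exp (-T) + c*(1-c)*T*Real.exp (-T)) - 1) (by simp) ?_ (fun t => one_pos) ?_
  · intro t
    have := ((hC t).mul ((((hN t).const_mul (1+c)).const_sub (1+c)).sub (((hI t).const_mul c).mul (hN t)))).sub (hI t)
    refine this.congr_deriv ?_
    simp only [Pi.sub_apply, Pi.mul_apply, Pi.add_apply]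
    ring
  refine SC_of_deriv (p := fun t => Real.exp (c*t) * Real.exp (-t)) (by simp; try ring) ?_ (fun t => by positivity) (SC_k c hc)
  intro t
  have := ((hC t).mul ((((hN t).const_mul (1-c-c^2)).const_add (c*(1+c))).add (((hI t).const_mul (c*(1-c))).mul (hN t)))).sub_const 1
  refine this.congr_deriv ?_
  simp only [Pi.sub_apply, Pi.mul_apply, Pi.add_apply]
  linear_combination (-(c^2*(1+c))) * Real.exp (c*t) * hinv t

lemma h_neg (c : ℝ) (hc : c ≤ 0) (T : ℝ) (hT : 0 < T) :
    Real.exp (c*T) * (Real.exp T - 1 - T) - (Real.exp T * (T-1) + 1) < 0 := by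
  have h1 : Real.exp (c*T) ≤ 1 := by
    rw [Real.exp_le_one_iff]; nlinarith
  have h2 : 0 ≤ Real.exp T - 1 - T := by linarith [Real.add_one_le_exp T]
  have h3 : Real.exp (c*T) * (Real.exp T - 1 - T) ≤ 1 * (Real.exp T - 1 - T) := by gcongr
  have hE : ∀ t : ℝ, HasDerivAt (fun T : ℝ => Real.exp T) (Real.exp t) t := Real.hasDerivAt_exp
  have hI : ∀ t : ℝ, HasDerivAt (fun T : ℝ => T) 1 t := hasDerivAt_id
  have hd : ∀ t, HasDerivAt (fun T => Real.exp T * (T-2) + 2 + T) (Real.exp t * (t-1) + 1) t := by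
    intro t
    have := (((hE t).mul ((hI t).sub_const 2)).add_const 2).add (hI t)
    refine this.congr_deriv ?_
    ring
  have hm : StrictMonoOn (fun T => Real.exp T * (T-2) + 2 + T) (Ici 0) := by
    apply strictMonoOn_of_deriv_pos (convex_Ici 0) (by fun_prop)
    intro t ht
    rw [interior_Ici] at ht
    rw [(hd t).deriv]
    have e := Real.add_one_lt_exp (x := -t) (neg_ne_zero.2 (ne_of_gt ht))
    have hinv : Real.exp t * Real.exp (-t) = 1 := by rw [← Real.exp_add]; simp
    have := mul_lt_mul_of_pos_left e (Real.exp_pos t)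
    nlinarith
  have := hm (by simp) (by simpa using hT.le) hT
  simp at this
  linarith

lemma h_ex (c : ℝ) (hc : 0 < c) : ∃ T, 0 < T ∧
    0 < Real.exp (c*T) * (Real.exp T - 1 - T) - (Real.exp T * (T-1) + 1) := by
  have hT2 : 0 < 8/c^2 := by positivity
  refine ⟨8/c^2+2, by positivity, ?_⟩
  have hT8 : c^2 * (8/c^2+2) ≥ 8 := by
    rw [mul_add, mul_div_cancel₀ _ (by positivity)]; nlinarith
  generalize hT : 8/c^2+2 = T at *
  have hT : 2 < T := by linarith
  have e1 := Real.quadratic_le_exp_of_nonneg (x := c*T) (by positivity)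
  have e2 := Real.quadratic_le_exp_of_nonneg (x := T) (by positivity)
  have e3 : Real.exp T / 4 ≤ Real.exp T - 1 - T := by nlinarith
  have e4 : 4 * T ≤ Real.exp (c*T) := by
    have : 0 < c * T := by positivity
    nlinarith
  have e5 : 4 * T * (Real.exp T / 4) ≤ Real.exp (c*T) * (Real.exp T - 1 - T) := by
    gcongr
  nlinarith

lemma cov (v v' : ℝ → ℝ) (hv : ∀ T, 0 < T → HasDerivAt v (v' T) T) (hinj : InjOn v (Ioi 0))
    (hpos : ∀ T, 0 < T → 0 < v T) (z c : ℝ) (hz : 0 < z) (hzc : 0 < z + c) :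
    IntegrableOn (fun T => Real.exp (-z * (v T - Real.log (v T))) * (v T ^ (c-1) * |v' T|)) (Ioi 0) ∧
    ∫ t in (fun T => z * v T) '' Ioi 0, Real.exp (-t) * t ^ (z + c - 1) =
      z ^ (z+c) * ∫ T in Ioi 0, Real.exp (-z * (v T - Real.log (v T))) * (v T ^ (c-1) * |v' T|) := by
  have hd : ∀ T ∈ Ioi (0:ℝ), HasDerivWithinAt (fun T => z * v T) (z * v' T) (Ioi 0) T :=
    fun T hT => ((hv T hT).const_mul z).hasDerivWithinAt
  have hi : InjOn (fun T => z * v T) (Ioi 0) := by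
    intro a ha b hb hab
    exact hinj ha hb (mul_left_cancel₀ hz.ne' hab)
  have key : ∀ T ∈ Ioi (0:ℝ), |z * v' T| • (Real.exp (-(z * v T)) * (z * v T) ^ (z + c - 1)) =
      z ^ (z+c) * (Real.exp (-z * (v T - Real.log (v T))) * (v T ^ (c-1) * |v' T|)) := by
    intro T hT
    have hp := hpos T hT
    rw [smul_eq_mul, abs_mul, abs_of_pos hz, Real.mul_rpow hz.le hp.le,
      show z + c - 1 = z + (c - 1) by ring, Real.rpow_add hp, Real.rpow_add hz z (c-1),
      Real.rpow_sub_one hz.ne', Real.rpow_add hz z c,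
      show -z * (v T - Real.log (v T)) = -(z * v T) + Real.log (v T) * z by ring, Real.exp_add,
      ← Real.rpow_def_of_pos hp]
    field_simp
  have hzp : 0 < z ^ (z+c) := by positivity
  have hint : IntegrableOn (fun t => Real.exp (-t) * t ^ (z + c - 1)) ((fun T => z * v T) '' Ioi 0) := by
    refine (Real.GammaIntegral_convergent hzc).mono_set ?_
    rintro _ ⟨T, hT, rfl⟩
    exact mul_pos hz (hpos T hT)
  constructor
  · rw [integrableOn_image_iff_integrableOn_abs_deriv_smul measurableSet_Ioi hd hi] at hint
    have := (integrableOn_congr_fun key measurableSet_Ioi).1 hint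
    have h2 := this.const_mul (z ^ (z+c))⁻¹
    refine IntegrableOn.congr_fun h2 (fun T _ => ?_) measurableSet_Ioi
    rw [inv_mul_cancel_left₀ hzp.ne']
  · rw [integral_image_eq_integral_abs_deriv_smul measurableSet_Ioi hd hi,
      setIntegral_congr_fun measurableSet_Ioi key, integral_const_mul]

lemma E_pos {T : ℝ} (hT : 0 < T) : 0 < Real.exp T - 1 := by
  linarith [Real.add_one_le_exp T]

lemma M_pos {T : ℝ} (hT : 0 < T) : 0 < Real.exp T - 1 - T := by
  linarith [Real.add_one_lt_exp hT.ne']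

lemma N_pos {T : ℝ} (hT : 0 < T) : 0 < Real.exp T * (T - 1) + 1 := by
  have e := Real.add_one_lt_exp (x := -T) (neg_ne_zero.2 (ne_of_gt hT))
  have hinv : Real.exp T * Real.exp (-T) = 1 := by rw [← Real.exp_add]; simp
  have := mul_lt_mul_of_pos_left e (Real.exp_pos T)
  nlinarith

noncomputable def uu (T : ℝ) : ℝ := T * Real.exp T / (Real.exp T - 1)
noncomputable def ll (T : ℝ) : ℝ := T / (Real.exp T - 1)
noncomputable def hh (c T : ℝ) : ℝ :=
  Real.exp (c*T) * (Real.exp T - 1 - T) - (Real.exp T * (T-1) + 1)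
noncomputable def QQ (T : ℝ) : ℝ := uu T - Real.log (uu T)
noncomputable def WW (c T : ℝ) : ℝ := ll T ^ (c-1) / (Real.exp T - 1)^2

lemma uu_deriv {T : ℝ} (hT : 0 < T) :
    HasDerivAt uu (Real.exp T * (Real.exp T - 1 - T) / (Real.exp T - 1)^2) T := by
  have h := ((hasDerivAt_id T).mul (Real.hasDerivAt_exp T)).div
    ((Real.hasDerivAt_exp T).sub_const 1) (E_pos hT).ne'
  refine h.congr_deriv ?_
  have := (E_pos hT).ne'
  simp only [id, one_mul, mul_one, Pi.mul_apply]
  field_simp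
  ring

lemma ll_deriv {T : ℝ} (hT : 0 < T) :
    HasDerivAt ll (-(Real.exp T * (T - 1) + 1) / (Real.exp T - 1)^2) T := by
  have h := (hasDerivAt_id T).div
    ((Real.hasDerivAt_exp T).sub_const 1) (E_pos hT).ne'
  refine h.congr_deriv ?_
  have := (E_pos hT).ne'
  simp only [id, one_mul, mul_one, Pi.mul_apply]
  field_simp
  ring

lemma ll_pos {T : ℝ} (hT : 0 < T) : 0 < ll T := div_pos hT (E_pos hT)
lemma uu_eq (T : ℝ) : uu T = ll T * Real.exp T := by unfold uu ll; ring
lemma uu_pos {T : ℝ} (hT : 0 < T) : 0 < uu T := by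
  rw [uu_eq]; exact mul_pos (ll_pos hT) (Real.exp_pos T)
lemma uu_sub {T : ℝ} (hT : 0 < T) : uu T = ll T + T := by
  have := (E_pos hT).ne'
  unfold uu ll
  field_simp
  ring
lemma uu_gt {T : ℝ} (hT : 0 < T) : 1 < uu T := by
  unfold uu
  rw [lt_div_iff₀ (E_pos hT)]
  have := N_pos hT
  linarith
lemma ll_lt {T : ℝ} (hT : 0 < T) : ll T < 1 := by
  unfold ll
  rw [div_lt_one (E_pos hT)]
  linarith [M_pos hT]

lemma QQ_eq {T : ℝ} (hT : 0 < T) : ll T - Real.log (ll T) = QQ T := by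
  unfold QQ
  have : Real.log (uu T) = Real.log (ll T) + T := by
    rw [uu_eq, Real.log_mul (ll_pos hT).ne' (Real.exp_pos T).ne', Real.log_exp]
  rw [this, uu_sub hT]; ring

lemma uu_mono : StrictMonoOn uu (Ioi 0) := by
  apply strictMonoOn_of_deriv_pos (convex_Ioi 0)
    (fun t ht => (uu_deriv ht).continuousAt.continuousWithinAt)
  intro t ht
  rw [interior_Ioi] at ht
  rw [(uu_deriv ht).deriv]
  exact div_pos (mul_pos (Real.exp_pos _) (M_pos ht)) (pow_pos (E_pos ht) 2)

lemma ll_anti : StrictAntiOn ll (Ioi 0) := by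
  apply strictAntiOn_of_deriv_neg (convex_Ioi 0)
    (fun t ht => (ll_deriv ht).continuousAt.continuousWithinAt)
  intro t ht
  rw [interior_Ioi] at ht
  rw [(ll_deriv ht).deriv]
  exact div_neg_of_neg_of_pos (neg_neg_of_pos (N_pos ht)) (pow_pos (E_pos ht) 2)

lemma QQ_mono : StrictMonoOn QQ (Ioi 0) := by
  have hd : ∀ t : ℝ, 0 < t → HasDerivAt QQ (Real.exp t * (Real.exp t - 1 - t) / (Real.exp t - 1)^2
     - Real.exp t * (Real.exp t - 1 - t) / (Real.exp t - 1)^2 / uu t) t := fun t ht =>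
    (uu_deriv ht).sub ((uu_deriv ht).log (uu_pos ht).ne')
  apply strictMonoOn_of_deriv_pos (convex_Ioi 0)
    (fun t ht => (hd t ht).continuousAt.continuousWithinAt)
  intro t ht
  rw [interior_Ioi] at ht
  rw [(hd t ht).deriv, sub_pos]
  exact div_lt_self (div_pos (mul_pos (Real.exp_pos _) (M_pos ht)) (pow_pos (E_pos ht) 2)) (uu_gt ht)

lemma uu_image (z : ℝ) (hz : 0 < z) : (fun T => z * uu T) '' Ioi 0 = Ioi z := by
  ext t
  constructor
  · rintro ⟨T, hT, rfl⟩
    have := uu_gt hT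
    simp only [mem_Ioi]
    nlinarith
  · intro ht
    have ht : 1 < t / z := by rwa [one_lt_div hz]
    set v := t / z with hv
    have h1 : uu (v - 1) ≤ v := by
      have := uu_sub (sub_pos.2 ht)
      have := ll_lt (sub_pos.2 ht)
      linarith
    have h2 : v ≤ uu v := by
      have := uu_sub (T := v) (by linarith)
      have := ll_pos (T := v) (by linarith)
      linarith
    obtain ⟨T, hT, hT'⟩ := intermediate_value_Icc (show v - 1 ≤ v by linarith) (f := uu)
      (fun s hs => (uu_deriv (by linarith [hs.1])).continuousAt.continuousWithinAt) ⟨h1, h2⟩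
    refine ⟨T, by simp only [mem_Ioi]; linarith [hT.1], ?_⟩
    simp only [hT', hv]
    field_simp

lemma ll_image (z : ℝ) (hz : 0 < z) : (fun T => z * ll T) '' Ioi 0 = Ioo 0 z := by
  ext t
  constructor
  · rintro ⟨T, hT, rfl⟩
    have := ll_lt hT
    have := ll_pos hT
    simp only [mem_Ioo]
    constructor
    · positivity
    · nlinarith
  · rintro ⟨ht0, ht⟩
    have ht : t / z < 1 := by rwa [div_lt_one hz]
    have hv0 : 0 < t / z := by positivity
    set v := t / z with hv
    have hl : 0 < -Real.log v := by
      have := Real.log_neg hv0 ht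
      linarith
    have h1 : v ≤ ll (-Real.log v) := by
      have h3 := uu_gt hl
      rw [uu_eq, Real.exp_neg, Real.exp_log hv0] at h3
      have := mul_lt_mul_of_pos_right h3 hv0
      rw [inv_mul_cancel_right₀ hv0.ne'] at this
      linarith
    have h0 : 0 < 2 / v := by positivity
    have h2 : ll (2/v) ≤ v := by
      have e := Real.quadratic_le_exp_of_nonneg h0.le
      unfold ll
      rw [div_le_iff₀ (E_pos h0)]
      have : v * (2/v + (2/v)^2/2) ≤ v * (Real.exp (2/v) - 1) := by
        gcongr; linarith
      have h5 : v * (2/v + (2/v)^2/2) = 2 + 2/v := by field_simp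
      linarith
    have h6 : -Real.log v ≤ 2 / v := by
      have := Real.add_one_le_exp (-Real.log v)
      rw [Real.exp_neg, Real.exp_log hv0] at this
      have : v⁻¹ ≤ 2 / v := by rw [div_eq_mul_inv]; linarith [inv_pos.2 hv0]
      linarith
    obtain ⟨T, hT, hT'⟩ := intermediate_value_Icc' h6 (f := ll)
      (fun s hs => (ll_deriv (by linarith [hs.1])).continuousAt.continuousWithinAt) ⟨h2, h1⟩
    refine ⟨T, by simp only [mem_Ioi]; linarith [hT.1], ?_⟩
    simp only [hT', hv]
    field_simp

lemma WW_pos (c : ℝ) {T : ℝ} (hT : 0 < T) : 0 < WW c T :=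
  div_pos (Real.rpow_pos_of_pos (ll_pos hT) _) (pow_pos (E_pos hT) 2)

/-- The difference of the upper and lower gamma integrals. -/
lemma diff_eq (z c : ℝ) (hz : 0 < z) (hzc : 0 < z + c) :
    IntegrableOn (fun T => Real.exp (-z * QQ T) * (WW c T * hh c T)) (Ioi 0) ∧
    (∫ t in Ioi z, Real.exp (-t) * t ^ (z + c - 1)) - (∫ t in Ioc 0 z, Real.exp (-t) * t ^ (z + c - 1))
      = z ^ (z+c) * ∫ T in Ioi 0, Real.exp (-z * QQ T) * (WW c T * hh c T) := by
  obtain ⟨iu, eu⟩ := cov uu _ (fun T hT => uu_deriv hT) uu_mono.injOn (fun T hT => uu_pos hT) z c hz hzc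
  obtain ⟨il, el⟩ := cov ll _ (fun T hT => ll_deriv hT) ll_anti.injOn (fun T hT => ll_pos hT) z c hz hzc
  rw [uu_image z hz] at eu
  rw [ll_image z hz] at el
  have key : ∀ T ∈ Ioi (0:ℝ),
      Real.exp (-z * (uu T - Real.log (uu T))) * (uu T ^ (c-1) * |Real.exp T * (Real.exp T - 1 - T) / (Real.exp T - 1)^2|)
      - Real.exp (-z * (ll T - Real.log (ll T))) * (ll T ^ (c-1) * |-(Real.exp T * (T - 1) + 1) / (Real.exp T - 1)^2|)
      = Real.exp (-z * QQ T) * (WW c T * hh c T) := by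
    intro T hT
    have hE := pow_pos (E_pos hT) 2
    rw [QQ_eq hT, neg_div, abs_neg, abs_of_pos (div_pos (N_pos hT) hE),
      abs_of_pos (div_pos (mul_pos (Real.exp_pos T) (M_pos hT)) hE), uu_eq,
      Real.mul_rpow (ll_pos hT).le (Real.exp_pos T).le, ← Real.exp_mul, ← uu_eq]
    have h1 : Real.exp (T * (c-1)) * Real.exp T = Real.exp (c*T) := by
      rw [← Real.exp_add]; ring_nf
    unfold WW hh
    rw [← h1]
    change Real.exp (-z * QQ T) * _ - _ = _
    ring
  constructor
  · exact (iu.sub il).congr_fun key measurableSet_Ioi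
  · rw [integral_Ioc_eq_integral_Ioo, eu, el, ← mul_sub, ← integral_sub iu il,
      setIntegral_congr_fun measurableSet_Ioi key]

lemma main_sign (c z₀ z₁ : ℝ) (hz : 0 < z₀) (hzc : 0 < z₀ + c) (hlt : z₀ < z₁)
    (h0 : ∫ T in Ioi 0, Real.exp (-z₀ * QQ T) * (WW c T * hh c T) = 0) :
    ∫ T in Ioi 0, Real.exp (-z₁ * QQ T) * (WW c T * hh c T) < 0 := by
  have i0 := (diff_eq z₀ c hz hzc).1
  have i1 := (diff_eq z₁ c (by linarith) (by linarith)).1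
  rcases le_or_gt c 0 with hc | hc
  · exfalso
    have : 0 < ∫ T in Ioi 0, -(Real.exp (-z₀ * QQ T) * (WW c T * hh c T)) := by
      have hp : ∀ T ∈ Ioi (0:ℝ), 0 < -(Real.exp (-z₀ * QQ T) * (WW c T * hh c T)) := fun T hT => by
        have := mul_pos (Real.exp_pos (-z₀ * QQ T))
          (mul_pos (WW_pos c hT) (neg_pos.2 (h_neg c hc T hT)))
        unfold hh
        linarith
      refine (setIntegral_pos_iff_support_of_nonneg_ae ?_ i0.neg).2 ?_
      rotate_left
      · refine lt_of_lt_of_le (b := volume (Ioi (0:ℝ))) (by simp) (measure_mono fun T hT => ⟨(hp T hT).ne', hT⟩)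
      · exact (ae_restrict_mem measurableSet_Ioi).mono fun T hT => (hp T hT).le
    rw [integral_neg, h0] at this
    simp at this
  · have hS : ∀ s t, 0 < s → s < t → 0 < hh c s → 0 < hh c t := SC_h c hc
    obtain ⟨s, hs, hs'⟩ := h_ex c hc
    change 0 < hh c s at hs'
    set S := {T | 0 < T ∧ 0 < hh c T} with hSdef
    set q := sInf (QQ '' S) with hq
    have hbdd : BddBelow (QQ '' S) := by
      refine ⟨0, ?_⟩
      rintro _ ⟨T, hT, rfl⟩
      have := Real.log_le_sub_one_of_pos (uu_pos hT.1)
      unfold QQ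
      linarith
    have hq1 : ∀ T, 0 < T → 0 < hh c T → q ≤ QQ T := fun T hT h => csInf_le hbdd ⟨T, ⟨hT, h⟩, rfl⟩
    have hq2 : ∀ T, 0 < T → hh c T ≤ 0 → QQ T ≤ q := by
      intro T hT h
      refine le_csInf ⟨_, s, ⟨hs, hs'⟩, rfl⟩ ?_
      rintro _ ⟨r, hr, rfl⟩
      rcases lt_trichotomy r T with h3 | h3 | h3
      · exact absurd (hS r T hr.1 h3 hr.2) (not_lt.2 h)
      · exact absurd hr.2 (by rw [h3]; exact not_lt.2 h)
      · exact (QQ_mono hT hr.1 h3).le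
    have hfac : ∀ z T : ℝ, Real.exp (z * q) * (Real.exp (-z * QQ T) * (WW c T * hh c T)) =
        Real.exp (z * (q - QQ T)) * (WW c T * hh c T) := fun z T => by
      rw [← mul_assoc, ← Real.exp_add]; ring_nf
    set F : ℝ → ℝ := fun T => Real.exp (z₀ * q) * (Real.exp (-z₀ * QQ T) * (WW c T * hh c T))
      - Real.exp (z₁ * q) * (Real.exp (-z₁ * QQ T) * (WW c T * hh c T)) with hF
    have hFe : ∀ T, F T = (Real.exp (z₀ * (q - QQ T)) - Real.exp (z₁ * (q - QQ T))) * (WW c T * hh c T) := by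
      intro T
      rw [hF]; simp only [hfac]; ring
    have hF0 : ∀ T ∈ Ioi (0:ℝ), 0 ≤ F T := by
      intro T hT
      rw [hFe]
      rcases le_or_gt (hh c T) 0 with h | h
      · have := hq2 T hT h
        apply mul_nonneg_of_nonpos_of_nonpos
        · rw [sub_nonpos, Real.exp_le_exp]; nlinarith
        · exact mul_nonpos_of_nonneg_of_nonpos (WW_pos c hT).le h
      · have := hq1 T hT h
        apply mul_nonneg
        · rw [sub_nonneg, Real.exp_le_exp]; nlinarith
        · exact (mul_pos (WW_pos c hT) h).le
    have hFs : ∀ T ∈ Ioi s, 0 < F T := by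
      intro T hT
      have hT0 : 0 < T := hs.trans hT
      rw [hFe]
      have h1 := hq1 s hs hs'
      have h2 := QQ_mono hs hT0 hT
      apply mul_pos
      · rw [sub_pos, Real.exp_lt_exp]; nlinarith
      · exact (mul_pos (WW_pos c hT0) (hS s T hs hT hs'))
    have iF : IntegrableOn F (Ioi 0) := (i0.const_mul _).sub (i1.const_mul _)
    have hpos : 0 < ∫ T in Ioi 0, F T := by
      rw [setIntegral_pos_iff_support_of_nonneg_ae _ iF]
      · refine lt_of_lt_of_le (b := volume (Ioi s)) (by simp) (measure_mono fun T hT => ⟨(hFs T hT).ne', hs.trans hT⟩)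
      · exact (ae_restrict_mem measurableSet_Ioi).mono hF0
    rw [hF, integral_sub (i0.const_mul _) (i1.const_mul _), integral_const_mul, integral_const_mul, h0] at hpos
    have he := Real.exp_pos (z₁ * q)
    by_contra hcon
    have := mul_nonneg he.le (not_lt.1 hcon)
    linarith

/-- The function `x ↦ m(x) − x` is strictly decreasing on `(0,∞)`, where
`m` is the median of the gamma distribution; in particular the sequence `m(n) − n`, `n ≥ 1`,
is strictly decreasing (the conjecture of Chen and Rubin). -/
theorem gammaMedian_sub_id_strictAnti (m : ℝ → ℝ)
    (hm : ∀ x > (0:ℝ), 0 < m x ∧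
      (∫ t in Set.Ioc (0:ℝ) (m x), Real.exp (-t) * t ^ (x - 1)) =
        (1/2) * ∫ t in Set.Ioi (0:ℝ), Real.exp (-t) * t ^ (x - 1)) :
    StrictAntiOn (fun x => m x - x) (Set.Ioi 0) ∧
      ∀ n : ℕ, 1 ≤ n → m ((n:ℝ) + 1) - ((n:ℝ) + 1) < m (n:ℝ) - (n:ℝ) := by
  have main : StrictAntiOn (fun x => m x - x) (Set.Ioi 0) := by
    intro x hx y hy hxy
    have hx : 0 < x := hx
    have hy : 0 < y := hy
    have split : ∀ p z : ℝ, 0 < p → 0 < z → (∫ t in Ioi 0, Real.exp (-t) * t ^ (p - 1)) =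
        (∫ t in Ioc 0 z, Real.exp (-t) * t ^ (p - 1)) + ∫ t in Ioi z, Real.exp (-t) * t ^ (p - 1) := by
      intro p z hp hz
      have hi := Real.GammaIntegral_convergent hp
      rw [← setIntegral_union (Ioc_disjoint_Ioi le_rfl) measurableSet_Ioi
        (hi.mono_set Ioc_subset_Ioi_self) (hi.mono_set (Ioi_subset_Ioi hz.le)),
        Ioc_union_Ioi_eq_Ioi hz.le]
    obtain ⟨hmx, ex⟩ := hm x hx
    obtain ⟨hmy, ey⟩ := hm y hy
    have hz1 : 0 < m x + (y - x) := by linarith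
    have d0 := (diff_eq (m x) (x - m x) hmx (by linarith)).2
    have d1 := (diff_eq (m x + (y - x)) (x - m x) hz1 (by linarith)).2
    have s := main_sign (x - m x) (m x) (m x + (y - x)) hmx (by linarith) (by linarith)
    rw [show m x + (x - m x) = x by ring] at d0
    rw [show m x + (y - x) + (x - m x) = y by ring] at d1
    have sx := split x (m x) hx hmx
    have sy := split y _ hy hz1
    have h0 : m x ^ x * ∫ T in Ioi 0, Real.exp (-(m x) * QQ T) * (WW (x - m x) T * hh (x - m x) T) = 0 := by
      rw [← d0]; linarith
    have hne : m x ^ x ≠ 0 := (Real.rpow_pos_of_pos hmx _).ne'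
    have s1 := s ((mul_eq_zero.1 h0).resolve_left hne)
    have s2 := mul_neg_of_pos_of_neg (Real.rpow_pos_of_pos hz1 y) s1
    rw [← d1] at s2
    by_contra hcon
    have hle : m x + (y - x) ≤ m y := by simp only [not_lt] at hcon; linarith
    have hmono : (∫ t in Ioc 0 (m x + (y - x)), Real.exp (-t) * t ^ (y - 1)) ≤
        ∫ t in Ioc 0 (m y), Real.exp (-t) * t ^ (y - 1) := by
      refine setIntegral_mono_set ((Real.GammaIntegral_convergent hy).mono_set Ioc_subset_Ioi_self) ?_
        (LE.le.eventuallyLE (Ioc_subset_Ioc_right hle))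
      refine (ae_restrict_mem measurableSet_Ioc).mono fun t ht => ?_
      exact mul_nonneg (Real.exp_pos _).le (Real.rpow_nonneg ht.1.le _)
    linarith
  refine ⟨main, fun n hn => ?_⟩
  have hn' : (0:ℝ) < n := by exact_mod_cast hn
  exact main (mem_Ioi.2 hn') (mem_Ioi.2 (by linarith)) (by linarith)
end
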